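/- Let Ω ⊂⊂ ℂⁿ be a pseudoconvex domain with smooth boundary. If the set of infinite type boundary points of Ω (in the sense of D'Angelo) is finite, then S(Ω) = 1. -/

import Mathlib

noncomputable section

open Complex Topology
open scoped ENNReal

/-- Wirtinger derivative `∂f/∂z_j`. -/
def dz {n : ℕ} (j : Fin n) (f : (Fin n → ℂ) → ℂ) (z : Fin n → ℂ) : ℂ :=
  (fderiv ℝ f z (Pi.single j 1) - Complex.I * fderiv ℝ f z (Pi.single j Complex.I)) / 2

/-- Wirtinger derivative `∂f/∂z̄_j`. -/
def dzbar {n : ℕ} (j : Fin n) (f : (Fin n → ℂ) → ℂ) (z : Fin n → ℂ) : ℂ :=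
  (fderiv ℝ f z (Pi.single j 1) + Complex.I * fderiv ℝ f z (Pi.single j Complex.I)) / 2

/-- Complexification of a real-valued function. -/
def cplx {n : ℕ} (ρ : (Fin n → ℂ) → ℝ) : (Fin n → ℂ) → ℂ := fun z => (ρ z : ℂ)

/-- The Levi form `L_ρ(X,Y)(z) = Σ_{j,k} ∂²ρ/∂z_j∂z̄_k (z) X_j conj(Y_k)`. -/
def levi {n : ℕ} (ρ : (Fin n → ℂ) → ℝ) (X Y : Fin n → ℂ) (z : Fin n → ℂ) : ℂ :=
  ∑ j, ∑ k, dz j (fun w => dzbar k (cplx ρ) w) z * X j * (starRingEnd ℂ) (Y k)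

/-- `Xf = Σ_j X_j ∂f/∂z_j` for a (1,0) vector `X`. -/
def dirDeriv {n : ℕ} (X : Fin n → ℂ) (f : (Fin n → ℂ) → ℂ) (z : Fin n → ℂ) : ℂ :=
  ∑ j, X j * dz j f z

/-- `X̄f = Σ_j conj(X_j) ∂f/∂z̄_j`. -/
def dirDerivBar {n : ℕ} (X : Fin n → ℂ) (f : (Fin n → ℂ) → ℂ) (z : Fin n → ℂ) : ℂ :=
  ∑ j, (starRingEnd ℂ) (X j) * dzbar j f z

/-- Derivative of `f` along the (1,0) vector field `X`. -/
def fieldDeriv {n : ℕ} (X : (Fin n → ℂ) → (Fin n → ℂ)) (f : (Fin n → ℂ) → ℂ)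
    (z : Fin n → ℂ) : ℂ :=
  dirDeriv (X z) f z

/-- Euclidean norm of the real gradient of `ρ`. -/
def gradNorm {n : ℕ} (ρ : (Fin n → ℂ) → ℝ) (z : Fin n → ℂ) : ℝ :=
  Real.sqrt (∑ j, ((fderiv ℝ ρ z (Pi.single j 1)) ^ 2 +
    (fderiv ℝ ρ z (Pi.single j Complex.I)) ^ 2))

/-- The complex normal field `N_ρ`. -/
def nfield {n : ℕ} (ρ : (Fin n → ℂ) → ℝ) (z : Fin n → ℂ) : Fin n → ℂ := fun j =>
  ((Real.sqrt (∑ k, Complex.normSq (dz k (cplx ρ) z)) : ℝ) : ℂ)⁻¹ * dzbar j (cplx ρ) z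

/-- Squared Euclidean norm of a vector in ℂⁿ. -/
def enormSq {n : ℕ} (X : Fin n → ℂ) : ℝ := ∑ j, Complex.normSq (X j)

/-- `f` is strictly plurisubharmonic on `S`. -/
def StrictPSHOn {n : ℕ} (f : (Fin n → ℂ) → ℝ) (S : Set (Fin n → ℂ)) : Prop :=
  ∀ z ∈ S, ∀ X : Fin n → ℂ, X ≠ 0 → 0 < (levi f X X z).re

/-- `ρ` is a (global smooth) defining function of `Ω` on the neighborhood `V` of `cl Ω`. -/
structure IsDefFn {n : ℕ} (Ω V : Set (Fin n → ℂ)) (ρ : (Fin n → ℂ) → ℝ) : Prop where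
  isOpen : IsOpen V
  subset : closure Ω ⊆ V
  smooth : ContDiffOn ℝ (⊤ : ℕ∞) ρ V
  eq : Ω = {z ∈ V | ρ z < 0}
  grad_ne : ∀ z ∈ frontier Ω, fderiv ℝ ρ z ≠ 0

/-- The Levi form of `ρ` is positive semidefinite on complex tangent vectors at `z`. -/
def LeviPseudoconvexAt {n : ℕ} (ρ : (Fin n → ℂ) → ℝ) (z : Fin n → ℂ) : Prop :=
  ∀ X : Fin n → ℂ, dirDeriv X (cplx ρ) z = 0 → 0 ≤ (levi ρ X X z).re

/-- `Ω` is a (smoothly bounded, Levi) pseudoconvex domain. -/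
def IsPseudoconvex {n : ℕ} (Ω : Set (Fin n → ℂ)) : Prop :=
  ∃ (V : Set (Fin n → ℂ)) (ρ : (Fin n → ℂ) → ℝ), IsDefFn Ω V ρ ∧
    ∀ p ∈ frontier Ω, LeviPseudoconvexAt ρ p

/-- The set of Steinness exponents of `ρ`. -/
def steinExpSet {n : ℕ} (Ω : Set (Fin n → ℂ)) (ρ : (Fin n → ℂ) → ℝ) : Set ℝ :=
  {η : ℝ | 1 < η ∧ ∃ W : Set (Fin n → ℂ), IsOpen W ∧ frontier Ω ⊆ W ∧
    StrictPSHOn (fun z => ρ z ^ η) ((closure Ω)ᶜ ∩ W)}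

/-- The Steinness exponent `η̃_ρ` of a defining function `ρ` (`∞` if none exists). -/
def steinExp {n : ℕ} (Ω : Set (Fin n → ℂ)) (ρ : (Fin n → ℂ) → ℝ) : ℝ≥0∞ :=
  sInf (ENNReal.ofReal '' steinExpSet Ω ρ)

/-- The Steinness index `S(Ω)`. -/
def steinIndex {n : ℕ} (Ω : Set (Fin n → ℂ)) : ℝ≥0∞ :=
  ⨅ (V : Set (Fin n → ℂ)) (ρ : (Fin n → ℂ) → ℝ) (_ : IsDefFn Ω V ρ), steinExp Ω ρ

/-- The set of Diederich–Fornæss exponents of `ρ`. -/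
def dfExpSet {n : ℕ} (Ω : Set (Fin n → ℂ)) (ρ : (Fin n → ℂ) → ℝ) : Set ℝ :=
  {η : ℝ | 0 < η ∧ η < 1 ∧ StrictPSHOn (fun z => -((-ρ z) ^ η)) Ω}

/-- The Diederich–Fornæss exponent of `ρ` (`0` if no exponent exists). -/
def dfExp {n : ℕ} (Ω : Set (Fin n → ℂ)) (ρ : (Fin n → ℂ) → ℝ) : ℝ :=
  sSup (insert 0 (dfExpSet Ω ρ))

/-- The Diederich–Fornæss index `DF(Ω)`. -/
def dfIndex {n : ℕ} (Ω : Set (Fin n → ℂ)) : ℝ :=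
  sSup {t : ℝ | ∃ V ρ, IsDefFn Ω V ρ ∧ t = dfExp Ω ρ}

/-- `L` is a smooth (1,0) tangent vector field for `ρ` on `A`. -/
def IsTangentField {n : ℕ} (ρ : (Fin n → ℂ) → ℝ) (L : (Fin n → ℂ) → (Fin n → ℂ))
    (A : Set (Fin n → ℂ)) : Prop :=
  ContDiffOn ℝ (⊤ : ℕ∞) L A ∧ ∀ z ∈ A, dirDeriv (L z) (cplx ρ) z = 0

/-- The key differential inequality
`(1/(η₂−1))|L_ρ(L,N)|²/‖∇ρ‖² − (1/2)(N L_ρ(L,L))/‖∇ρ‖ ≤ 0` at `p`. -/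
def keyIneqAt {n : ℕ} (ρ : (Fin n → ℂ) → ℝ) (L : (Fin n → ℂ) → (Fin n → ℂ)) (η₂ : ℝ)
    (p : Fin n → ℂ) : Prop :=
  1 / (η₂ - 1) * Complex.normSq (levi ρ (L p) (nfield ρ p) p) / (gradNorm ρ p) ^ 2 -
    1 / 2 * (fieldDeriv (nfield ρ) (fun w => levi ρ (L w) (L w) w) p).re / gradNorm ρ p ≤ 0

/-- The strict version of the key differential inequality. -/
def strictKeyIneqAt {n : ℕ} (ρ : (Fin n → ℂ) → ℝ) (L : (Fin n → ℂ) → (Fin n → ℂ)) (η₂ : ℝ)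
    (p : Fin n → ℂ) : Prop :=
  1 / (η₂ - 1) * Complex.normSq (levi ρ (L p) (nfield ρ p) p) / (gradNorm ρ p) ^ 2 -
    1 / 2 * (fieldDeriv (nfield ρ) (fun w => levi ρ (L w) (L w) w) p).re / gradNorm ρ p < 0

/-- `cl Ω` has a strong Stein neighborhood basis. -/
def HasStrongSteinBasis {n : ℕ} (Ω : Set (Fin n → ℂ)) : Prop :=
  ∃ (V : Set (Fin n → ℂ)) (ρ : (Fin n → ℂ) → ℝ), IsDefFn Ω V ρ ∧ ∃ ε₀ : ℝ, 0 < ε₀ ∧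
    (∀ z ∈ V, 0 ≤ ρ z → ρ z < ε₀ → fderiv ℝ ρ z ≠ 0) ∧
    ∀ ε : ℝ, 0 ≤ ε → ε < ε₀ → ∀ z ∈ V, ρ z = ε → LeviPseudoconvexAt ρ z

/-- Vanishing order at `0` of a holomorphic function `ℂ → ℂ` (`∞` if all derivatives vanish). -/
def orderC (h : ℂ → ℂ) : ℕ∞ :=
  sInf ((fun k : ℕ => (k : ℕ∞)) '' {k : ℕ | iteratedDeriv k h 0 ≠ 0})

/-- Vanishing order at `0` of a real-valued function on `ℂ`. -/
def orderR (g : ℂ → ℝ) : ℕ∞ :=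
  sInf ((fun k : ℕ => (k : ℕ∞)) '' {k : ℕ | iteratedFDeriv ℝ k g 0 ≠ 0})

/-- `ν(γ)`: minimal vanishing order at `0` of the components of `γ − p`. -/
def curveOrder {n : ℕ} (γ : ℂ → Fin n → ℂ) (p : Fin n → ℂ) : ℕ∞ :=
  ⨅ j, orderC (fun t => γ t j - p j)

/-- `p` is a boundary point of finite D'Angelo 1-type (w.r.t. the defining function `ρ`). -/
def FiniteTypePt {n : ℕ} (ρ : (Fin n → ℂ) → ℝ) (p : Fin n → ℂ) : Prop :=
  ∃ M : ℕ, ∀ γ : ℂ → Fin n → ℂ, (∀ j, AnalyticAt ℂ (fun t => γ t j) 0) → γ 0 = p →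
    ¬ (∀ᶠ t in nhds (0 : ℂ), γ t = p) →
    orderR (fun t => ρ (γ t)) ≤ (M : ℕ∞) * curveOrder γ p

open scoped ContDiff

section

/-- The algebra of smooth complex-valued functions on `ℂⁿ`. -/
def smoothAlg (n : ℕ) : Subalgebra ℂ ((Fin n → ℂ) → ℂ) where
  carrier := {f | ContDiff ℝ ∞ f}
  mul_mem' := fun {a b} (ha : ContDiff ℝ ∞ a) (hb : ContDiff ℝ ∞ b) => ha.mul hb
  add_mem' := fun {a b} (ha : ContDiff ℝ ∞ a) (hb : ContDiff ℝ ∞ b) => ha.add hb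
  algebraMap_mem' := fun c => (contDiff_const : ContDiff ℝ ∞ fun _ : Fin n → ℂ => c)

variable {n : ℕ}

theorem smC (f : smoothAlg n) : ContDiff ℝ ∞ f.1 := f.2

theorem smD (f : smoothAlg n) (z : Fin n → ℂ) :
    DifferentiableAt ℝ f.1 z :=
  ((smC f).differentiable (by simp)).differentiableAt

/-- The derivative of smooth functions in a constant real direction. -/
def ddir (v : Fin n → ℂ) : Derivation ℂ (smoothAlg n) (smoothAlg n) :=
  Derivation.mk'
    { toFun := fun f => ⟨fun z => fderiv ℝ f.1 z v,
        ((smC f).fderiv_right (m := ∞) (by simp)).clm_apply contDiff_const⟩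
      map_add' := fun f g => by
        ext z
        exact congrArg (fun L => L v)
          (fderiv_add (smD f z) (smD g z))
      map_smul' := fun c f => by
        ext z
        exact congrArg (fun L => L v) (fderiv_const_smul (smD f z) c) }
    (fun f g => by
      ext z
      have := congrArg (fun L => L v)
        (fderiv_mul (smD f z) (smD g z))
      simpa using this)

theorem ddir_apply (v : Fin n → ℂ) (f : smoothAlg n) (z : Fin n → ℂ) :
    (ddir v f).1 z = fderiv ℝ f.1 z v := rfl

theorem ddir_comm (v w : Fin n → ℂ) (f : smoothAlg n) :
    ddir v (ddir w f) = ddir w (ddir v f) := by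
  ext z
  have hd : DifferentiableAt ℝ (fderiv ℝ f.1) z :=
    (((smC f).fderiv_right (m := ∞) (by simp)).differentiable (by simp)).differentiableAt
  have key : ∀ v w : Fin n → ℂ,
      (ddir v (ddir w f)).1 z = fderiv ℝ (fderiv ℝ f.1) z v w := by
    intro v w
    rw [ddir_apply]
    have : (ddir w f).1 = fun y => fderiv ℝ f.1 y w := rfl
    rw [this, fderiv_clm_apply hd (differentiableAt_const w)]
    simp
  have hs : IsSymmSndFDerivAt ℝ f.1 z :=
    (smC f).contDiffAt.isSymmSndFDerivAt (by
      rw [minSmoothness_of_isRCLikeNormedField]; exact WithTop.coe_le_coe.2 (le_top (a := (2 : ℕ∞))))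
  change (ddir v (ddir w f)).1 z = (ddir w (ddir v f)).1 z
  rw [key, key, hs v w]

/-- The derivation `∂/∂z_j`. -/
def pz (j : Fin n) : Derivation ℂ (smoothAlg n) (smoothAlg n) :=
  (1 / 2 : ℂ) • (ddir (Pi.single j 1) - I • ddir (Pi.single j I))

/-- The derivation `∂/∂z̄_j`. -/
def pzb (j : Fin n) : Derivation ℂ (smoothAlg n) (smoothAlg n) :=
  (1 / 2 : ℂ) • (ddir (Pi.single j 1) + I • ddir (Pi.single j I))

theorem pz_apply (j : Fin n) (f : smoothAlg n) (z : Fin n → ℂ) :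
    (pz j f).1 z = dz j f.1 z := by
  change (1 / 2 : ℂ) * (fderiv ℝ f.1 z (Pi.single j 1) - I * fderiv ℝ f.1 z (Pi.single j I)) = _
  unfold dz; ring

theorem pzb_apply (j : Fin n) (f : smoothAlg n) (z : Fin n → ℂ) :
    (pzb j f).1 z = dzbar j f.1 z := by
  change (1 / 2 : ℂ) * (fderiv ℝ f.1 z (Pi.single j 1) + I * fderiv ℝ f.1 z (Pi.single j I)) = _
  unfold dzbar; ring

/-- All Wirtinger derivations: `∂/∂z_j` and `∂/∂z̄_j`. -/
def pw : Fin n ⊕ Fin n → Derivation ℂ (smoothAlg n) (smoothAlg n) := Sum.elim pz pzb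

theorem pw_comm (i j : Fin n ⊕ Fin n) (f : smoothAlg n) :
    pw i (pw j f) = pw j (pw i f) := by
  have h1 := fun v w => ddir_comm (n := n) v w f
  rcases i with i | i <;> rcases j with j | j <;>
  · simp only [pw, Sum.elim_inl, Sum.elim_inr, pz, pzb, Derivation.smul_apply, Derivation.map_smul,
      Derivation.sub_apply, Derivation.add_apply, map_sub, map_add]
    rw [h1 (Pi.single j 1) (Pi.single i 1), h1 (Pi.single j 1) (Pi.single i I),
      h1 (Pi.single j I) (Pi.single i 1), h1 (Pi.single j I) (Pi.single i I)]
    module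

/-- The coordinate functions `z_j`. -/
def cz (j : Fin n) : smoothAlg n :=
  ⟨fun z => z j, (contDiff_apply ℝ ℂ j : ContDiff ℝ ∞ fun z : Fin n → ℂ => z j)⟩

/-- Complex conjugation of smooth functions. -/
def cj (f : smoothAlg n) : smoothAlg n :=
  ⟨fun z => (starRingEnd ℂ) (f.1 z), conjCLE.contDiff.comp (smC f)⟩

theorem cj_apply (f : smoothAlg n) (z) : (cj f).1 z = (starRingEnd ℂ) (f.1 z) := rfl

theorem cj_cj (f : smoothAlg n) : cj (cj f) = f := by
  ext z; exact Complex.conj_conj _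

theorem cj_add (f g : smoothAlg n) : cj (f + g) = cj f + cj g := by
  ext z; exact map_add _ _ _

theorem cj_mul (f g : smoothAlg n) : cj (f * g) = cj f * cj g := by
  ext z; exact map_mul _ _ _

theorem cj_smul (c : ℂ) (f : smoothAlg n) : cj (c • f) = (starRingEnd ℂ) c • cj f := by
  ext z; exact map_mul _ _ _

theorem cj_zero : cj (0 : smoothAlg n) = 0 := by
  ext z; exact map_zero _

theorem cj_one : cj (1 : smoothAlg n) = 1 := by
  ext z; exact map_one _

theorem cj_sub (f g : smoothAlg n) : cj (f - g) = cj f - cj g := by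
  ext z; exact map_sub _ _ _

theorem cj_sum {ι : Type*} (s : Finset ι) (f : ι → smoothAlg n) :
    cj (∑ i ∈ s, f i) = ∑ i ∈ s, cj (f i) := by
  classical
  induction s using Finset.induction_on with
  | empty => simp [cj_zero]
  | insert a s ha ih => rw [Finset.sum_insert ha, Finset.sum_insert ha, cj_add, ih]

theorem ddir_cj (v : Fin n → ℂ) (f : smoothAlg n) : ddir v (cj f) = cj (ddir v f) := by
  ext z
  change fderiv ℝ (fun z => (starRingEnd ℂ) (f.1 z)) z v = (starRingEnd ℂ) (fderiv ℝ f.1 z v)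
  have := (conjCLE.hasFDerivAt (x := f.1 z)).comp z (smD f z).hasFDerivAt
  have h2 := this.fderiv
  have h3 : (fun z => (starRingEnd ℂ) (f.1 z)) = (conjCLE : ℂ → ℂ) ∘ f.1 := rfl
  rw [h3, h2]; rfl

theorem pz_cj (j : Fin n) (f : smoothAlg n) : pz j (cj f) = cj (pzb j f) := by
  simp only [pz, pzb, Derivation.smul_apply, Derivation.sub_apply, Derivation.add_apply, ddir_cj,
    cj_smul, cj_add, conj_I, map_div₀, map_one, map_ofNat, neg_smul, sub_eq_add_neg]

theorem pzb_cj (j : Fin n) (f : smoothAlg n) : pzb j (cj f) = cj (pz j f) := by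
  rw [← cj_cj (pzb j (cj f)), ← pz_cj, cj_cj]

theorem ddir_cz (v : Fin n → ℂ) (j : Fin n) : ddir v (cz j) = algebraMap ℂ _ (v j) := by
  ext z
  change fderiv ℝ (ContinuousLinearMap.proj j : (Fin n → ℂ) →L[ℝ] ℂ) z v = v j
  rw [ContinuousLinearMap.fderiv]; rfl

theorem pz_cz (i j : Fin n) : pz i (cz j) = if i = j then 1 else 0 := by
  ext z
  simp only [pz, Derivation.smul_apply, Derivation.sub_apply, ddir_cz]
  change (1 / 2 : ℂ) * ((Pi.single i 1 : Fin n → ℂ) j - I * (Pi.single i I : Fin n → ℂ) j) = _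
  by_cases h : i = j
  · subst h; simp; norm_num
  · simp [h, Ne.symm h]

theorem pzb_cz (i j : Fin n) : pzb i (cz j) = 0 := by
  ext z
  simp only [pzb, Derivation.smul_apply, Derivation.add_apply, ddir_cz]
  change (1 / 2 : ℂ) * ((Pi.single i 1 : Fin n → ℂ) j + I * (Pi.single i I : Fin n → ℂ) j) = 0
  by_cases h : i = j
  · subst h; simp
  · simp [h, Ne.symm h]

/-- `f` vanishes to order at least `K` at `p`. -/
def Flat (p : Fin n → ℂ) : ℕ → smoothAlg n → Prop
  | 0, _ => True
  | K + 1, f => f.1 p = 0 ∧ ∀ i, Flat p K (pw i f)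

theorem Flat.of_succ {p : Fin n → ℂ} {K : ℕ} {f : smoothAlg n} (h : Flat p (K + 1) f) :
    Flat p K f := by
  induction K generalizing f with
  | zero => trivial
  | succ K ih => exact ⟨h.1, fun i => ih (h.2 i)⟩

theorem Flat.mono {p : Fin n → ℂ} {K L : ℕ} {f : smoothAlg n} (h : Flat p K f) (hL : L ≤ K) :
    Flat p L f := by
  induction hL with
  | refl => exact h
  | step _ ih => exact ih h.of_succ

theorem flat_zero (p : Fin n → ℂ) (K : ℕ) : Flat p K (0 : smoothAlg n) := by
  induction K with
  | zero => trivial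
  | succ K ih => exact ⟨rfl, fun i => by rw [map_zero]; exact ih⟩

theorem Flat.add {p : Fin n → ℂ} {K : ℕ} {f g : smoothAlg n} (hf : Flat p K f)
    (hg : Flat p K g) : Flat p K (f + g) := by
  induction K generalizing f g with
  | zero => trivial
  | succ K ih =>
    refine ⟨?_, fun i => by rw [map_add]; exact ih (hf.2 i) (hg.2 i)⟩
    change f.1 p + g.1 p = 0
    rw [hf.1, hg.1, add_zero]

theorem Flat.mul_left {p : Fin n → ℂ} {K : ℕ} {f : smoothAlg n} (g : smoothAlg n)
    (hf : Flat p K f) : Flat p K (g * f) := by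
  induction K generalizing f g with
  | zero => trivial
  | succ K ih =>
    refine ⟨?_, fun i => ?_⟩
    · change g.1 p * f.1 p = 0
      rw [hf.1, mul_zero]
    · rw [Derivation.leibniz]
      exact (ih g (hf.2 i)).add (by rw [smul_eq_mul, mul_comm]; exact ih _ hf.of_succ)

theorem Flat.smul {p : Fin n → ℂ} {K : ℕ} {f : smoothAlg n} (c : ℂ)
    (hf : Flat p K f) : Flat p K (c • f) := by
  have := hf.mul_left (algebraMap ℂ _ c)
  rwa [← Algebra.smul_def] at this

theorem Flat.sub {p : Fin n → ℂ} {K : ℕ} {f g : smoothAlg n} (hf : Flat p K f)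
    (hg : Flat p K g) : Flat p K (f - g) := by
  have := hf.add (hg.smul (-1))
  rwa [neg_one_smul, ← sub_eq_add_neg] at this

theorem Flat.cj {p : Fin n → ℂ} {K : ℕ} {f : smoothAlg n} (hf : Flat p K f) :
    Flat p K (cj f) := by
  induction K generalizing f with
  | zero => trivial
  | succ K ih =>
    refine ⟨by rw [cj_apply, hf.1, map_zero], fun i => ?_⟩
    rcases i with i | i
    · change Flat p K (pz i (_root_.cj f)); rw [pz_cj]; exact ih (hf.2 (Sum.inr i))
    · change Flat p K (pzb i (_root_.cj f)); rw [pzb_cj]; exact ih (hf.2 (Sum.inl i))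

theorem ddir_eq (v : Fin n → ℂ) (f : smoothAlg n) :
    ddir v f = ∑ j, (v j • pz j f + (starRingEnd ℂ) (v j) • pzb j f) := by
  ext z
  have hv : v = ∑ j, ((v j).re • (Pi.single j 1 : Fin n → ℂ) + (v j).im • (Pi.single j I : Fin n → ℂ)) := by
    ext k
    simp only [Finset.sum_apply, Pi.add_apply, Pi.smul_apply, Pi.single_apply]
    rw [Finset.sum_eq_single k]
    · simp
    · intro b _ hb; simp [Ne.symm hb]
    · simp
  have hR : (∑ j, (v j • pz j f + (starRingEnd ℂ) (v j) • pzb j f) : smoothAlg n).1 z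
      = ∑ j, (v j * (pz j f).1 z + (starRingEnd ℂ) (v j) * (pzb j f).1 z) := by
    rw [AddSubmonoidClass.coe_finsetSum, Finset.sum_apply]; rfl
  change (ddir v f).1 z = (_ : smoothAlg n).1 z
  rw [hR, ddir_apply]
  conv_lhs => rw [hv]
  rw [map_sum]
  refine Finset.sum_congr rfl fun j _ => ?_
  rw [pz_apply, pzb_apply, map_add, map_smul, map_smul]
  unfold dz dzbar
  apply Complex.ext <;> simp <;> ring

theorem Flat.bound {p : Fin n → ℂ} {K : ℕ} {f : smoothAlg n} (hf : Flat p K f) :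
    ∃ C : ℝ, 0 ≤ C ∧ ∀ z ∈ Metric.closedBall p 1, ‖f.1 z‖ ≤ C * ‖z - p‖ ^ K := by
  induction K generalizing f with
  | zero =>
    obtain ⟨C, hC⟩ := (isCompact_closedBall p 1).exists_bound_of_continuousOn
      (f := f.1) (smC f).continuous.continuousOn
    refine ⟨max C 0, le_max_right _ _, fun z hz => ?_⟩
    simpa using Or.inl (hC z hz)
  | succ K ih =>
    choose C hC0 hC using fun i => ih (hf.2 i)
    set D : ℝ := ∑ j, (C (Sum.inl j) + C (Sum.inr j)) with hD
    have hD0 : 0 ≤ D := Finset.sum_nonneg fun j _ => add_nonneg (hC0 _) (hC0 _)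
    refine ⟨D, hD0, fun z hz => ?_⟩
    have hz' : ‖z - p‖ ≤ 1 := by simpa [dist_eq_norm] using hz
    have key : ∀ y ∈ Metric.closedBall p ‖z - p‖, ‖fderiv ℝ f.1 y‖ ≤ D * ‖z - p‖ ^ K := by
      intro y hy
      refine ContinuousLinearMap.opNorm_le_bound _ (by positivity) fun v => ?_
      have hy1 : y ∈ Metric.closedBall p 1 := Metric.closedBall_subset_closedBall hz' hy
      have hyn : ‖y - p‖ ≤ ‖z - p‖ := by simpa [dist_eq_norm] using hy
      have hR : (fderiv ℝ f.1 y v) =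
          ∑ j, (v j * (pz j f).1 y + (starRingEnd ℂ) (v j) * (pzb j f).1 y) := by
        rw [← ddir_apply, ddir_eq, AddSubmonoidClass.coe_finsetSum, Finset.sum_apply]; rfl
      rw [hR, hD, Finset.sum_mul, Finset.sum_mul]
      refine norm_sum_le_of_le _ fun j _ => ?_
      have h1 : ‖(pz j f).1 y‖ ≤ C (Sum.inl j) * ‖z - p‖ ^ K :=
        (hC (Sum.inl j) y hy1).trans (by gcongr; exact hC0 _)
      have h2 : ‖(pzb j f).1 y‖ ≤ C (Sum.inr j) * ‖z - p‖ ^ K :=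
        (hC (Sum.inr j) y hy1).trans (by gcongr; exact hC0 _)
      have h3 : ‖v j‖ ≤ ‖v‖ := norm_le_pi_norm v j
      calc _ ≤ ‖v j‖ * ‖(pz j f).1 y‖ + ‖v j‖ * ‖(pzb j f).1 y‖ := by
            refine (norm_add_le _ _).trans ?_
            rw [norm_mul, norm_mul, RCLike.norm_conj]
        _ ≤ ‖v‖ * (C (Sum.inl j) * ‖z - p‖ ^ K) + ‖v‖ * (C (Sum.inr j) * ‖z - p‖ ^ K) := by
            gcongr
        _ = _ := by ring
    have := (convex_closedBall p ‖z - p‖).norm_image_sub_le_of_norm_fderiv_le (𝕜 := ℝ)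
      (f := f.1) (fun y _ => smD f y) key
      (Metric.mem_closedBall_self (norm_nonneg _)) (y := z) (by simp [dist_eq_norm])
    rw [hf.1, sub_zero] at this
    rw [pow_succ, ← mul_assoc]; exact this

/-- Holomorphic polynomials as smooth functions. -/
def hol (g : MvPolynomial (Fin n) ℂ) : smoothAlg n := MvPolynomial.aeval cz g

theorem pzb_hol (j : Fin n) (g : MvPolynomial (Fin n) ℂ) : pzb j (hol g) = 0 := by
  unfold hol
  induction g using MvPolynomial.induction_on with
  | C a => simp [MvPolynomial.algHom_C]
  | add p q hp hq => rw [map_add, map_add, hp, hq, add_zero]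
  | mul_X p i hp => rw [map_mul, Derivation.leibniz, hp, MvPolynomial.aeval_X, pzb_cz]; simp

theorem pz_hol (j : Fin n) (g : MvPolynomial (Fin n) ℂ) :
    pz j (hol g) = hol (MvPolynomial.pderiv j g) := by
  unfold hol
  induction g using MvPolynomial.induction_on with
  | C a => simp [MvPolynomial.algHom_C]
  | add p q hp hq => simp only [map_add, hp, hq]
  | mul_X p i hp =>
    simp only [map_mul, Derivation.leibniz, hp, MvPolynomial.aeval_X, pz_cz,
      MvPolynomial.pderiv_X, map_add, smul_eq_mul, Pi.single_apply]
    split_ifs <;> simp [eq_comm] <;> simp_all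

/-- Any derivation annihilating antiholomorphic coordinates acts on holomorphic polynomials by
the chain rule. -/
theorem derivation_hol (d : Derivation ℂ (smoothAlg n) (smoothAlg n))
    (g : MvPolynomial (Fin n) ℂ) :
    d (hol g) = ∑ j, d (cz j) * pz j (hol g) := by
  unfold hol
  induction g using MvPolynomial.induction_on with
  | C a => simp [MvPolynomial.algHom_C]
  | add p q hp hq => simp only [map_add, hp, hq, mul_add, Finset.sum_add_distrib]
  | mul_X p i hp =>
    simp only [map_mul, Derivation.leibniz, hp, MvPolynomial.aeval_X, pz_cz, smul_eq_mul,
      mul_add, Finset.sum_add_distrib, Finset.mul_sum]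
    congr 1
    · simp [Finset.sum_ite_eq', mul_comm]
    · exact Finset.sum_congr rfl fun j _ => by ring

end

section

variable {n : ℕ}

theorem exists_aeval_of_commute {ι B : Type*} [Ring B] [Algebra ℂ B] (x : ι → B)
    (hx : ∀ i j, x i * x j = x j * x i) :
    ∃ Φ : MvPolynomial ι ℂ →ₐ[ℂ] B, ∀ i, Φ (MvPolynomial.X i) = x i := by
  have hc : ∀ a ∈ Set.range x, ∀ b ∈ Set.range x, a * b = b * a := by
    rintro _ ⟨i, rfl⟩ _ ⟨j, rfl⟩; exact hx i j
  have := Algebra.isMulCommutative_adjoin ℂ hc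
  let _ : CommRing (Algebra.adjoin ℂ (Set.range x)) :=
    { mul_comm := fun a b => IsMulCommutative.is_comm.comm a b }
  let y : ι → Algebra.adjoin ℂ (Set.range x) := fun i => ⟨_, Algebra.subset_adjoin ⟨i, rfl⟩⟩
  refine ⟨(Algebra.adjoin ℂ (Set.range x)).val.comp (MvPolynomial.aeval y), fun i => ?_⟩
  rw [AlgHom.comp_apply, MvPolynomial.aeval_X]
  rfl

/-- There is an algebra homomorphism sending a polynomial to the corresponding constant
coefficient differential operator. -/
theorem exists_diffOp (n : ℕ) : ∃ Φ : MvPolynomial (Fin n ⊕ Fin n) ℂ →ₐ[ℂ]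
    Module.End ℂ (smoothAlg n), ∀ i, Φ (MvPolynomial.X i) = (pw i : smoothAlg n →ₗ[ℂ] smoothAlg n) :=
  exists_aeval_of_commute (fun i => ((pw i : Derivation ℂ (smoothAlg n) (smoothAlg n)) :
    Module.End ℂ (smoothAlg n))) fun i j => LinearMap.ext fun f => pw_comm i j f

/-- The real coordinates centred at `p`. -/
def wv (p : Fin n → ℂ) : Fin n ⊕ Fin n → smoothAlg n :=
  Sum.elim (fun j => cz j - algebraMap ℂ _ (p j)) (fun j => cj (cz j - algebraMap ℂ _ (p j)))

theorem wv_apply_self (p : Fin n → ℂ) (i) : (wv p i).1 p = 0 := by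
  rcases i with i | i
  · exact sub_self _
  · change (starRingEnd ℂ) (p i - p i) = 0; simp

theorem pw_wv (p : Fin n → ℂ) (i j) : pw i (wv p j) = if i = j then 1 else 0 := by
  rcases i with i | i <;> rcases j with j | j <;> simp only [pw, wv, Sum.elim_inl, Sum.elim_inr]
  · simp [pz_cz]
  · rw [pz_cj]; simp [pzb_cz, cj_zero]
  · simp [pzb_cz]
  · rw [pzb_cj, map_sub, pz_cz]
    by_cases h : i = j <;> simp [h, cj_one, cj_zero]

theorem pw_aeval_wv (p : Fin n → ℂ) (i) (Q : MvPolynomial (Fin n ⊕ Fin n) ℂ) :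
    pw i (MvPolynomial.aeval (wv p) Q) = MvPolynomial.aeval (wv p) (MvPolynomial.pderiv i Q) := by
  induction Q using MvPolynomial.induction_on with
  | C a => simp [MvPolynomial.algHom_C]
  | add q r hp hq => simp only [map_add, hp, hq]
  | mul_X q j hp =>
    simp only [map_mul, Derivation.leibniz, hp, MvPolynomial.aeval_X, pw_wv,
      MvPolynomial.pderiv_X, map_add, smul_eq_mul, Pi.single_apply]
    by_cases h : i = j
    · subst h; simp
    · simp [h, Ne.symm h]

theorem aeval_wv_self (p : Fin n → ℂ) (Q : MvPolynomial (Fin n ⊕ Fin n) ℂ) :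
    (MvPolynomial.aeval (wv p) Q).1 p = MvPolynomial.coeff 0 Q := by
  induction Q using MvPolynomial.induction_on with
  | C a => rw [MvPolynomial.algHom_C, MvPolynomial.coeff_zero_C]; rfl
  | add q r hp hq => rw [map_add, MvPolynomial.coeff_add, ← hp, ← hq]; rfl
  | mul_X q j hp =>
    rw [map_mul, MvPolynomial.aeval_X, MvPolynomial.coeff_mul_X']
    simp only [Finsupp.support_zero, Finset.notMem_empty, if_false]
    change _ * (wv p j).1 p = 0
    rw [wv_apply_self, mul_zero]

theorem flat_sub_aeval (Φ : MvPolynomial (Fin n ⊕ Fin n) ℂ →ₐ[ℂ] Module.End ℂ (smoothAlg n))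
    (hΦ : ∀ i, Φ (MvPolynomial.X i) = (pw i : smoothAlg n →ₗ[ℂ] smoothAlg n))
    (p : Fin n → ℂ) (K : ℕ) (f : smoothAlg n) (Q : MvPolynomial (Fin n ⊕ Fin n) ℂ)
    (h : ∀ m : (Fin n ⊕ Fin n) →₀ ℕ, m.degree < K →
      Q.coeff m * (m.prod fun _ k => (k.factorial : ℂ)) =
        (Φ (MvPolynomial.monomial m 1) f).1 p) :
    Flat p K (f - MvPolynomial.aeval (wv p) Q) := by
  induction K generalizing f Q with
  | zero => trivial
  | succ K ih =>
    refine ⟨?_, fun i => ?_⟩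
    · have := h 0 (by simp)
      rw [Finsupp.prod_zero_index, mul_one] at this
      change f.1 p - (MvPolynomial.aeval (wv p) Q).1 p = 0
      rw [aeval_wv_self, this]
      have h1 : (MvPolynomial.monomial (0 : (Fin n ⊕ Fin n) →₀ ℕ) (1 : ℂ)) = 1 := rfl
      rw [h1, map_one]; exact sub_self _
    · rw [map_sub, pw_aeval_wv]
      refine ih _ _ fun m hm => ?_
      have h1 := h (m + Finsupp.single i 1) (by
        rw [map_add, Finsupp.degree_single]; omega)
      have h2 : (MvPolynomial.monomial (m + Finsupp.single i 1) (1 : ℂ)) =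
          MvPolynomial.monomial m 1 * MvPolynomial.X i := by
        rw [MvPolynomial.X, MvPolynomial.monomial_mul, mul_one]
      rw [h2, map_mul, hΦ] at h1
      change _ = (Φ (MvPolynomial.monomial m 1) (pw i f)).1 p at h1
      rw [← h1]
      have h3 : (m + Finsupp.single i 1).prod (fun _ k => (k.factorial : ℂ)) =
          (m i + 1 : ℂ) * m.prod fun _ k => (k.factorial : ℂ) := by
        rw [Finsupp.prod_fintype _ _ (by simp), Finsupp.prod_fintype _ _ (by simp)]
        rw [← Finset.mul_prod_erase _ _ (Finset.mem_univ i),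
          ← Finset.mul_prod_erase _ (fun i => ((m i).factorial : ℂ)) (Finset.mem_univ i), ← mul_assoc]
        congr 1
        · simp [Nat.factorial_succ]
        · refine Finset.prod_congr rfl fun j hj => ?_
          simp [(Finset.ne_of_mem_erase hj).symm]
      rw [h3, MvPolynomial.coeff_pderiv]
      ring

theorem exists_flat_sub_aeval (p : Fin n → ℂ) (K : ℕ) (f : smoothAlg n) :
    ∃ Q : MvPolynomial (Fin n ⊕ Fin n) ℂ, Flat p K (f - MvPolynomial.aeval (wv p) Q) := by
  obtain ⟨Φ, hΦ⟩ := exists_diffOp n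
  let s : Finset ((Fin n ⊕ Fin n) →₀ ℕ) := (Finset.range K).biUnion fun d => Finset.finsuppAntidiag Finset.univ d
  have hs : ∀ m : (Fin n ⊕ Fin n) →₀ ℕ, m.degree < K → m ∈ s := by
    intro m hm
    refine Finset.mem_biUnion.2 ⟨m.degree, Finset.mem_range.2 hm, ?_⟩
    simp [Finset.mem_finsuppAntidiag, Finsupp.degree_eq_sum]
  refine ⟨∑ m ∈ s, MvPolynomial.monomial m
    ((Φ (MvPolynomial.monomial m 1) f).1 p / m.prod fun _ k => (k.factorial : ℂ)),
    flat_sub_aeval Φ hΦ p K f _ fun m hm => ?_⟩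
  rw [MvPolynomial.coeff_sum, Finset.sum_eq_single m]
  · rw [MvPolynomial.coeff_monomial, if_pos rfl, div_mul_cancel₀]
    exact Finset.prod_ne_zero_iff.2 fun i _ => by exact Nat.cast_ne_zero.2 (Nat.factorial_ne_zero (m i))
  · intro b _ hb; rw [MvPolynomial.coeff_monomial, if_neg hb]
  · intro hm'; exact absurd (hs m hm) hm'

/-- Finite sums of products `g h̄` with `g`, `h` holomorphic polynomials. -/
def sesq (n : ℕ) : AddSubmonoid (smoothAlg n) :=
  AddSubmonoid.closure {f | ∃ g h, f = hol g * cj (hol h)}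

theorem mul_mem_sesq {f : smoothAlg n} (hf : f ∈ sesq n) (g h : MvPolynomial (Fin n) ℂ) :
    f * (hol g * cj (hol h)) ∈ sesq n := by
  refine AddSubmonoid.closure_induction (motive := fun f _ => f * (hol g * cj (hol h)) ∈ sesq n)
    ?_ ?_ ?_ hf
  · rintro _ ⟨g', h', rfl⟩
    refine AddSubmonoid.subset_closure ⟨g' * g, h' * h, ?_⟩
    simp only [hol, map_mul, cj_mul]; ring
  · rw [zero_mul]; exact zero_mem _
  · intro a b _ _ ha hb
    rw [add_mul]; exact add_mem ha hb

theorem aeval_wv_mem_sesq (p : Fin n → ℂ) (Q : MvPolynomial (Fin n ⊕ Fin n) ℂ) :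
    MvPolynomial.aeval (wv p) Q ∈ sesq n := by
  induction Q using MvPolynomial.induction_on with
  | C a =>
    refine AddSubmonoid.subset_closure ⟨MvPolynomial.C a, 1, ?_⟩
    simp [hol, MvPolynomial.algHom_C, cj_one]
  | add q r hp hq => rw [map_add]; exact add_mem hp hq
  | mul_X q j hp =>
    rw [map_mul, MvPolynomial.aeval_X]
    rcases j with j | j
    · have := mul_mem_sesq hp (MvPolynomial.X j - MvPolynomial.C (p j)) 1
      simpa [hol, MvPolynomial.algHom_C, cj_one, wv] using this
    · have := mul_mem_sesq hp 1 (MvPolynomial.X j - MvPolynomial.C (p j))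
      simpa [hol, MvPolynomial.algHom_C, cj_one, wv] using this

theorem exists_sesq_flat_sub (p : Fin n → ℂ) (K : ℕ) (f : smoothAlg n) :
    ∃ Q ∈ sesq n, Flat p K (f - Q) := by
  obtain ⟨Q, hQ⟩ := exists_flat_sub_aeval p K f
  exact ⟨_, aeval_wv_mem_sesq p Q, hQ⟩

/-- An additive relation that holds for flat functions and for products `g h̄` of holomorphic and
antiholomorphic polynomials holds for all smooth functions. -/
theorem smooth_induction {P : smoothAlg n → Prop} (p : Fin n → ℂ) (K : ℕ)
    (hadd : ∀ f g, P f → P g → P (f + g)) (hflat : ∀ f, Flat p K f → P f)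
    (hprod : ∀ g h, P (hol g * cj (hol h))) (f : smoothAlg n) : P f := by
  obtain ⟨Q, hQ, hfl⟩ := exists_sesq_flat_sub p K f
  have hPQ : P Q := by
    refine AddSubmonoid.closure_induction (motive := fun f _ => P f) ?_ ?_ ?_ hQ
    · rintro _ ⟨g, h, rfl⟩; exact hprod g h
    · exact hflat 0 (flat_zero p K)
    · intro a b _ _ ha hb; exact hadd a b ha hb
  have := hadd _ _ (hflat _ hfl) hPQ
  rwa [sub_add_cancel] at this

end

section

variable {n : ℕ}

/-- The free real algebra on two letters, `true` for `X = L + L̄` and `false` for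
`Y = i (L - L̄)`. -/
abbrev Wd : Type := FreeAlgebra ℝ Bool

/-- A letter as an element of the free algebra. -/
abbrev lt (b : Bool) : Wd := FreeAlgebra.ι ℝ b

/-- Lie polynomials in the two letters. -/
inductive IsLie : Wd → Prop
  | gen (b : Bool) : IsLie (lt b)
  | add {u v : Wd} : IsLie u → IsLie v → IsLie (u + v)
  | smul (c : ℝ) {u : Wd} : IsLie u → IsLie (c • u)
  | ad (b : Bool) {u : Wd} : IsLie u → IsLie (lt b * u - u * lt b)

theorem word_induction {P : Wd → Prop} (one : P 1) (add : ∀ u v, P u → P v → P (u + v))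
    (smul : ∀ (c : ℝ) u, P u → P (c • u)) (gen : ∀ b u, P u → P (lt b * u)) (u : Wd) : P u := by
  have : ∀ u : Wd, ∀ v, P v → P (u * v) := by
    intro u
    induction u using FreeAlgebra.induction with
    | grade0 r => intro v hv; rw [← Algebra.smul_def]; exact smul r v hv
    | grade1 b => exact fun v hv => gen b v hv
    | mul a b ha hb => intro v hv; rw [mul_assoc]; exact ha _ (hb _ hv)
    | add a b ha hb => intro v hv; rw [add_mul]; exact add _ _ (ha _ hv) (hb _ hv)
  simpa using this u 1 one

/-- The field `L = ∑ a_j ∂/∂z_j`. -/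
def fieldL (a : Fin n → smoothAlg n) : Derivation ℂ (smoothAlg n) (smoothAlg n) :=
  ∑ j, a j • pz j

/-- The conjugate field `L̄ = ∑ ā_j ∂/∂z̄_j`. -/
def fieldLb (a : Fin n → smoothAlg n) : Derivation ℂ (smoothAlg n) (smoothAlg n) :=
  ∑ j, cj (a j) • pzb j

theorem fieldL_apply (a : Fin n → smoothAlg n) (f : smoothAlg n) :
    fieldL a f = ∑ j, a j * pz j f := by
  unfold fieldL
  rw [← Derivation.coeFnAddMonoidHom_apply, map_sum, Finset.sum_apply]; rfl

theorem fieldLb_apply (a : Fin n → smoothAlg n) (f : smoothAlg n) :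
    fieldLb a f = ∑ j, cj (a j) * pzb j f := by
  unfold fieldLb
  rw [← Derivation.coeFnAddMonoidHom_apply, map_sum, Finset.sum_apply]; rfl

theorem fieldL_cj (a : Fin n → smoothAlg n) (f : smoothAlg n) :
    fieldL a (cj f) = cj (fieldLb a f) := by
  simp only [fieldL_apply, fieldLb_apply, cj_sum, cj_mul, cj_cj, pz_cj]

theorem fieldLb_cj (a : Fin n → smoothAlg n) (f : smoothAlg n) :
    fieldLb a (cj f) = cj (fieldL a f) := by
  simp only [fieldL_apply, fieldLb_apply, cj_sum, cj_mul, pzb_cj]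

/-- The real fields `X = L + L̄` and `Y = i (L - L̄)`. -/
def dv (a : Fin n → smoothAlg n) : Bool → Derivation ℂ (smoothAlg n) (smoothAlg n)
  | true => fieldL a + fieldLb a
  | false => I • (fieldL a - fieldLb a)

theorem dv_cj (a : Fin n → smoothAlg n) (b : Bool) (f : smoothAlg n) :
    dv a b (cj f) = cj (dv a b f) := by
  cases b
  · simp only [dv, Derivation.smul_apply, Derivation.sub_apply, fieldL_cj, fieldLb_cj, cj_smul,
      cj_sub, conj_I, neg_smul, ← smul_neg, neg_sub]
  · simp only [dv, Derivation.add_apply, fieldL_cj, fieldLb_cj, cj_add, add_comm]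

theorem fieldL_cz (a : Fin n → smoothAlg n) (j : Fin n) : fieldL a (cz j) = a j := by
  simp [fieldL_apply, pz_cz]

theorem fieldLb_cz (a : Fin n → smoothAlg n) (j : Fin n) : fieldLb a (cz j) = 0 := by
  simp [fieldLb_apply, pzb_cz]

theorem dv_cz_true (a : Fin n → smoothAlg n) (j : Fin n) : dv a true (cz j) = a j := by
  simp [dv, fieldL_cz, fieldLb_cz]

theorem dv_cz_false (a : Fin n → smoothAlg n) (j : Fin n) : dv a false (cz j) = I • a j := by
  simp [dv, fieldL_cz, fieldLb_cz]

/-- The action of the free algebra on smooth functions. -/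
def act (a : Fin n → smoothAlg n) : Wd →ₐ[ℝ] Module.End ℂ (smoothAlg n) :=
  FreeAlgebra.lift ℝ fun b => (dv a b : smoothAlg n →ₗ[ℂ] smoothAlg n)

theorem act_lt (a : Fin n → smoothAlg n) (b : Bool) (f : smoothAlg n) :
    act a (lt b) f = dv a b f := by
  simp [act]

theorem act_lt_mul (a : Fin n → smoothAlg n) (b : Bool) (u : Wd) (f : smoothAlg n) :
    act a (lt b * u) f = dv a b (act a u f) := by
  rw [map_mul, Module.End.mul_apply, act_lt]

theorem act_add (a : Fin n → smoothAlg n) (u v : Wd) (f : smoothAlg n) :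
    act a (u + v) f = act a u f + act a v f := by
  rw [map_add]; rfl

theorem act_smul (a : Fin n → smoothAlg n) (c : ℝ) (u : Wd) (f : smoothAlg n) :
    act a (c • u) f = c • act a u f := by
  rw [map_smul]; rfl

theorem act_cj (a : Fin n → smoothAlg n) (u : Wd) (f : smoothAlg n) :
    act a u (cj f) = cj (act a u f) := by
  induction u using word_induction with
  | one => simp
  | add u v hu hv => rw [act_add, act_add, hu, hv, cj_add]
  | smul c u hu =>
    rw [act_smul, act_smul, hu]
    exact (Complex.conj_ofReal c ▸ (cj_smul (c : ℂ) (act a u f)).symm :)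
  | gen b u hu => rw [act_lt_mul, act_lt_mul, hu, dv_cj]

theorem IsLie.exists_derivation {g : Wd} (hg : IsLie g) (a : Fin n → smoothAlg n) :
    ∃ d : Derivation ℂ (smoothAlg n) (smoothAlg n), ∀ f, act a g f = d f := by
  induction hg with
  | gen b => exact ⟨dv a b, act_lt a b⟩
  | add _ _ h1 h2 =>
    obtain ⟨d1, h1⟩ := h1
    obtain ⟨d2, h2⟩ := h2
    exact ⟨d1 + d2, fun f => by rw [act_add, h1, h2]; rfl⟩
  | smul c _ h =>
    obtain ⟨d, h⟩ := h
    exact ⟨(c : ℂ) • d, fun f => by rw [act_smul, h]; rfl⟩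
  | ad b _ h =>
    obtain ⟨d, h⟩ := h
    refine ⟨⁅dv a b, d⁆, fun f => ?_⟩
    rw [map_sub, LinearMap.sub_apply, act_lt_mul, h, map_mul, Module.End.mul_apply, act_lt, h,
      Derivation.commutator_apply]

/-- One step of the recursion for the antiholomorphic part of a word. -/
def opStep (a : Fin n → smoothAlg n) (b : Bool) :
    Module.End ℝ (Module.End ℂ (smoothAlg n)) where
  toFun P := (dv a b : smoothAlg n →ₗ[ℂ] smoothAlg n).comp P -
    ∑ j, ((LinearMap.mulLeft ℂ (dv a b (cz j))).comp P).comp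
      (pz j : smoothAlg n →ₗ[ℂ] smoothAlg n)
  map_add' P Q := by
    simp only [LinearMap.comp_add, LinearMap.add_comp, Finset.sum_add_distrib]; abel
  map_smul' c P := by
    ext1 f
    simp [LinearMap.sum_apply, smul_sub, Finset.smul_sum]

/-- The part of a word acting on antiholomorphic functions, as a differential operator. -/
def dop (a : Fin n → smoothAlg n) : Wd →ₗ[ℝ] Module.End ℂ (smoothAlg n) :=
  (LinearMap.applyₗ (1 : Module.End ℂ (smoothAlg n))).comp
    (FreeAlgebra.lift ℝ (opStep a)).toLinearMap

theorem dop_one (a : Fin n → smoothAlg n) (f : smoothAlg n) : dop a 1 f = f := by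
  simp [dop]

theorem dop_lt_mul (a : Fin n → smoothAlg n) (b : Bool) (v : Wd) (f : smoothAlg n) :
    dop a (lt b * v) f = dv a b (dop a v f) - ∑ j, dv a b (cz j) * dop a v (pz j f) := by
  simp [dop, opStep, LinearMap.sum_apply]

/-- The starting value of the bracket. -/
def bra0 (a : Fin n → smoothAlg n) (f : smoothAlg n) : Wd →ₗ[ℝ] smoothAlg n where
  toFun v := dop a v f
  map_add' u v := by rw [map_add]; rfl
  map_smul' c u := by rw [map_smul]; rfl

/-- One step of the recursion for the bracket. -/
def braStep (a : Fin n → smoothAlg n) (b : Bool) : Module.End ℝ (Wd →ₗ[ℝ] smoothAlg n) where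
  toFun h := ((dv a b : smoothAlg n →ₗ[ℂ] smoothAlg n).restrictScalars ℝ).comp h -
    h.comp (LinearMap.mulLeft ℝ (lt b))
  map_add' g h := by ext1; simp; abel
  map_smul' c h := by ext1; simp [smul_sub]

/-- The bracket `⟨u, v⟩`: `u` differentiates the holomorphic slot and `v` the antiholomorphic slot
of the polarization of `f`. -/
def bra (a : Fin n → smoothAlg n) (f : smoothAlg n) (u : Wd) : Wd →ₗ[ℝ] smoothAlg n :=
  FreeAlgebra.lift ℝ (braStep a) u (bra0 a f)

variable (a : Fin n → smoothAlg n)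

theorem bra_one (f : smoothAlg n) (v : Wd) : bra a f 1 v = dop a v f := by
  simp [bra, bra0]

theorem bra_lt_mul (f : smoothAlg n) (b : Bool) (u v : Wd) :
    bra a f (lt b * u) v = dv a b (bra a f u v) - bra a f u (lt b * v) := by
  simp [bra, braStep]

theorem bra_add (f : smoothAlg n) (u u' v : Wd) :
    bra a f (u + u') v = bra a f u v + bra a f u' v := by
  unfold bra
  have h : FreeAlgebra.lift ℝ (braStep a) (u + u') =
      FreeAlgebra.lift ℝ (braStep a) u + FreeAlgebra.lift ℝ (braStep a) u' :=
    (FreeAlgebra.lift ℝ (braStep a)).map_add' u u'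
  rw [h]
  rfl

theorem bra_smul (f : smoothAlg n) (c : ℝ) (u v : Wd) :
    bra a f (c • u) v = c • bra a f u v := by
  unfold bra
  rw [AlgHom.map_smul_of_tower]
  rfl

theorem bra_sub (f : smoothAlg n) (u u' v : Wd) :
    bra a f (u - u') v = bra a f u v - bra a f u' v := by
  have h1 : u - u' = u + (-1 : ℝ) • u' := by rw [neg_one_smul, sub_eq_add_neg]
  rw [h1, bra_add, bra_smul, neg_one_smul, sub_eq_add_neg]

theorem dop_hol_mul (g h : MvPolynomial (Fin n) ℂ) (v : Wd) :
    dop a v (hol g * cj (hol h)) = hol g * act a v (cj (hol h)) := by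
  induction v using word_induction generalizing g with
  | one => rw [dop_one, map_one]; rfl
  | add u v hu hv => rw [map_add, LinearMap.add_apply, act_add, hu, hv, mul_add]
  | smul c u hu =>
    rw [map_smul, LinearMap.smul_apply, act_smul, hu]
    ext z; exact mul_left_comm (c : ℂ) _ _
  | gen b u hu =>
    rw [dop_lt_mul, hu, act_lt_mul]
    have : ∀ j, pz j (hol g * cj (hol h)) = hol (MvPolynomial.pderiv j g) * cj (hol h) := by
      intro j
      rw [Derivation.leibniz, pz_cj, pzb_hol, cj_zero, smul_zero, zero_add, pz_hol, smul_eq_mul,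
        mul_comm]
    simp only [this, hu, Derivation.leibniz, smul_eq_mul]
    rw [derivation_hol (dv a b) g, add_sub_assoc, Finset.mul_sum, ← Finset.sum_sub_distrib,
      Finset.sum_eq_zero, add_zero]
    intro j _
    rw [pz_hol]; ring

theorem bra_hol_mul (g h : MvPolynomial (Fin n) ℂ) (u v : Wd) :
    bra a (hol g * cj (hol h)) u v = act a u (hol g) * act a v (cj (hol h)) := by
  induction u using word_induction generalizing v with
  | one => rw [bra_one, dop_hol_mul, map_one]; rfl
  | add u u' hu hu' => rw [bra_add, hu, hu', act_add, add_mul]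
  | smul c u hu =>
    rw [bra_smul, hu, act_smul]; ext z; exact (mul_assoc (c : ℂ) _ _).symm
  | gen b u hu =>
    rw [bra_lt_mul, hu, hu, act_lt_mul, act_lt_mul, Derivation.leibniz]
    simp only [smul_eq_mul]; ring

theorem bra_add_fun (f g : smoothAlg n) (u v : Wd) :
    bra a (f + g) u v = bra a f u v + bra a g u v := by
  have : bra0 a (f + g) = bra0 a f + bra0 a g := by
    ext1 v; exact map_add (dop a v) f g
  unfold bra
  rw [this, map_add, LinearMap.add_apply]

theorem Flat.dv {p : Fin n → ℂ} {K : ℕ} {f : smoothAlg n} (b : Bool) (hf : Flat p (K + 1) f) :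
    Flat p K (dv a b f) := by
  have hs : ∀ g : Fin n → smoothAlg n, (∀ j, Flat p K (g j)) → Flat p K (∑ j, g j) := by
    intro g hg
    exact Finset.sum_induction _ _ (fun _ _ => Flat.add) (flat_zero p K) fun j _ => hg j
  have h1 : Flat p K (fieldL a f) := by
    rw [fieldL_apply]; exact hs _ fun j => (hf.2 (Sum.inl j)).mul_left _
  have h2 : Flat p K (fieldLb a f) := by
    rw [fieldLb_apply]; exact hs _ fun j => (hf.2 (Sum.inr j)).mul_left _
  cases b
  · exact (h1.sub h2).smul I
  · exact h1.add h2

theorem dop_flat (v : Wd) : ∃ d, ∀ K p f, Flat p (K + d) f → Flat p K (dop a v f) := by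
  induction v using word_induction with
  | one => exact ⟨0, fun K p f h => by rwa [dop_one]⟩
  | add u v hu hv =>
    obtain ⟨d1, h1⟩ := hu
    obtain ⟨d2, h2⟩ := hv
    refine ⟨max d1 d2, fun K p f h => ?_⟩
    rw [map_add]
    exact (h1 K p f (h.mono (by omega))).add (h2 K p f (h.mono (by omega)))
  | smul c u hu =>
    obtain ⟨d, h1⟩ := hu
    refine ⟨d, fun K p f h => ?_⟩
    rw [map_smul]
    exact (h1 K p f h).smul (c : ℂ)
  | gen b u hu =>
    obtain ⟨d, h1⟩ := hu
    refine ⟨d + 1, fun K p f h => ?_⟩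
    rw [dop_lt_mul]
    refine ((h1 (K + 1) p f (h.mono (by omega))).dv a b).sub ?_
    refine Finset.sum_induction _ _ (fun _ _ => Flat.add) (flat_zero p K) fun j _ => ?_
    exact (h1 K p _ (h.2 (Sum.inl j))).mul_left _

theorem bra_flat (u v : Wd) : ∃ d, ∀ K p f, Flat p (K + d) f → Flat p K (bra a f u v) := by
  induction u using word_induction generalizing v with
  | one => simp only [bra_one]; exact dop_flat a v
  | add u u' hu hu' =>
    obtain ⟨d1, h1⟩ := hu v
    obtain ⟨d2, h2⟩ := hu' v
    refine ⟨max d1 d2, fun K p f h => ?_⟩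
    rw [bra_add]
    exact (h1 K p f (h.mono (by omega))).add (h2 K p f (h.mono (by omega)))
  | smul c u hu =>
    obtain ⟨d, h1⟩ := hu v
    refine ⟨d, fun K p f h => ?_⟩
    rw [bra_smul]
    exact (h1 K p f h).smul (c : ℂ)
  | gen b u hu =>
    obtain ⟨d1, h1⟩ := hu v
    obtain ⟨d2, h2⟩ := hu (lt b * v)
    refine ⟨max (d1 + 1) d2, fun K p f h => ?_⟩
    rw [bra_lt_mul]
    exact ((h1 (K + 1) p f (h.mono (by omega))).dv a b).sub (h2 K p f (h.mono (by omega)))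

theorem bra_flat_eq_zero (u v : Wd) : ∃ K, ∀ p f, Flat p K f → (bra a f u v).1 p = 0 := by
  obtain ⟨d, h⟩ := bra_flat a u v
  exact ⟨1 + d, fun p f hf => (h 1 p f hf).1⟩

theorem cj_bra (f : smoothAlg n) (u v : Wd) : cj (bra a f u v) = bra a (cj f) v u := by
  ext p
  obtain ⟨K1, h1⟩ := bra_flat_eq_zero a u v
  obtain ⟨K2, h2⟩ := bra_flat_eq_zero a v u
  refine smooth_induction (P := fun f => (cj (bra a f u v)).1 p = (bra a (cj f) v u).1 p)
    p (max K1 K2) ?_ ?_ ?_ f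
  · intro f g hf hg
    rw [bra_add_fun, cj_add, cj_add, bra_add_fun]
    exact congrArg₂ (· + ·) hf hg
  · intro f hf
    rw [cj_apply, h1 p f (hf.mono (le_max_left _ _)),
      h2 p _ (hf.cj.mono (le_max_right _ _)), map_zero]
  · intro g h
    have : cj (hol g * cj (hol h)) = hol h * cj (hol g) := by rw [cj_mul, cj_cj, mul_comm]
    rw [this, bra_hol_mul, bra_hol_mul, cj_mul, act_cj, act_cj, cj_cj, mul_comm]

theorem bra_mul_true (f : smoothAlg n) (u v : Wd) :
    bra a f (u * lt true) v = -(I • bra a f (u * lt false) v) := by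
  induction u using word_induction generalizing v with
  | one =>
    have h := fun b => bra_lt_mul a f b 1 v
    simp only [mul_one] at h
    rw [one_mul, one_mul, h, h, bra_one, bra_one, bra_one, dop_lt_mul, dop_lt_mul]
    simp only [dv_cz_true, dv_cz_false, sub_sub_cancel, Finset.smul_sum, ← smul_mul_assoc,
      smul_smul, I_mul_I, neg_smul, one_smul]
    rw [← Finset.sum_neg_distrib]
    exact Finset.sum_congr rfl fun j _ => by ring
  | add u u' hu hu' => simp only [add_mul, bra_add, hu, hu', smul_add, neg_add]
  | smul c u hu =>
    simp only [smul_mul_assoc, bra_smul, hu, smul_neg]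
    rw [smul_comm]
  | gen b u hu =>
    rw [mul_assoc, mul_assoc, bra_lt_mul, bra_lt_mul, hu, hu, map_neg, Derivation.map_smul,
      smul_sub]
    abel

theorem IsLie.act_bra {g : Wd} (hg : IsLie g) (f : smoothAlg n) (u v : Wd) :
    act a g (bra a f u v) = bra a f (g * u) v + bra a f u (g * v) := by
  induction hg generalizing u v with
  | gen b => rw [act_lt, bra_lt_mul]; abel
  | add _ _ h1 h2 =>
    rw [act_add, h1, h2, add_mul, add_mul, bra_add, map_add]; abel
  | smul c _ h => rw [act_smul, h, smul_mul_assoc, smul_mul_assoc, bra_smul, map_smul, smul_add]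
  | @ad b w _ h =>
    have hb : ∀ u v, dv a b (bra a f u v) = bra a f (lt b * u) v + bra a f u (lt b * v) := by
      intro u v; rw [bra_lt_mul]; abel
    rw [map_sub, LinearMap.sub_apply, act_lt_mul, map_mul, Module.End.mul_apply, act_lt, hb, h,
      map_add, map_add, hb, hb, h, h, sub_mul, sub_mul, bra_sub, map_sub, mul_assoc, mul_assoc,
      mul_assoc, mul_assoc]
    abel

end

section

/-- The formal properties of the bracket on a set of points which force it to vanish. -/
structure BracketHyp {T : Type*} (β : T → Wd → Wd → ℂ) : Prop where
  add_left : ∀ t u u' v, β t (u + u') v = β t u v + β t u' v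
  smul_left : ∀ t (c : ℝ) u v, β t (c • u) v = c * β t u v
  leib : ∀ g u v, IsLie g → (∀ t, β t u v = 0) → ∀ t, β t (g * u) v + β t u (g * v) = 0
  kill : ∀ t u v, β t (u * lt true) v = -(I * β t (u * lt false) v)
  herm : ∀ t u v, (starRingEnd ℂ) (β t u v) = β t v u
  one : ∀ t, β t 1 1 = 0
  null : ∀ V, IsLie V → (∀ t, β t V 1 = 0) → ∀ t, β t (lt true) V = 0
  pos : ∀ t W (V : Fin 2 → Wd) (c : Fin 2 → ℂ) k, IsLie W → (∀ i, IsLie (V i)) → Odd k →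
    (∀ a b, a + b < k → ∀ i j, β t (W ^ a * V i) (W ^ b * V j) = 0) →
    (∀ a b, a + b ≤ k → β t (W ^ a) (W ^ b) = 0) →
    (∀ a b, a + b ≤ k → ∀ i, β t (W ^ a * V i) (W ^ b) = 0) →
    ∑ x ∈ Finset.HasAntidiagonal.antidiagonal k, I ^ x.1 * (-I) ^ x.2 / (x.1.factorial * x.2.factorial) *
      ∑ i, ∑ j, c i * (starRingEnd ℂ) (c j) * β t (W ^ x.1 * V i) (W ^ x.2 * V j) = 0

/-- Coefficients of `(W + s v) ^ k` as a polynomial in `s`. -/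
def powCoeff (W v : Wd) : ℕ → ℕ → Wd
  | 0, 0 => 1
  | 0, _ + 1 => 0
  | k + 1, 0 => W * powCoeff W v k 0
  | k + 1, i + 1 => W * powCoeff W v k (i + 1) + v * powCoeff W v k i

theorem powCoeff_eq_zero (W v : Wd) (k i : ℕ) (h : k < i) : powCoeff W v k i = 0 := by
  induction k generalizing i with
  | zero => cases i with
    | zero => omega
    | succ i => rfl
  | succ k ih => cases i with
    | zero => omega
    | succ i => rw [powCoeff, ih _ (by omega), ih _ (by omega)]; simp

theorem pow_add_smul (W v : Wd) (s : ℝ) (k : ℕ) :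
    (W + s • v) ^ k = ∑ i ∈ Finset.range (k + 1), s ^ i • powCoeff W v k i := by
  induction k with
  | zero => simp [powCoeff]
  | succ k ih =>
    rw [pow_succ', add_mul]
    rw [Finset.sum_range_succ' _ (k + 1)]
    simp only [powCoeff, smul_add, Finset.sum_add_distrib]
    have h1 : W * (W + s • v) ^ k = ∑ i ∈ Finset.range (k + 1),
        s ^ (i + 1) • (W * powCoeff W v k (i + 1)) + s ^ 0 • (W * powCoeff W v k 0) := by
      rw [← Finset.sum_range_succ' (fun i => s ^ i • (W * powCoeff W v k i)),
        Finset.sum_range_succ _ (k + 1), powCoeff_eq_zero W v k (k + 1) (by omega), ih,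
        Finset.mul_sum]
      simp
    have h2 : s • v * (W + s • v) ^ k = ∑ i ∈ Finset.range (k + 1),
        s ^ (i + 1) • (v * powCoeff W v k i) := by
      rw [ih, Finset.mul_sum]
      refine Finset.sum_congr rfl fun i _ => ?_
      rw [smul_mul_smul_comm, pow_succ']
    rw [h1, h2]; abel

theorem powCoeff_zero (W v : Wd) (k : ℕ) : powCoeff W v k 0 = W ^ k := by
  induction k with
  | zero => rfl
  | succ k ih => rw [powCoeff, ih, pow_succ']

theorem coeff_eq_zero_of_forall_real {N : ℕ} (c : ℕ → ℂ)
    (h : ∀ s : ℝ, ∑ i ∈ Finset.range N, (s : ℂ) ^ i * c i = 0) {i : ℕ} (hi : i < N) : c i = 0 := by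
  let q : Polynomial ℂ := ∑ i ∈ Finset.range N, Polynomial.monomial i (c i)
  have hq : q = 0 := by
    refine Polynomial.eq_zero_of_infinite_isRoot q ?_
    refine Set.Infinite.mono (s := Set.range ((↑) : ℝ → ℂ)) ?_
      (Set.infinite_range_of_injective Complex.ofReal_injective)
    rintro _ ⟨s, rfl⟩
    change q.eval _ = 0
    rw [Polynomial.eval_finsetSum, ← h s]
    exact Finset.sum_congr rfl fun i _ => by rw [Polynomial.eval_monomial, mul_comm]
  have : q.coeff i = c i := by
    simp only [q, Polynomial.finsetSum_coeff, Polynomial.coeff_monomial]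
    rw [Finset.sum_ite_eq' (Finset.range N) i c, if_pos (Finset.mem_range.2 hi)]
  rw [← this, hq, Polynomial.coeff_zero]

/-- A symmetric multilinear expression on Lie polynomials vanishes if it vanishes on the
diagonal. -/
theorem polarization (F : Wd →ₗ[ℝ] ℂ) (j : ℕ)
    (hperm : ∀ l l' : List Wd, (∀ g ∈ l, IsLie g) → l.length = j → l.Perm l' →
      F l.prod = F l'.prod)
    (hdiag : ∀ W, IsLie W → F (W ^ j) = 0) (l : List Wd) (hl : ∀ g ∈ l, IsLie g)
    (hlen : l.length = j) : F l.prod = 0 := by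
  have key : ∀ l : List Wd, (∀ g ∈ l, IsLie g) → ∀ k, l.length + k = j → ∀ W, IsLie W →
      F (l.prod * W ^ k) = 0 := by
    intro l
    induction l with
    | nil =>
      intro _ k hk W hW
      simp only [List.length_nil, zero_add] at hk
      rw [List.prod_nil, one_mul, hk, hdiag W hW]
    | cons v l ih =>
      intro hl k hk W hW
      have hv : IsLie v := hl v (by simp)
      have hl' : ∀ g ∈ l, IsLie g := fun g hg => hl g (by simp [hg])
      simp only [List.length_cons] at hk
      have h1 : ∀ s : ℝ, ∑ i ∈ Finset.range (k + 1 + 1),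
          (s : ℂ) ^ i * F (l.prod * powCoeff W v (k + 1) i) = 0 := by
        intro s
        have := ih hl' (k + 1) (by omega) (W + s • v) (hW.add (hv.smul s))
        rw [pow_add_smul, Finset.mul_sum, map_sum] at this
        rw [← this]
        refine Finset.sum_congr rfl fun i _ => ?_
        rw [mul_smul_comm, map_smul, Complex.real_smul]; push_cast; rfl
      have h2 := coeff_eq_zero_of_forall_real _ h1 (i := 1) (by omega)
      have h3 : ∀ m r, l.length + r + (m + 1) = j →
          F (l.prod * (W ^ r * powCoeff W v (m + 1) 1)) =
            (m + 1 : ℂ) * F ((v :: l).prod * W ^ (r + m)) := by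
        intro m
        induction m with
        | zero =>
          intro r hr
          simp only [powCoeff, mul_zero, zero_add, mul_one, Nat.cast_zero, one_mul, add_zero]
          have := hperm (l ++ (List.replicate r W ++ [v])) (v :: l ++ List.replicate r W) ?_ ?_ ?_
          · simpa [mul_assoc] using this
          · intro g hg
            simp only [List.mem_append, List.mem_replicate, List.mem_singleton] at hg
            rcases hg with h | h | h
            exacts [hl' g h, h.2 ▸ hW, h ▸ hv]
          · simp; omega
          · have : (l ++ (List.replicate r W ++ [v])) = (l ++ List.replicate r W) ++ [v] := by simp
            rw [this]
            exact List.perm_append_singleton v _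
        | succ m ihm =>
          intro r hr
          rw [powCoeff, powCoeff_zero, mul_add, ← mul_assoc (W ^ r), ← pow_succ, mul_add, map_add,
            ihm (r + 1) (by omega)]
          have := hperm (l ++ (List.replicate r W ++ v :: List.replicate (m + 1) W))
            (v :: l ++ List.replicate (r + (m + 1)) W) ?_ ?_ ?_
          · simp only [List.prod_append, List.prod_replicate, List.prod_cons,
              List.cons_append] at this
            rw [this]
            simp only [List.prod_cons, mul_assoc]
            rw [show r + 1 + m = r + (m + 1) by omega]
            push_cast; ring
          · intro g hg
            simp only [List.mem_append, List.mem_replicate, List.mem_cons] at hg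
            rcases hg with h | h | h | h
            exacts [hl' g h, h.2 ▸ hW, h ▸ hv, h.2 ▸ hW]
          · simp; omega
          · have : List.replicate (r + (m + 1)) W =
                List.replicate r W ++ List.replicate (m + 1) W := List.replicate_add _ _ _
            rw [this, ← List.append_assoc, List.cons_append, ← List.append_assoc]
            exact List.perm_middle
      have h4 := h3 k 0 (by omega)
      rw [pow_zero, one_mul, h2, zero_add] at h4
      have h5 : (k + 1 : ℂ) ≠ 0 := by exact_mod_cast Nat.succ_ne_zero k
      exact (mul_eq_zero.1 h4.symm).resolve_left h5
  simpa using key l hl 0 (by simpa using hlen) (lt true) (IsLie.gen true)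

theorem eq_zero_of_conj {p q σ : ℂ} (hσ0 : σ ≠ 0)
    (hp : (starRingEnd ℂ) p = σ * p) (hq : (starRingEnd ℂ) q = σ * q) (h : p = -(I * q)) :
    p = 0 ∧ q = 0 := by
  have h1 : (starRingEnd ℂ) p = I * (σ * q) := by
    rw [h, map_neg, map_mul, conj_I, hq]; ring
  rw [hp, h] at h1
  have h2 : (2 * I * σ) * q = 0 := by linear_combination -h1
  have h3 : q = 0 := (mul_eq_zero.1 h2).resolve_left
    (mul_ne_zero (mul_ne_zero two_ne_zero I_ne_zero) hσ0)
  exact ⟨by rw [h, h3]; simp, h3⟩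


theorem IsLie.bracket {u v : Wd} (hu : IsLie u) (hv : IsLie v) : IsLie (u * v - v * u) := by
  induction hu generalizing v with
  | gen b => exact hv.ad b
  | add _ _ h1 h2 =>
    rw [show ∀ x y : Wd, (x + y) * v - v * (x + y) = (x * v - v * x) + (y * v - v * y) from
      fun x y => by noncomm_ring]
    exact (h1 hv).add (h2 hv)
  | smul c _ h =>
    rw [smul_mul_assoc, mul_smul_comm, ← smul_sub]
    exact (h hv).smul c
  | @ad b w _ h =>
    have h1 := (h hv).ad b
    have h2 := h (hv.ad b)
    rw [show (lt b * w - w * lt b) * v - v * (lt b * w - w * lt b) =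
      (lt b * (w * v - v * w) - (w * v - v * w) * lt b) +
        (-1 : ℝ) • (w * (lt b * v - v * lt b) - (lt b * v - v * lt b) * w) by
      rw [neg_one_smul]; noncomm_ring]
    exact h1.add (h2.smul _)

namespace BracketHyp

variable {T : Type*} {β : T → Wd → Wd → ℂ}

/-- The bracket as a linear function of its first slot. -/
def linLeft (H : BracketHyp β) (t : T) (v : Wd) : Wd →ₗ[ℝ] ℂ where
  toFun u := β t u v
  map_add' u u' := H.add_left t u u' v
  map_smul' c u := by rw [H.smul_left, Complex.real_smul]; rfl

theorem linLeft_apply (H : BracketHyp β) (t : T) (u v : Wd) : H.linLeft t v u = β t u v := rfl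

theorem sub_left (H : BracketHyp β) (t u u' v) : β t (u - u') v = β t u v - β t u' v :=
  map_sub (H.linLeft t v) u u'

/-- All brackets of Lie polynomials of total length less than `m` vanish. -/
def Zlt (β : T → Wd → Wd → ℂ) (m : ℕ) : Prop :=
  ∀ l₁ l₂ : List Wd, (∀ g ∈ l₁, IsLie g) → (∀ g ∈ l₂, IsLie g) → l₁.length + l₂.length < m →
    ∀ t, β t l₁.prod l₂.prod = 0

/-- `V` is a Lie polynomial all of whose brackets of total length `m` vanish. -/
def InK (β : T → Wd → Wd → ℂ) (m : ℕ) (V : Wd) : Prop :=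
  IsLie V ∧ ∀ l : List Wd, (∀ g ∈ l, IsLie g) → l.length + 1 = m → ∀ t, β t (l ++ [V]).prod 1 = 0

theorem move (H : BracketHyp β) {m : ℕ} (hZ : Zlt β m) (l₂ : List Wd) :
    ∀ l₁ : List Wd, (∀ g ∈ l₁, IsLie g) → (∀ g ∈ l₂, IsLie g) → l₁.length + l₂.length = m →
    ∀ t, β t l₁.prod l₂.prod = (-1) ^ l₂.length * β t (l₂.reverse ++ l₁).prod 1 := by
  induction l₂ with
  | nil => intro l₁ _ _ _ t; simp
  | cons V l ih =>
    intro l₁ h1 h2 hm t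
    have hV : IsLie V := h2 V (by simp)
    have h2' : ∀ g ∈ l, IsLie g := fun g hg => h2 g (by simp [hg])
    simp only [List.length_cons] at hm
    have h3 := H.leib V l₁.prod l.prod hV (hZ l₁ l h1 h2' (by omega)) t
    have h4 := ih (V :: l₁) (by
      intro g hg
      rcases List.mem_cons.1 hg with h | h
      exacts [h ▸ hV, h1 g h]) h2' (by simp; omega) t
    rw [List.prod_cons] at h4
    rw [List.prod_cons, List.length_cons, pow_succ, List.reverse_cons, List.append_assoc,
      List.singleton_append, mul_neg_one, neg_mul, ← h4]
    linear_combination h3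

theorem perm (H : BracketHyp β) {m : ℕ} (hZ : Zlt β m) {l l' : List Wd} (hp : l.Perm l') (t : T) :
    ∀ pre : List Wd, (∀ g ∈ pre, IsLie g) → (∀ g ∈ l, IsLie g) → pre.length + l.length = m →
    β t (pre ++ l).prod 1 = β t (pre ++ l').prod 1 := by
  induction hp with
  | nil => intros; rfl
  | cons x _ ih =>
    intro pre h1 h2 hm
    have := ih (pre ++ [x]) (by
      intro g hg
      rcases List.mem_append.1 hg with h | h
      · exact h1 g h
      · exact h2 g (by simp [List.mem_singleton.1 h])) (fun g hg => h2 g (by simp [hg]))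
      (by simp at hm ⊢; omega)
    simpa using this
  | swap x y l =>
    intro pre h1 h2 hm
    have hx : IsLie x := h2 x (by simp)
    have hy : IsLie y := h2 y (by simp)
    have h := hZ (pre ++ (y * x - x * y) :: l) [] (by
      intro g hg
      rcases List.mem_append.1 hg with h | h
      · exact h1 g h
      · rcases List.mem_cons.1 h with h | h
        · exact h ▸ hy.bracket hx
        · exact h2 g (by simp [h])) (by simp) (by simp at hm ⊢; omega) t
    rw [List.prod_nil] at h
    have e : (pre ++ (y * x - x * y) :: l).prod = (pre ++ y :: x :: l).prod -
        (pre ++ x :: y :: l).prod := by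
      simp only [List.prod_append, List.prod_cons]; noncomm_ring
    rw [e, H.sub_left] at h
    exact sub_eq_zero.1 h
  | trans h12 _ ih1 ih2 =>
    intro pre h1 h2 hm
    rw [ih1 pre h1 h2 hm]
    exact ih2 pre h1 (fun g hg => h2 g (h12.mem_iff.2 hg)) (by rw [← h12.length_eq]; exact hm)

theorem perm' (H : BracketHyp β) {m : ℕ} (hZ : Zlt β m) {l l' : List Wd} (hp : l.Perm l') (t : T)
    (hl : ∀ g ∈ l, IsLie g) (hm : l.length = m) : β t l.prod 1 = β t l'.prod 1 :=
  H.perm hZ hp t [] (by simp) hl (by simpa using hm)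

theorem conj_eq (H : BracketHyp β) {m : ℕ} (hZ : Zlt β m) (l : List Wd) (hl : ∀ g ∈ l, IsLie g)
    (hm : l.length = m) (t : T) :
    (starRingEnd ℂ) (β t l.prod 1) = (-1) ^ m * β t l.prod 1 := by
  have h := H.move hZ l [] (by simp) hl (by simpa using hm) t
  rw [List.prod_nil, List.append_nil, hm] at h
  rw [H.herm, h, H.perm' hZ (l.reverse_perm) t (by simpa using hl) (by simpa using hm)]

theorem letter_inK (H : BracketHyp β) {m : ℕ} (hZ : Zlt β m) (b : Bool) : InK β m (lt b) := by
  refine ⟨IsLie.gen b, fun l hl hm t => ?_⟩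
  have hc : ∀ b, ∀ g ∈ l ++ [lt b], IsLie g := by
    intro b g hg
    rcases List.mem_append.1 hg with h | h
    · exact hl g h
    · rw [List.mem_singleton.1 h]; exact IsLie.gen b
  have h1 := H.conj_eq hZ (l ++ [lt true]) (hc _) (by simpa using hm) t
  have h2 := H.conj_eq hZ (l ++ [lt false]) (hc _) (by simpa using hm) t
  have h3 : β t (l ++ [lt true]).prod 1 = -(I * β t (l ++ [lt false]).prod 1) := by
    have := H.kill t l.prod 1
    simpa using this
  have h4 := eq_zero_of_conj (pow_ne_zero m (neg_ne_zero.2 one_ne_zero)) h1 h2 h3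
  cases b
  exacts [h4.2, h4.1]

theorem InK.mem (H : BracketHyp β) {m : ℕ} (hZ : Zlt β m) {V : Wd} (hV : InK β m V) (l : List Wd)
    (hl : ∀ g ∈ l, IsLie g) (hm : l.length = m) (hVl : V ∈ l) (t : T) : β t l.prod 1 = 0 := by
  obtain ⟨s, r, rfl⟩ := List.append_of_mem hVl
  have h := hV.2 (s ++ r) (by
    intro g hg
    rcases List.mem_append.1 hg with h | h
    exacts [hl g (by simp [h]), hl g (by simp [h])]) (by simp at hm ⊢; omega) t
  rw [← h]
  refine H.perm' hZ ?_ t hl hm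
  exact List.perm_middle.trans (List.perm_append_singleton V (s ++ r)).symm

theorem InK.zero (H : BracketHyp β) {m : ℕ} (hZ : Zlt β m) {V : Wd} (hV : InK β m V)
    (l₁ l₂ : List Wd) (h1 : ∀ g ∈ l₁, IsLie g) (h2 : ∀ g ∈ l₂, IsLie g)
    (hm : l₁.length + l₂.length ≤ m) (hVl : V ∈ l₁ ∨ V ∈ l₂) (t : T) :
    β t l₁.prod l₂.prod = 0 := by
  rcases hm.lt_or_eq with hm | hm
  · exact hZ l₁ l₂ h1 h2 hm t
  · rw [H.move hZ l₂ l₁ h1 h2 hm t, InK.mem H hZ hV, mul_zero]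
    · intro g hg
      rcases List.mem_append.1 hg with h | h
      exacts [h2 g (List.mem_reverse.1 h), h1 g h]
    · simp; omega
    · rcases hVl with h | h <;> simp [h]

theorem InK.add (H : BracketHyp β) {m : ℕ} {V V' : Wd} (hV : InK β m V) (hV' : InK β m V') :
    InK β m (V + V') := by
  refine ⟨hV.1.add hV'.1, fun l hl hm t => ?_⟩
  have h1 := hV.2 l hl hm t
  have h2 := hV'.2 l hl hm t
  simp only [List.prod_append, List.prod_singleton] at h1 h2 ⊢
  rw [mul_add, H.add_left, h1, h2, add_zero]

theorem InK.smul (H : BracketHyp β) {m : ℕ} {V : Wd} (hV : InK β m V) (c : ℝ) :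
    InK β m (c • V) := by
  refine ⟨hV.1.smul c, fun l hl hm t => ?_⟩
  have h1 := hV.2 l hl hm t
  simp only [List.prod_append, List.prod_singleton] at h1 ⊢
  rw [mul_smul_comm, H.smul_left, h1, mul_zero]

theorem mem_replicate_append {W V : Wd} (hW : IsLie W) (hV : IsLie V) (a : ℕ) :
    ∀ g ∈ List.replicate a W ++ [V], IsLie g := by
  intro g hg
  rcases List.mem_append.1 hg with h | h
  · rw [List.eq_of_mem_replicate h]; exact hW
  · rw [List.mem_singleton.1 h]; exact hV

theorem prod_replicate_append (W V : Wd) (a : ℕ) :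
    (List.replicate a W ++ [V]).prod = W ^ a * V := by simp

theorem shift (H : BracketHyp β) {m : ℕ} (hZ : Zlt β m) {W V V' : Wd} (hW : IsLie W)
    (hV : InK β m V) (hV' : InK β m V') (a : ℕ) :
    ∀ b, a + b + 1 ≤ m → ∀ t,
      β t (W ^ a * V) (W ^ b * V') = (-1) ^ a * β t V (W ^ (a + b) * V') := by
  induction a with
  | zero => intro b _ t; simp
  | succ a ih =>
    intro b hb t
    have h := H.leib W (W ^ a * V) (W ^ b * V') hW (fun t => by
      have := InK.zero H hZ hV (List.replicate a W ++ [V]) (List.replicate b W ++ [V'])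
        (mem_replicate_append hW hV.1 a) (mem_replicate_append hW hV'.1 b) (by simp; omega)
        (by simp) t
      rwa [prod_replicate_append, prod_replicate_append] at this) t
    have h2 := ih (b + 1) (by omega) t
    rw [← mul_assoc, ← mul_assoc, ← pow_succ', ← pow_succ'] at h
    rw [show a + 1 + b = a + (b + 1) by ring, pow_succ (-1 : ℂ)]
    linear_combination h - h2

theorem sum_inv_factorial_ne_zero (k : ℕ) :
    ∑ x ∈ Finset.HasAntidiagonal.antidiagonal k, (1 : ℂ) / (x.1.factorial * x.2.factorial) ≠ 0 := by
  have : (0 : ℝ) < ∑ x ∈ Finset.HasAntidiagonal.antidiagonal k,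
      (1 : ℝ) / (x.1.factorial * x.2.factorial) := by
    refine Finset.sum_pos (fun x _ => by positivity) ⟨(0, k), by simp⟩
  intro h
  apply this.ne'
  have h2 := congrArg Complex.re h
  rw [← Complex.ofReal_inj]
  push_cast
  exact h

theorem cross (H : BracketHyp β) {m : ℕ} (hZ : Zlt β m) {k : ℕ} (hk : k + 1 = m) (hodd : Odd k)
    {W : Wd} (hW : IsLie W) (V : Fin 2 → Wd) (hV : ∀ i, InK β m (V i)) (t : T) :
    β t (V 0) (W ^ k * V 1) = 0 := by
  have hsum : ∀ c : Fin 2 → ℂ,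
      ∑ i, ∑ j, c i * (starRingEnd ℂ) (c j) * β t (V i) (W ^ k * V j) = 0 := by
    intro c
    have hrep : ∀ a, (∀ g ∈ List.replicate a W, IsLie g) := fun a g hg => by
      rw [List.eq_of_mem_replicate hg]; exact hW
    have h := H.pos t W V c k hW (fun i => (hV i).1) hodd (fun a b hab i j => by
      have := InK.zero H hZ (hV i) (List.replicate a W ++ [V i]) (List.replicate b W ++ [V j])
        (mem_replicate_append hW (hV i).1 a) (mem_replicate_append hW (hV j).1 b) (by simp; omega)
        (by simp) t
      rwa [prod_replicate_append, prod_replicate_append] at this) (fun a b hab => by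
      have := hZ (List.replicate a W) (List.replicate b W) (hrep a) (hrep b) (by simp; omega) t
      rwa [List.prod_replicate, List.prod_replicate] at this) (fun a b hab i => by
      have := InK.zero H hZ (hV i) (List.replicate a W ++ [V i]) (List.replicate b W)
        (mem_replicate_append hW (hV i).1 a) (hrep b) (by simp; omega) (by simp) t
      rwa [prod_replicate_append, List.prod_replicate] at this)
    have h2 : (-I) ^ k * (∑ x ∈ Finset.HasAntidiagonal.antidiagonal k,
        (1 : ℂ) / (x.1.factorial * x.2.factorial)) *
        (∑ i, ∑ j, c i * (starRingEnd ℂ) (c j) * β t (V i) (W ^ k * V j)) = 0 := by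
      rw [← h, mul_assoc, Finset.sum_mul, Finset.mul_sum]
      refine Finset.sum_congr rfl fun x hx => ?_
      have hx' : x.1 + x.2 = k := Finset.HasAntidiagonal.mem_antidiagonal.1 hx
      have e : ∀ i j, β t (W ^ x.1 * V i) (W ^ x.2 * V j) =
          (-1) ^ x.1 * β t (V i) (W ^ k * V j) := fun i j => by
        rw [H.shift hZ hW (hV i) (hV j) x.1 x.2 (by omega) t, hx']
      simp only [e]
      have e2 : ∑ i, ∑ j, c i * (starRingEnd ℂ) (c j) *
          ((-1) ^ x.1 * β t (V i) (W ^ k * V j)) = (-1) ^ x.1 *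
          ∑ i, ∑ j, c i * (starRingEnd ℂ) (c j) * β t (V i) (W ^ k * V j) := by
        simp only [Finset.mul_sum]
        exact Finset.sum_congr rfl fun i _ => Finset.sum_congr rfl fun j _ => by ring
      rw [e2, ← hx', pow_add, neg_pow I x.1]
      ring
    rcases mul_eq_zero.1 h2 with h3 | h3
    · rcases mul_eq_zero.1 h3 with h4 | h4
      · exact absurd h4 (pow_ne_zero _ (neg_ne_zero.2 I_ne_zero))
      · exact absurd h4 (sum_inv_factorial_ne_zero k)
    · exact h3
  have h1 := hsum ![1, 0]
  have h2 := hsum ![0, 1]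
  have h3 := hsum ![1, 1]
  have h4 := hsum ![1, I]
  simp only [Fin.sum_univ_two, Matrix.cons_val_zero, Matrix.cons_val_one, map_one, map_zero,
    conj_I, mul_one, mul_zero, zero_mul, one_mul, add_zero, zero_add] at h1 h2 h3 h4
  rw [h1, h2] at h3 h4
  have h5 : (2 * I) * β t (V 0) (W ^ k * V 1) = 0 := by
    linear_combination I * h3 - h4
  exact (mul_eq_zero.1 h5).resolve_left (mul_ne_zero two_ne_zero I_ne_zero)

theorem InK.ad (H : BracketHyp β) {m k : ℕ} (hZ : Zlt β m) (hk : k + 1 = m) {V : Wd}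
    (hV : InK β m V) (hlet : ∀ W, IsLie W → ∀ b t, β t (lt b) (W ^ k * V) = 0) (b : Bool) :
    InK β m (lt b * V - V * lt b) := by
  refine ⟨hV.1.ad b, fun l hl hm t => ?_⟩
  have hdiag : ∀ W, IsLie W → β t (W ^ k * (lt b * V - V * lt b)) 1 = 0 := by
    intro W hW
    have hrep : ∀ a, (∀ g ∈ List.replicate a W, IsLie g) := fun a g hg => by
      rw [List.eq_of_mem_replicate hg]; exact hW
    have hb : ∀ b, β t (W ^ k * (lt b * V)) 1 = 0 := by
      intro b
      have h1 := H.leib (lt b) 1 (W ^ k * V) (IsLie.gen b) (fun t => by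
        have := InK.zero H hZ hV [] (List.replicate k W ++ [V]) (by simp)
          (mem_replicate_append hW hV.1 k) (by simp; omega) (by simp) t
        rwa [prod_replicate_append] at this) t
      rw [mul_one, hlet W hW b t, zero_add] at h1
      have h2 : β t (lt b * (W ^ k * V)) 1 = 0 := by rw [← H.herm, h1, map_zero]
      have h3 : ∀ i, i ≤ k → β t (W ^ i * (lt b * (W ^ (k - i) * V))) 1 = 0 := by
        intro i
        induction i with
        | zero => intro _; simpa using h2
        | succ i ih =>
          intro hi
          have h4 := ih (by omega)
          have h5 := InK.mem H hZ hV
            (List.replicate i W ++ (lt b * W - W * lt b) :: (List.replicate (k - (i + 1)) W ++ [V]))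
            (by
              intro g hg
              rcases List.mem_append.1 hg with h | h
              · exact hrep _ g h
              · rcases List.mem_cons.1 h with h | h
                · rw [h]; exact hW.ad b
                · exact mem_replicate_append hW hV.1 _ g h) (by simp; omega) (by simp) t
          have e : (List.replicate i W ++ (lt b * W - W * lt b) ::
              (List.replicate (k - (i + 1)) W ++ [V])).prod =
              W ^ i * (lt b * (W ^ (k - i) * V)) -
                W ^ (i + 1) * (lt b * (W ^ (k - (i + 1)) * V)) := by
            rw [List.prod_append, List.prod_replicate, List.prod_cons, prod_replicate_append,
              show k - i = (k - (i + 1)) + 1 by omega, pow_succ' W (k - (i + 1)), pow_succ W i]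
            noncomm_ring
          rw [e, H.sub_left, h4, zero_sub, neg_eq_zero] at h5
          exact h5
      simpa using h3 k le_rfl
    have hr : ∀ b, β t (W ^ k * (lt b * V - V * lt b)) 1 = -β t (W ^ k * V * lt b) 1 := by
      intro b
      rw [mul_sub, H.sub_left, hb, zero_sub, mul_assoc]
    have hc : ∀ b, (starRingEnd ℂ) (β t (W ^ k * (lt b * V - V * lt b)) 1) =
        (-1) ^ m * β t (W ^ k * (lt b * V - V * lt b)) 1 := by
      intro b
      have := H.conj_eq hZ (List.replicate k W ++ [lt b * V - V * lt b])
        (mem_replicate_append hW (hV.1.ad b) k) (by simp; omega) t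
      rwa [prod_replicate_append] at this
    have h := eq_zero_of_conj (pow_ne_zero m (neg_ne_zero.2 one_ne_zero)) (hc true) (hc false)
      (by rw [hr, hr, H.kill]; ring)
    cases b
    exacts [h.2, h.1]
  have := polarization ((H.linLeft t 1).comp (LinearMap.mulRight ℝ (lt b * V - V * lt b))) k
    (fun l l' hl hlen hp => by
      have := H.perm' hZ (hp.append_right [lt b * V - V * lt b]) t (by
        intro g hg
        rcases List.mem_append.1 hg with h | h
        · exact hl g h
        · rw [List.mem_singleton.1 h]; exact hV.1.ad b) (by simp; omega)
      simpa [linLeft_apply] using this) hdiag l hl (by omega)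
  simpa [linLeft_apply] using this

theorem Zlt.succ_of_inK (H : BracketHyp β) {m : ℕ} (hm : m ≠ 0) (hZ : Zlt β m)
    (hK : ∀ V, IsLie V → InK β m V) : Zlt β (m + 1) := by
  intro l₁ l₂ h1 h2 hlen t
  have : ∃ V, V ∈ l₁ ∨ V ∈ l₂ ∨ l₁.length + l₂.length < m := by
    cases l₁ with
    | cons V l => exact ⟨V, by simp⟩
    | nil => cases l₂ with
      | cons V l => exact ⟨V, by simp⟩
      | nil => exact ⟨1, by simp; omega⟩
  obtain ⟨V, h | h | h⟩ := this
  · exact InK.zero H hZ (hK V (h1 V h)) l₁ l₂ h1 h2 (by omega) (Or.inl h) t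
  · exact InK.zero H hZ (hK V (h2 V h)) l₁ l₂ h1 h2 (by omega) (Or.inr h) t
  · exact hZ l₁ l₂ h1 h2 h t

theorem inK_of_isLie (H : BracketHyp β) {m : ℕ} (hZ : Zlt β m)
    (had : ∀ V b, InK β m V → InK β m (lt b * V - V * lt b)) {V : Wd} (hV : IsLie V) :
    InK β m V := by
  induction hV with
  | gen b => exact H.letter_inK hZ b
  | add _ _ h1 h2 => exact InK.add H h1 h2
  | smul c _ h => exact InK.smul H h c
  | ad b _ h => exact had _ b h

theorem zlt (H : BracketHyp β) (m : ℕ) : Zlt β m := by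
  induction m with
  | zero => intro _ _ _ _ h; omega
  | succ m hZ =>
    rcases Nat.even_or_odd m with hm | hm
    · rcases eq_or_ne m 0 with rfl | h0
      · intro l₁ l₂ _ _ hlen t
        have h1 : l₁ = [] := List.length_eq_zero_iff.1 (by omega)
        have h2 : l₂ = [] := List.length_eq_zero_iff.1 (by omega)
        rw [h1, h2]; exact H.one t
      · obtain ⟨k, rfl⟩ := Nat.exists_eq_succ_of_ne_zero h0
        have hk : Odd k := by
          rcases Nat.even_or_odd k with h | h
          · exact absurd hm (by rw [Nat.even_add_one]; exact not_not.2 h)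
          · exact h
        refine Zlt.succ_of_inK H h0 hZ fun V hV => H.inK_of_isLie hZ (fun V b hV => ?_) hV
        refine InK.ad H hZ rfl hV (fun W hW b t => ?_) b
        exact H.cross hZ rfl hk hW ![lt b, V] (by
          intro i; fin_cases i
          exacts [H.letter_inK hZ b, hV]) t
    · rcases eq_or_ne m 1 with rfl | h1
      · refine Zlt.succ_of_inK H one_ne_zero hZ fun V hV => H.inK_of_isLie hZ (fun V b hV => ?_) hV
        refine InK.ad H (k := 0) hZ rfl hV (fun W hW b t => ?_) b
        have h2 : ∀ t, β t (lt true) V = 0 := H.null V hV.1 (fun t => by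
          simpa using hV.2 [] (by simp) rfl t)
        rw [pow_zero, one_mul]
        cases b
        · have h3 := H.kill t 1 V
          rw [one_mul, one_mul, h2] at h3
          exact (mul_eq_zero.1 (neg_eq_zero.1 h3.symm)).resolve_left I_ne_zero
        · exact h2 t
      · obtain ⟨k, rfl⟩ : ∃ k, m = k + 2 := ⟨m - 2, by obtain ⟨r, hr⟩ := hm; omega⟩
        have hk : Odd k := by
          obtain ⟨r, hr⟩ := hm; exact ⟨r - 1, by omega⟩
        have hdiag : ∀ t W, IsLie W → β t (W ^ (k + 2)) 1 = 0 := by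
          intro t W hW
          have hrep : ∀ a, (∀ g ∈ List.replicate a W, IsLie g) := fun a g hg => by
            rw [List.eq_of_mem_replicate hg]; exact hW
          have hz : ∀ a b, a + b < k + 2 → β t (W ^ a) (W ^ b) = 0 := fun a b hab => by
            have := hZ (List.replicate a W) (List.replicate b W) (hrep a) (hrep b)
              (by simp; omega) t
            rwa [List.prod_replicate, List.prod_replicate] at this
          have h := H.pos t W ![W, W] ![1, 0] k hW (by intro i; fin_cases i <;> exact hW) hk
            (fun a b hab i j => by
              fin_cases i <;> fin_cases j <;>
                exact (by rw [← pow_succ, ← pow_succ]; exact hz _ _ (by omega) :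
                  β t (W ^ a * W) (W ^ b * W) = 0))
            (fun a b hab => hz _ _ (by omega))
            (fun a b hab i => by
              fin_cases i <;>
                exact (by rw [← pow_succ]; exact hz _ _ (by omega) :
                  β t (W ^ a * W) (W ^ b) = 0))
          have h2 : (-(I ^ k)) * (∑ x ∈ Finset.HasAntidiagonal.antidiagonal k,
              (1 : ℂ) / (x.1.factorial * x.2.factorial)) * β t (W ^ (k + 2)) 1 = 0 := by
            rw [← h, mul_assoc, Finset.sum_mul, Finset.mul_sum]
            refine Finset.sum_congr rfl fun x hx => ?_
            have hx' : x.1 + x.2 = k := Finset.HasAntidiagonal.mem_antidiagonal.1 hx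
            have e := H.move hZ (List.replicate (x.2 + 1) W) (List.replicate (x.1 + 1) W)
              (hrep _) (hrep _) (by simp; omega) t
            rw [List.reverse_replicate, ← List.replicate_add, List.prod_replicate,
              List.prod_replicate, List.prod_replicate, List.length_replicate,
              show x.2 + 1 + (x.1 + 1) = k + 2 by omega] at e
            simp only [Fin.sum_univ_two, Matrix.cons_val_zero, Matrix.cons_val_one, map_one,
              map_zero, mul_one, mul_zero, zero_mul, one_mul, add_zero]
            rw [← pow_succ, ← pow_succ, e, ← hx', pow_add, neg_pow I x.2, pow_succ (-1 : ℂ)]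
            have h1 : ((-1 : ℂ) ^ x.2) * (-1) ^ x.2 = 1 := by
              rw [← mul_pow]; simp
            linear_combination (I ^ x.1 * I ^ x.2 / (x.1.factorial * x.2.factorial) *
              β t (W ^ (x.1 + x.2 + 2)) 1) * h1
          rcases mul_eq_zero.1 h2 with h3 | h3
          · rcases mul_eq_zero.1 h3 with h4 | h4
            · exact absurd h4 (neg_ne_zero.2 (pow_ne_zero _ I_ne_zero))
            · exact absurd h4 (sum_inv_factorial_ne_zero k)
          · exact h3
        have hP : ∀ t, ∀ l : List Wd, (∀ g ∈ l, IsLie g) → l.length = k + 2 →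
            β t l.prod 1 = 0 := fun t l hl hlen =>
          polarization (H.linLeft t 1) (k + 2)
            (fun l l' hl hlen hp => H.perm' hZ hp t hl hlen) (hdiag t) l hl hlen
        intro l₁ l₂ h1 h2 hlen t
        rcases (Nat.lt_succ_iff.1 hlen).lt_or_eq with hlt | heq
        · exact hZ l₁ l₂ h1 h2 hlt t
        · rw [H.move hZ l₂ l₁ h1 h2 heq t, hP, mul_zero]
          · intro g hg
            rcases List.mem_append.1 hg with h | h
            exacts [h2 g (List.mem_reverse.1 h), h1 g h]
          · simp; omega

/-- All brackets of powers of the first letter vanish. -/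
theorem pow_eq_zero (H : BracketHyp β) (a b : ℕ) (t : T) : β t (lt true ^ a) (lt true ^ b) = 0 := by
  have hrep : ∀ a, (∀ g ∈ List.replicate a (lt true), IsLie g) := fun a g hg => by
    rw [List.eq_of_mem_replicate hg]; exact IsLie.gen true
  have := H.zlt (a + b + 1) (List.replicate a (lt true)) (List.replicate b (lt true))
    (hrep a) (hrep b) (by simp) t
  rwa [List.prod_replicate, List.prod_replicate] at this

end BracketHyp

end

section

variable {n : ℕ}

open Asymptotics Polynomial

/-- Agreement to order `N` at the origin. -/
def EqO (N : ℕ) (F G : ℂ → ℂ) : Prop :=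
  (fun ζ => F ζ - G ζ) =O[𝓝 (0 : ℂ)] fun ζ => ‖ζ‖ ^ (N + 1)

namespace EqO

variable {N : ℕ} {F G F' G' : ℂ → ℂ}

theorem refl (N : ℕ) (F : ℂ → ℂ) : EqO N F F := by
  unfold EqO; simp only [sub_self]; exact isBigO_zero _ _

theorem symm (h : EqO N F G) : EqO N G F := by
  unfold EqO at *; simpa using h.neg_left

theorem trans (h : EqO N F G) (h' : EqO N G G') : EqO N F G' := by
  unfold EqO at *; simpa using h.add h'

theorem add (h : EqO N F G) (h' : EqO N F' G') :
    EqO N (fun ζ => F ζ + F' ζ) (fun ζ => G ζ + G' ζ) := by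
  unfold EqO at *
  exact (IsBigO.add h h').congr_left fun ζ => by ring

theorem sum {ι : Type*} (s : Finset ι) {F G : ι → ℂ → ℂ} (h : ∀ i ∈ s, EqO N (F i) (G i)) :
    EqO N (fun ζ => ∑ i ∈ s, F i ζ) (fun ζ => ∑ i ∈ s, G i ζ) := by
  unfold EqO at *
  exact (IsBigO.sum h).congr_left fun ζ => by
    rw [Finset.sum_apply, Finset.sum_sub_distrib]

theorem conj (h : EqO N F G) :
    EqO N (fun ζ => (starRingEnd ℂ) (F ζ)) (fun ζ => (starRingEnd ℂ) (G ζ)) := by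
  unfold EqO at *
  refine IsBigO.of_norm_left (h.norm_left.congr_left fun ζ => ?_)
  rw [← map_sub, RCLike.norm_conj]

theorem mul (hF : F =O[𝓝 0] fun _ => (1 : ℝ)) (hG' : G' =O[𝓝 0] fun _ => (1 : ℝ))
    (h : EqO N F G) (h' : EqO N F' G') :
    EqO N (fun ζ => F ζ * F' ζ) (fun ζ => G ζ * G' ζ) := by
  unfold EqO at *
  have h1 := IsBigO.mul hF h'
  have h2 := IsBigO.mul h hG'
  simp only [one_mul, mul_one] at h1 h2
  exact (h1.add h2).congr_left fun ζ => by ring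

theorem apply_zero (h : EqO N F G) : F 0 = G 0 := by
  obtain ⟨C, hC⟩ := IsBigO.bound h
  have := hC.self_of_nhds
  simp at this
  exact sub_eq_zero.1 this

end EqO

theorem continuous_isBigO_one {F : ℂ → ℂ} (h : Continuous F) : F =O[𝓝 0] fun _ => (1 : ℝ) :=
  (h.tendsto 0).isBigO_one ℝ

variable (a : Fin n → smoothAlg n) (p : Fin n → ℂ) (W : Wd)

/-- Taylor coefficients along a Lie polynomial. -/
def jetCoeff (k : ℕ) (f : smoothAlg n) : ℂ := (act a (W ^ k) f).1 p / k.factorial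

/-- Taylor polynomial along a Lie polynomial. -/
def jet (N : ℕ) (f : smoothAlg n) : ℂ[X] :=
  ∑ k ∈ Finset.range (N + 1), monomial k (jetCoeff a p W k f)

theorem jet_coeff (N : ℕ) (f : smoothAlg n) {k : ℕ} (hk : k < N + 1) :
    (jet a p W N f).coeff k = jetCoeff a p W k f := by
  simp only [jet, finsetSum_coeff, coeff_monomial]
  rw [Finset.sum_ite_eq' (Finset.range (N + 1)) k (fun k => jetCoeff a p W k f),
    if_pos (Finset.mem_range.2 hk)]

theorem jet_eval (N : ℕ) (f : smoothAlg n) (ζ : ℂ) :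
    (jet a p W N f).eval ζ =
      ∑ k ∈ Finset.range (N + 1), ζ ^ k / k.factorial * (act a (W ^ k) f).1 p := by
  rw [jet, eval_finsetSum]
  refine Finset.sum_congr rfl fun k _ => ?_
  rw [eval_monomial, jetCoeff]; ring

theorem eqO_of_coeff {N : ℕ} {P Q : ℂ[X]} (h : ∀ k < N + 1, P.coeff k = Q.coeff k) :
    EqO N (fun ζ => P.eval ζ) (fun ζ => Q.eval ζ) := by
  obtain ⟨R, hR⟩ := X_pow_dvd_iff.2 (fun k hk => by rw [coeff_sub, h k hk, sub_self] :
    ∀ k < N + 1, (P - Q).coeff k = 0)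
  unfold EqO
  have h1 : (fun ζ : ℂ => ζ ^ (N + 1)) =O[𝓝 0] fun ζ => ‖ζ‖ ^ (N + 1) :=
    (isBigO_refl (fun ζ : ℂ => ζ ^ (N + 1)) (𝓝 0)).norm_right.congr_right fun ζ => by simp
  have h2 := h1.mul (continuous_isBigO_one R.continuous)
  simp only [mul_one] at h2
  refine h2.congr_left fun ζ => ?_
  rw [← eval_sub, hR]; simp

theorem eval_isBigO_one (P : ℂ[X]) : (fun ζ => P.eval ζ) =O[𝓝 0] fun _ => (1 : ℝ) :=
  continuous_isBigO_one P.continuous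

theorem iterate_leibniz (d : Derivation ℂ (smoothAlg n) (smoothAlg n)) (f g : smoothAlg n)
    (k : ℕ) : d^[k] (f * g) = ∑ x ∈ Finset.HasAntidiagonal.antidiagonal k,
      (k.choose x.1 : smoothAlg n) * (d^[x.1] f * d^[x.2] g) := by
  induction k with
  | zero => simp
  | succ k ih =>
    rw [Finset.sum_antidiagonal_choose_succ_mul (fun i j => d^[i] f * d^[j] g),
      Function.iterate_succ_apply', ih, map_sum, ← Finset.sum_add_distrib]
    refine Finset.sum_congr rfl fun x hx => ?_
    have hx' : x.1 + x.2 = k := Finset.HasAntidiagonal.mem_antidiagonal.1 hx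
    rw [← Nat.choose_symm_of_eq_add hx'.symm, Derivation.leibniz, Derivation.leibniz,
      Derivation.map_natCast, Function.iterate_succ_apply', Function.iterate_succ_apply']
    simp only [smul_eq_mul]; ring

variable {W}

theorem act_pow (hW : IsLie W) : ∃ d : Derivation ℂ (smoothAlg n) (smoothAlg n),
    ∀ k f, act a (W ^ k) f = d^[k] f := by
  obtain ⟨d, hd⟩ := hW.exists_derivation a
  refine ⟨d, fun k => ?_⟩
  induction k with
  | zero => intro f; simp
  | succ k ih =>
    intro f
    rw [pow_succ', map_mul, Module.End.mul_apply, hd, ih, Function.iterate_succ_apply']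

theorem jetCoeff_mul (hW : IsLie W) (k : ℕ) (f g : smoothAlg n) :
    jetCoeff a p W k (f * g) = ∑ x ∈ Finset.HasAntidiagonal.antidiagonal k,
      jetCoeff a p W x.1 f * jetCoeff a p W x.2 g := by
  obtain ⟨d, hd⟩ := act_pow a hW
  simp only [jetCoeff, hd]
  rw [iterate_leibniz]
  have e : ∀ (s : Finset (ℕ × ℕ)) (h : ℕ × ℕ → smoothAlg n),
      (∑ x ∈ s, h x).1 p = ∑ x ∈ s, (h x).1 p := by
    intro s h
    rw [AddSubmonoidClass.coe_finsetSum, Finset.sum_apply]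
  rw [e, Finset.sum_div]
  refine Finset.sum_congr rfl fun x hx => ?_
  have hx' : x.1 + x.2 = k := Finset.HasAntidiagonal.mem_antidiagonal.1 hx
  have h1 : ((k.choose x.1 : smoothAlg n) * (d^[x.1] f * d^[x.2] g)).1 p =
      (k.choose x.1 : ℂ) * ((d^[x.1] f).1 p * (d^[x.2] g).1 p) := by
    rw [← nsmul_eq_mul, ← nsmul_eq_mul]; rfl
  have h2 : (k.choose x.1 : ℂ) * x.1.factorial * x.2.factorial = k.factorial := by
    have := Nat.choose_mul_factorial_mul_factorial (by omega : x.1 ≤ k)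
    rw [show k - x.1 = x.2 by omega] at this
    exact_mod_cast this
  have h3 : (k.choose x.1 : ℂ) ≠ 0 := by
    exact_mod_cast (Nat.choose_pos (by omega : x.1 ≤ k)).ne'
  rw [h1, ← h2]
  have h4 : (x.1.factorial : ℂ) ≠ 0 := by exact_mod_cast Nat.factorial_ne_zero _
  have h5 : (x.2.factorial : ℂ) ≠ 0 := by exact_mod_cast Nat.factorial_ne_zero _
  field_simp

theorem jet_mul (hW : IsLie W) (N : ℕ) (f g : smoothAlg n) :
    EqO N (fun ζ => (jet a p W N (f * g)).eval ζ)
      (fun ζ => (jet a p W N f).eval ζ * (jet a p W N g).eval ζ) := by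
  simp only [← eval_mul]
  refine eqO_of_coeff fun k hk => ?_
  rw [jet_coeff _ _ _ _ _ hk, jetCoeff_mul a p hW, coeff_mul]
  refine Finset.sum_congr rfl fun x hx => ?_
  have hx' : x.1 + x.2 = k := Finset.HasAntidiagonal.mem_antidiagonal.1 hx
  rw [jet_coeff _ _ _ _ _ (by omega), jet_coeff _ _ _ _ _ (by omega)]

theorem jet_add (N : ℕ) (f g : smoothAlg n) :
    jet a p W N (f + g) = jet a p W N f + jet a p W N g := by
  rw [jet, jet, jet, ← Finset.sum_add_distrib]
  refine Finset.sum_congr rfl fun k _ => ?_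
  rw [← map_add (monomial k), jetCoeff, jetCoeff, jetCoeff, ← add_div, map_add (act a (W ^ k))]
  rfl

theorem jet_sum {ι : Type*} (s : Finset ι) (N : ℕ) (f : ι → smoothAlg n) :
    jet a p W N (∑ i ∈ s, f i) = ∑ i ∈ s, jet a p W N (f i) := by
  classical
  induction s using Finset.induction_on with
  | empty =>
    have : jet a p W N 0 = 0 := by
      have := jet_add a p (W := W) N 0 0
      rw [add_zero] at this
      exact left_eq_add.1 this
    simpa using this
  | insert i s hi ih => rw [Finset.sum_insert hi, Finset.sum_insert hi, jet_add, ih]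

theorem jet_const (hW : IsLie W) (N : ℕ) (c : ℂ) :
    jet a p W N (algebraMap ℂ (smoothAlg n) c) = C c := by
  obtain ⟨d, hd⟩ := act_pow a hW
  rw [jet, Finset.sum_range_succ', Finset.sum_eq_zero, zero_add, jetCoeff, hd]
  · simp only [Function.iterate_zero, id, Nat.factorial_zero, Nat.cast_one, div_one]; rfl
  · intro k _
    have : d^[k + 1] (algebraMap ℂ (smoothAlg n) c) = 0 := by
      rw [Function.iterate_succ_apply, Derivation.map_algebraMap, iterate_map_zero]
    rw [jetCoeff, hd, this]
    simp

/-- The polynomial curve generated by a Lie polynomial. -/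
def curve (W : Wd) (N : ℕ) (ζ : ℂ) : Fin n → ℂ := fun j => (jet a p W N (cz j)).eval ζ

theorem curve_continuous (N : ℕ) : Continuous (curve a p W N) :=
  continuous_pi fun j => (jet a p W N (cz j)).continuous

theorem curve_zero (N : ℕ) : curve a p W N 0 = p := by
  ext j
  rw [curve, jet_eval, Finset.sum_range_succ', Finset.sum_eq_zero]
  · simp [cz]
  · intro k _; simp

theorem curve_sub (N : ℕ) : (fun ζ => curve a p W N ζ - p) =O[𝓝 0] fun ζ : ℂ => ‖ζ‖ := by
  rw [isBigO_pi]
  intro j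
  have : EqO 0 (fun ζ => (jet a p W N (cz j)).eval ζ) (fun ζ => (C (p j)).eval ζ) := by
    refine eqO_of_coeff fun k hk => ?_
    obtain rfl : k = 0 := by omega
    rw [jet_coeff _ _ _ _ _ (by omega)]
    simp [jetCoeff, cz]
  simpa [EqO, curve] using this

theorem jet_hol (hW : IsLie W) (N : ℕ) (g : MvPolynomial (Fin n) ℂ) :
    EqO N (fun ζ => (jet a p W N (hol g)).eval ζ) (fun ζ => (hol g).1 (curve a p W N ζ)) := by
  induction g using MvPolynomial.induction_on with
  | C c =>
    rw [hol, MvPolynomial.algHom_C, jet_const a p hW]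
    simp only [eval_C]
    exact EqO.refl _ _
  | add f g hf hg =>
    have : hol (f + g) = hol f + hol g := map_add _ f g
    rw [this, jet_add]
    simp only [eval_add]
    exact hf.add hg
  | mul_X f j hf =>
    have : hol (f * MvPolynomial.X j) = hol f * cz j := by simp [hol]
    rw [this]
    refine (jet_mul a p hW N _ _).trans ?_
    exact EqO.mul (eval_isBigO_one _) (eval_isBigO_one _) hf (EqO.refl _ _)

/-- The holomorphic derivative with index `o`, where `none` stands for the identity. -/
def dO : Option (Fin n) → smoothAlg n →ₗ[ℂ] smoothAlg n
  | none => LinearMap.id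
  | some j => (pz j : smoothAlg n →ₗ[ℂ] smoothAlg n)

/-- The antiholomorphic derivative with index `o`, where `none` stands for the identity. -/
def dbO : Option (Fin n) → smoothAlg n →ₗ[ℂ] smoothAlg n
  | none => LinearMap.id
  | some j => (pzb j : smoothAlg n →ₗ[ℂ] smoothAlg n)

theorem dO_hol (o : Option (Fin n)) (g : MvPolynomial (Fin n) ℂ) : ∃ g', dO o (hol g) = hol g' := by
  cases o with
  | none => exact ⟨g, rfl⟩
  | some j => exact ⟨_, pz_hol j g⟩

theorem dO_dbO_hol_mul (o o' : Option (Fin n)) (g h : MvPolynomial (Fin n) ℂ) :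
    dO o (dbO o' (hol g * cj (hol h))) = dO o (hol g) * cj (dO o' (hol h)) := by
  have h1 : dbO o' (hol g * cj (hol h)) = hol g * cj (dO o' (hol h)) := by
    cases o' with
    | none => rfl
    | some j =>
      change pzb j _ = hol g * cj (pz j (hol h))
      rw [Derivation.leibniz, pzb_hol, smul_zero, add_zero, pzb_cj, smul_eq_mul]
  rw [h1]
  obtain ⟨h', hh'⟩ := dO_hol o' h
  rw [hh']
  cases o with
  | none => rfl
  | some j =>
    change pz j _ = pz j (hol g) * _
    rw [Derivation.leibniz, pz_cj, pzb_hol, cj_zero, smul_zero, zero_add, smul_eq_mul, mul_comm]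

theorem Flat.dO {p : Fin n → ℂ} {K : ℕ} {f : smoothAlg n} (o : Option (Fin n))
    (hf : Flat p (K + 1) f) : Flat p K (dO o f) := by
  cases o with
  | none => exact hf.of_succ
  | some j => exact hf.2 (Sum.inl j)

theorem Flat.dbO {p : Fin n → ℂ} {K : ℕ} {f : smoothAlg n} (o : Option (Fin n))
    (hf : Flat p (K + 1) f) : Flat p K (dbO o f) := by
  cases o with
  | none => exact hf.of_succ
  | some j => exact hf.2 (Sum.inr j)

/-- `u` acts on holomorphic functions as the first order operator with coefficients `c`. -/
def FirstOrder (u : Wd) (c : Option (Fin n) → smoothAlg n) : Prop :=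
  ∀ g, act a u (hol g) = ∑ o, c o * dO o (hol g)

theorem firstOrder_one : FirstOrder a 1 (fun o => o.elim 1 fun _ => 0) := by
  intro g
  rw [Fintype.sum_option]
  simp [dO]

theorem IsLie.firstOrder {V : Wd} (hV : IsLie V) :
    FirstOrder a V (fun o => o.elim 0 fun j => act a V (cz j)) := by
  intro g
  obtain ⟨d, hd⟩ := hV.exists_derivation a
  rw [Fintype.sum_option, hd, derivation_hol]
  simp [dO, hd]

theorem act_pow_mul (u : Wd) (k : ℕ) (f : smoothAlg n) :
    act a (W ^ k * u) f = act a (W ^ k) (act a u f) := by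
  rw [map_mul]; rfl

theorem jet_firstOrder (hW : IsLie W) {u : Wd} {c : Option (Fin n) → smoothAlg n}
    (hu : FirstOrder a u c) (N : ℕ) (g : MvPolynomial (Fin n) ℂ) :
    EqO N (fun ζ => (jet a p W N (act a u (hol g))).eval ζ)
      (fun ζ => ∑ o, (jet a p W N (c o)).eval ζ * (dO o (hol g)).1 (curve a p W N ζ)) := by
  rw [hu g, jet_sum]
  simp only [eval_finsetSum]
  refine EqO.sum _ fun o _ => (jet_mul a p hW N _ _).trans ?_
  obtain ⟨g', hg'⟩ := dO_hol o g
  rw [hg']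
  exact EqO.mul (eval_isBigO_one _)
    (continuous_isBigO_one ((smC (hol g')).continuous.comp (curve_continuous a p N)))
    (EqO.refl _ _) (jet_hol a p hW N g')

theorem sum_apply_smoothAlg {ι : Type*} (s : Finset ι) (f : ι → smoothAlg n) (z : Fin n → ℂ) :
    (∑ i ∈ s, f i).1 z = ∑ i ∈ s, (f i).1 z := by
  rw [AddSubmonoidClass.coe_finsetSum, Finset.sum_apply]

/-- Expansion of first and second derivatives along the curve generated by a Lie polynomial. -/
theorem bra_expansion (hW : IsLie W) {u v : Wd} {c c' : Option (Fin n) → smoothAlg n}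
    (hu : FirstOrder a u c) (hv : FirstOrder a v c') (N : ℕ) (φ : smoothAlg n) :
    EqO N (fun ζ => ∑ o, ∑ o', (jet a p W N (c o)).eval ζ *
        (starRingEnd ℂ) ((jet a p W N (c' o')).eval ζ) *
        (dO o (dbO o' φ)).1 (curve a p W N ζ))
      (fun ζ => ∑ i ∈ Finset.range (N + 1), ∑ j ∈ Finset.range (N + 1),
        ζ ^ i * (starRingEnd ℂ) ζ ^ j / (i.factorial * j.factorial) *
          (bra a φ (W ^ i * u) (W ^ j * v)).1 p) := by
  choose K hK using fun x : ℕ × ℕ => bra_flat_eq_zero a (W ^ x.1 * u) (W ^ x.2 * v)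
  let K' := (Finset.range (N + 1) ×ˢ Finset.range (N + 1)).sup K
  refine smooth_induction (P := fun φ => EqO N (fun ζ => ∑ o, ∑ o', (jet a p W N (c o)).eval ζ *
        (starRingEnd ℂ) ((jet a p W N (c' o')).eval ζ) *
        (dO o (dbO o' φ)).1 (curve a p W N ζ))
      (fun ζ => ∑ i ∈ Finset.range (N + 1), ∑ j ∈ Finset.range (N + 1),
        ζ ^ i * (starRingEnd ℂ) ζ ^ j / (i.factorial * j.factorial) *
          (bra a φ (W ^ i * u) (W ^ j * v)).1 p))
    p (max (N + 1 + 1 + 1) K') ?_ ?_ ?_ φ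
  · intro f g hf hg
    refine ((hf.add hg).congr_left fun ζ => ?_)
    simp only [map_add, bra_add_fun]
    have e : ∀ (f g : smoothAlg n) z, (f + g).1 z = f.1 z + g.1 z := fun _ _ _ => rfl
    simp only [e, mul_add, Finset.sum_add_distrib]
  · intro f hf
    have h0 : ∀ ζ : ℂ, ∑ i ∈ Finset.range (N + 1), ∑ j ∈ Finset.range (N + 1),
        ζ ^ i * (starRingEnd ℂ) ζ ^ j / (i.factorial * j.factorial) *
          (bra a f (W ^ i * u) (W ^ j * v)).1 p = 0 := by
      intro ζ
      refine Finset.sum_eq_zero fun i hi => Finset.sum_eq_zero fun j hj => ?_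
      rw [hK (i, j) p f (hf.mono (le_trans (Finset.le_sup
        (f := K) (Finset.mem_product.2 ⟨hi, hj⟩)) (le_max_right _ _))), mul_zero]
    simp only [h0]
    have h1 : ∀ o o', (fun ζ => (dO o (dbO o' f)).1 (curve a p W N ζ)) =O[𝓝 0]
        fun ζ : ℂ => ‖ζ‖ ^ (N + 1) := by
      intro o o'
      have hfl : Flat p (N + 1) (dO o (dbO o' f)) :=
        Flat.dO o (Flat.dbO o' (hf.mono (le_max_left _ _)))
      obtain ⟨C, hC0, hC⟩ := hfl.bound
      refine IsBigO.trans (IsBigO.of_bound (g := fun ζ => ‖curve a p W N ζ - p‖ ^ (N + 1)) C ?_)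
        ((curve_sub a p (W := W) N).norm_left.pow (N + 1))
      have := (curve_continuous a p (W := W) N).continuousAt (x := 0)
      have hb : Metric.closedBall p 1 ∈ 𝓝 (curve a p W N 0) := by
        rw [curve_zero]; exact Metric.closedBall_mem_nhds p one_pos
      filter_upwards [this hb] with ζ hζ
      rw [norm_pow, norm_norm]
      exact hC _ hζ
    have h2 : (fun ζ => ∑ o, ∑ o', (jet a p W N (c o)).eval ζ *
        (starRingEnd ℂ) ((jet a p W N (c' o')).eval ζ) *
        (dO o (dbO o' f)).1 (curve a p W N ζ)) =O[𝓝 0] fun ζ : ℂ => ‖ζ‖ ^ (N + 1) := by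
      refine IsBigO.fun_sum fun o _ => IsBigO.fun_sum fun o' _ => ?_
      have := (continuous_isBigO_one (((jet a p W N (c o)).continuous).mul
        (continuous_conj.comp (jet a p W N (c' o')).continuous))).mul (h1 o o')
      simp only [one_mul] at this
      exact this
    unfold EqO
    simpa only [sub_zero] using h2
  · intro g h
    simp only [dO_dbO_hol_mul, bra_hol_mul]
    have h1 := jet_firstOrder a p hW hu N g
    have h2 := (jet_firstOrder a p hW hv N h).conj
    have hb1 := eval_isBigO_one (jet a p W N (act a u (hol g)))
    have hb2 : (fun ζ => (starRingEnd ℂ) (∑ o, (jet a p W N (c' o)).eval ζ *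
        (dO o (hol h)).1 (curve a p W N ζ))) =O[𝓝 0] fun _ => (1 : ℝ) := by
      refine continuous_isBigO_one (continuous_conj.comp ?_)
      exact continuous_finsetSum _ fun o _ => (jet a p W N (c' o)).continuous.mul
        ((smC (dO o (hol h))).continuous.comp (curve_continuous a p N))
    have h3 := (EqO.mul hb1 hb2 h1 h2).symm
    refine h3.congr_left fun ζ => ?_
    congr 1
    · beta_reduce
      rw [map_sum, Finset.sum_mul_sum]
      refine Finset.sum_congr rfl fun o _ => Finset.sum_congr rfl fun o' _ => ?_
      rw [map_mul]
      change _ = _ * ((dO o (hol g)).1 _ * (cj (dO o' (hol h))).1 _)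
      rw [cj_apply]; ring
    · beta_reduce
      rw [jet_eval, jet_eval, map_sum, Finset.sum_mul_sum]
      refine Finset.sum_congr rfl fun i _ => Finset.sum_congr rfl fun j _ => ?_
      rw [act_pow_mul, act_pow_mul, act_cj, act_cj]
      change _ = _ * ((act a (W ^ i) (act a u (hol g))).1 p *
        (cj (act a (W ^ j) (act a v (hol h)))).1 p)
      rw [cj_apply, map_mul (starRingEnd ℂ), map_div₀, map_pow (starRingEnd ℂ), map_natCast]; ring

theorem bra_firstOrder {u v : Wd} {c c' : Option (Fin n) → smoothAlg n}
    (hu : FirstOrder a u c) (hv : FirstOrder a v c') (φ : smoothAlg n) :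
    (bra a φ u v).1 p = ∑ o, ∑ o', (c o).1 p * (starRingEnd ℂ) ((c' o').1 p) *
      (dO o (dbO o' φ)).1 p := by
  have h := (bra_expansion a p (IsLie.gen true) hu hv 0 φ).apply_zero
  simp only [curve_zero, jet_eval] at h
  simp [-Fintype.sum_option] at h
  exact h.symm

end

section

variable {n : ℕ}

open Asymptotics Polynomial

theorem levi_eq {ρ : (Fin n → ℂ) → ℝ} {r : smoothAlg n} (hr : ∀ z, r.1 z = (ρ z : ℂ))
    (X Y z : Fin n → ℂ) :
    levi ρ X Y z = ∑ j, ∑ k, (pz j (pzb k r)).1 z * X j * (starRingEnd ℂ) (Y k) := by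
  have h : cplx ρ = r.1 := funext fun z => (hr z).symm
  unfold levi
  rw [h]
  refine Finset.sum_congr rfl fun j _ => Finset.sum_congr rfl fun k _ => ?_
  rw [pz_apply]
  congr 3
  exact funext fun w => (pzb_apply k r w).symm

theorem dirDeriv_eq {ρ : (Fin n → ℂ) → ℝ} {r : smoothAlg n} (hr : ∀ z, r.1 z = (ρ z : ℂ))
    (X z : Fin n → ℂ) : dirDeriv X (cplx ρ) z = ∑ j, X j * (pz j r).1 z := by
  have h : cplx ρ = r.1 := funext fun z => (hr z).symm
  unfold dirDeriv
  rw [h]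
  exact Finset.sum_congr rfl fun j _ => by rw [pz_apply]

theorem cj_of_real {ρ : (Fin n → ℂ) → ℝ} {r : smoothAlg n} (hr : ∀ z, r.1 z = (ρ z : ℂ)) :
    cj r = r := by
  ext z
  change (starRingEnd ℂ) (r.1 z) = r.1 z
  rw [hr, Complex.conj_ofReal]

theorem levi_conj {ρ : (Fin n → ℂ) → ℝ} {r : smoothAlg n} (hr : ∀ z, r.1 z = (ρ z : ℂ))
    (X Y z : Fin n → ℂ) : (starRingEnd ℂ) (levi ρ X Y z) = levi ρ Y X z := by
  rw [levi_eq hr, levi_eq hr, map_sum, Finset.sum_comm]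
  simp only [map_sum]
  rw [Finset.sum_comm]
  rw [Finset.sum_comm]
  refine Finset.sum_congr rfl fun j _ => Finset.sum_congr rfl fun k _ => ?_
  rw [map_mul (starRingEnd ℂ), map_mul (starRingEnd ℂ), Complex.conj_conj, ← cj_apply, ← pzb_cj,
    ← pz_cj, cj_of_real hr]
  rw [show pzb j (pz k r) = pz k (pzb j r) from pw_comm (Sum.inr j) (Sum.inl k) r]
  ring

theorem levi_sum {ι κ : Type*} [Fintype ι] [Fintype κ] {ρ : (Fin n → ℂ) → ℝ}
    (c : ι → ℂ) (d : κ → ℂ) (X : ι → Fin n → ℂ) (Y : κ → Fin n → ℂ) (z : Fin n → ℂ) :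
    levi ρ (fun l => ∑ i, c i * X i l) (fun l => ∑ j, d j * Y j l) z =
      ∑ i, ∑ j, c i * (starRingEnd ℂ) (d j) * levi ρ (X i) (Y j) z := by
  unfold levi
  simp only [map_sum, Finset.mul_sum, Finset.sum_mul, map_mul (starRingEnd ℂ)]
  have h1 : ∀ f : Fin n → Fin n → κ → ι → ℂ,
      ∑ x, ∑ y, ∑ j, ∑ i, f x y j i = ∑ i, ∑ j, ∑ x, ∑ y, f x y j i := by
    intro f
    calc _ = ∑ x, ∑ y, ∑ i, ∑ j, f x y j i := by
          refine Finset.sum_congr rfl fun x _ => Finset.sum_congr rfl fun y _ => Finset.sum_comm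
      _ = ∑ x, ∑ i, ∑ y, ∑ j, f x y j i := by
          refine Finset.sum_congr rfl fun x _ => Finset.sum_comm
      _ = ∑ x, ∑ i, ∑ j, ∑ y, f x y j i := by
          refine Finset.sum_congr rfl fun x _ => Finset.sum_congr rfl fun y _ => Finset.sum_comm
      _ = ∑ i, ∑ x, ∑ j, ∑ y, f x y j i := Finset.sum_comm
      _ = _ := by
          refine Finset.sum_congr rfl fun x _ => Finset.sum_comm
  rw [h1]
  refine Finset.sum_congr rfl fun i _ => Finset.sum_congr rfl fun j _ =>
    Finset.sum_congr rfl fun x _ => Finset.sum_congr rfl fun y _ => by ring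

theorem dirDeriv_sum {ι : Type*} [Fintype ι] {f : (Fin n → ℂ) → ℂ}
    (c : ι → ℂ) (X : ι → Fin n → ℂ) (z : Fin n → ℂ) :
    dirDeriv (fun l => ∑ i, c i * X i l) f z = ∑ i, c i * dirDeriv (X i) f z := by
  unfold dirDeriv
  simp only [Finset.sum_mul, Finset.mul_sum]
  rw [Finset.sum_comm]
  refine Finset.sum_congr rfl fun i _ => Finset.sum_congr rfl fun j _ => by ring

/-- The differential hypotheses on a field `a` on the set `T` of boundary points. -/
structure StepB (T : Set (Fin n → ℂ)) (r : smoothAlg n) (ρ : (Fin n → ℂ) → ℝ)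
    (a : Fin n → smoothAlg n) : Prop where
  hr : ∀ z, r.1 z = (ρ z : ℂ)
  zero : ∀ p ∈ T, ρ p = 0
  tan : ∀ p ∈ T, ∀ f : smoothAlg n, (∀ z ∈ T, f.1 z = 0) → ∑ j, (a j).1 p * (pz j f).1 p = 0
  null : ∀ p ∈ T, ∀ X, dirDeriv X (cplx ρ) p = 0 → levi ρ (fun j => (a j).1 p) X p = 0
  lower : ∀ p ∈ T, ∃ c, ∀ᶠ z in 𝓝 p, ∀ X,
    -c * (|ρ z| * ‖X‖ ^ 2 + ‖dirDeriv X (cplx ρ) z‖ * ‖X‖) ≤ (levi ρ X X z).re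

theorem double_sum_eqO {k : ℕ} {B : ℕ → ℕ → ℂ} (hB : ∀ a b, a + b < k → B a b = 0) :
    EqO k (fun ζ => ∑ i ∈ Finset.range (k + 1), ∑ j ∈ Finset.range (k + 1),
        ζ ^ i * (starRingEnd ℂ) ζ ^ j / (i.factorial * j.factorial) * B i j)
      (fun ζ => ∑ x ∈ Finset.HasAntidiagonal.antidiagonal k,
        ζ ^ x.1 * (starRingEnd ℂ) ζ ^ x.2 / (x.1.factorial * x.2.factorial) * B x.1 x.2) := by
  have h : ∀ ζ : ℂ, ∑ x ∈ Finset.HasAntidiagonal.antidiagonal k,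
        ζ ^ x.1 * (starRingEnd ℂ) ζ ^ x.2 / (x.1.factorial * x.2.factorial) * B x.1 x.2 =
      ∑ i ∈ Finset.range (k + 1), ∑ j ∈ Finset.range (k + 1), if i + j = k then
        ζ ^ i * (starRingEnd ℂ) ζ ^ j / (i.factorial * j.factorial) * B i j else 0 := by
    intro ζ
    rw [← Finset.sum_product', ← Finset.sum_filter]
    refine Finset.sum_congr ?_ fun _ _ => rfl
    ext x
    simp only [Finset.HasAntidiagonal.mem_antidiagonal, Finset.mem_filter, Finset.mem_product,
      Finset.mem_range]
    omega
  simp only [h]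
  refine EqO.sum _ fun i _ => EqO.sum _ fun j _ => ?_
  rcases lt_trichotomy (i + j) k with h1 | h1 | h1
  · simp only [hB i j h1, mul_zero, ite_self]; exact EqO.refl _ _
  · simp only [h1, if_true]; exact EqO.refl _ _
  · simp only [h1.ne', if_false]
    unfold EqO
    simp only [sub_zero]
    refine IsBigO.of_bound (‖B i j‖ / (i.factorial * j.factorial)) ?_
    filter_upwards [Metric.closedBall_mem_nhds (0 : ℂ) one_pos] with ζ hζ
    have hζ' : ‖ζ‖ ≤ 1 := by simpa using hζ
    have h2 : ‖ζ‖ ^ (i + j) ≤ ‖ζ‖ ^ (k + 1) := pow_le_pow_of_le_one (norm_nonneg _) hζ' h1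
    simp only [norm_mul, norm_div, norm_pow, RCLike.norm_conj, Complex.norm_natCast, norm_norm]
    rw [← pow_add]
    calc _ = ‖B i j‖ / (i.factorial * j.factorial) * ‖ζ‖ ^ (i + j) := by ring
      _ ≤ _ := by gcongr

theorem eq_zero_of_odd {k : ℕ} (hk : Odd k) {A M : ℝ}
    (h : ∀ᶠ ε in 𝓝 (0 : ℝ), -M * |ε| ^ (k + 1) ≤ ε ^ k * A) : A = 0 := by
  have key : ∀ B : ℝ, (∀ᶠ ε in 𝓝 (0 : ℝ), 0 < ε → -M * ε ^ (k + 1) ≤ ε ^ k * B) → 0 ≤ B := by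
    intro B hB
    have h1 : ∀ᶠ ε in 𝓝[>] (0 : ℝ), -M * ε ≤ B := by
      filter_upwards [hB.filter_mono nhdsWithin_le_nhds, self_mem_nhdsWithin] with ε h1 h2
      have h2 : 0 < ε := h2
      have := h1 h2
      rw [pow_succ] at this
      have h3 : 0 < ε ^ k := pow_pos h2 k
      refine le_of_mul_le_mul_left (a := ε ^ k) ?_ h3
      linarith
    have h2 : Filter.Tendsto (fun ε : ℝ => -M * ε) (𝓝[>] 0) (𝓝 0) := by
      have : Filter.Tendsto (fun ε : ℝ => -M * ε) (𝓝 0) (𝓝 (-M * 0)) :=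
        (continuous_const.mul continuous_id).tendsto 0
      rw [mul_zero] at this
      exact this.mono_left nhdsWithin_le_nhds
    exact le_of_tendsto h2 h1
  refine le_antisymm ?_ (key A ?_)
  · have := key (-A) ?_
    · linarith
    have h' : Filter.Tendsto (fun ε : ℝ => -ε) (𝓝 0) (𝓝 0) := by
      have := (continuous_neg (G := ℝ)).tendsto 0
      simpa using this
    filter_upwards [h'.eventually h] with ε h1 h2
    rw [abs_neg, abs_of_pos h2, hk.neg_pow] at h1
    linarith
  · filter_upwards [h] with ε h1 h2
    rwa [abs_of_pos h2] at h1

end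

section

variable {n : ℕ}

open Asymptotics Polynomial

namespace StepB

variable {T : Set (Fin n → ℂ)} {r : smoothAlg n} {ρ : (Fin n → ℂ) → ℝ} {a : Fin n → smoothAlg n}

theorem fieldL_vanish (H : StepB T r ρ a) {f : smoothAlg n} (hf : ∀ z ∈ T, f.1 z = 0) :
    ∀ z ∈ T, (fieldL a f).1 z = 0 := by
  intro z hz
  rw [fieldL_apply, sum_apply_smoothAlg]
  exact H.tan z hz f hf

theorem fieldLb_vanish (H : StepB T r ρ a) {f : smoothAlg n} (hf : ∀ z ∈ T, f.1 z = 0) :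
    ∀ z ∈ T, (fieldLb a f).1 z = 0 := by
  intro z hz
  rw [← cj_cj f, fieldLb_cj, cj_apply, H.fieldL_vanish _ z hz, map_zero]
  intro y hy
  rw [cj_apply, hf y hy, map_zero]

theorem dv_vanish (H : StepB T r ρ a) (b : Bool) {f : smoothAlg n} (hf : ∀ z ∈ T, f.1 z = 0) :
    ∀ z ∈ T, (dv a b f).1 z = 0 := by
  intro z hz
  have h1 := H.fieldL_vanish hf z hz
  have h2 := H.fieldLb_vanish hf z hz
  cases b
  · change I * ((fieldL a f).1 z - (fieldLb a f).1 z) = 0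
    rw [h1, h2]; simp
  · change (fieldL a f).1 z + (fieldLb a f).1 z = 0
    rw [h1, h2]; simp

theorem act_vanish (H : StepB T r ρ a) (u : Wd) {f : smoothAlg n} (hf : ∀ z ∈ T, f.1 z = 0) :
    ∀ z ∈ T, (act a u f).1 z = 0 := by
  induction u using word_induction with
  | one => simpa using hf
  | add u v hu hv =>
    intro z hz
    rw [act_add]
    change (act a u f).1 z + (act a v f).1 z = 0
    rw [hu z hz, hv z hz, add_zero]
  | smul c u hu =>
    intro z hz
    rw [act_smul]
    change c • (act a u f).1 z = 0
    rw [hu z hz, smul_zero]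
  | gen b u hu =>
    rw [act_lt_mul]
    exact H.dv_vanish b hu

/-- The vector with components `V z_j` at points of the curve generated by `W`. -/
def vec (a : Fin n → smoothAlg n) (p : Fin n → ℂ) (W V : Wd) (N : ℕ) (ζ : ℂ) : Fin n → ℂ :=
  fun j => (jet a p W N (act a V (cz j))).eval ζ

theorem vec_continuous (a : Fin n → smoothAlg n) (p : Fin n → ℂ) (W V : Wd) (N : ℕ) :
    Continuous (vec a p W V N) :=
  continuous_pi fun j => (jet a p W N (act a V (cz j))).continuous

theorem jet_zero_eval (p : Fin n → ℂ) (W : Wd) (N : ℕ) (ζ : ℂ) :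
    (jet a p W N 0).eval ζ = 0 := by
  rw [jet_eval]
  refine Finset.sum_eq_zero fun k _ => ?_
  rw [map_zero (act a (W ^ k))]
  exact mul_zero _

theorem levi_expansion (hr : ∀ z, r.1 z = (ρ z : ℂ)) (p : Fin n → ℂ) {W V V' : Wd} (hW : IsLie W)
    (hV : IsLie V) (hV' : IsLie V') (N : ℕ) :
    EqO N (fun ζ => levi ρ (vec a p W V N ζ) (vec a p W V' N ζ) (curve a p W N ζ))
      (fun ζ => ∑ i ∈ Finset.range (N + 1), ∑ j ∈ Finset.range (N + 1),
        ζ ^ i * (starRingEnd ℂ) ζ ^ j / (i.factorial * j.factorial) *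
          (bra a r (W ^ i * V) (W ^ j * V')).1 p) := by
  have h := bra_expansion a p hW (hV.firstOrder a) (hV'.firstOrder a) N r
  convert h using 2 with ζ
  rw [levi_eq hr, Fintype.sum_option, Fintype.sum_option]
  simp only [Option.elim, jet_zero_eval, zero_mul, Finset.sum_const_zero, zero_add]
  refine Finset.sum_congr rfl fun j _ => ?_
  rw [Fintype.sum_option]
  simp only [jet_zero_eval, zero_mul, mul_zero, map_zero, zero_add]
  refine Finset.sum_congr rfl fun k _ => ?_
  simp only [vec, dO, dbO, Derivation.coeFn_coe]
  ring

theorem dirDeriv_expansion (hr : ∀ z, r.1 z = (ρ z : ℂ)) (p : Fin n → ℂ) {W V : Wd} (hW : IsLie W)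
    (hV : IsLie V) (N : ℕ) :
    EqO N (fun ζ => dirDeriv (vec a p W V N ζ) (cplx ρ) (curve a p W N ζ))
      (fun ζ => ∑ i ∈ Finset.range (N + 1), ∑ j ∈ Finset.range (N + 1),
        ζ ^ i * (starRingEnd ℂ) ζ ^ j / (i.factorial * j.factorial) *
          (bra a r (W ^ i * V) (W ^ j)).1 p) := by
  have h := bra_expansion a p hW (hV.firstOrder a) (firstOrder_one a) N r
  simp only [mul_one] at h
  convert h using 2 with ζ
  rw [dirDeriv_eq hr, Fintype.sum_option, Fintype.sum_option]
  have h1 : (jet a p W N 1).eval ζ = 1 := by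
    have := jet_const a p hW N 1
    rw [map_one, map_one] at this
    rw [this, eval_one]
  simp only [Option.elim, jet_zero_eval, zero_mul, Finset.sum_const_zero, zero_add]
  refine Finset.sum_congr rfl fun j _ => ?_
  rw [Fintype.sum_option]
  simp only [jet_zero_eval, zero_mul, mul_zero, map_zero, h1, map_one,
    Finset.sum_const_zero, add_zero, mul_one]
  rfl

theorem value_expansion (hr : ∀ z, r.1 z = (ρ z : ℂ)) (p : Fin n → ℂ) {W : Wd} (hW : IsLie W)
    (N : ℕ) :
    EqO N (fun ζ => (ρ (curve a p W N ζ) : ℂ))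
      (fun ζ => ∑ i ∈ Finset.range (N + 1), ∑ j ∈ Finset.range (N + 1),
        ζ ^ i * (starRingEnd ℂ) ζ ^ j / (i.factorial * j.factorial) *
          (bra a r (W ^ i) (W ^ j)).1 p) := by
  have h := bra_expansion a p hW (firstOrder_one a) (firstOrder_one a) N r
  simp only [mul_one] at h
  convert h using 2 with ζ
  have h1 : (jet a p W N 1).eval ζ = 1 := by
    have := jet_const a p hW N 1
    rw [map_one, map_one] at this
    rw [this, eval_one]
  rw [Fintype.sum_option, Fintype.sum_option]
  simp only [Option.elim, jet_zero_eval, zero_mul, mul_zero, map_zero, h1, map_one,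
    Finset.sum_const_zero, add_zero, mul_one, one_mul, ← hr]
  rfl

theorem eqO_zero {k : ℕ} {B : ℕ → ℕ → ℂ} (hB : ∀ a b, a + b ≤ k → B a b = 0) {F : ℂ → ℂ}
    (h : EqO k F (fun ζ => ∑ i ∈ Finset.range (k + 1), ∑ j ∈ Finset.range (k + 1),
        ζ ^ i * (starRingEnd ℂ) ζ ^ j / (i.factorial * j.factorial) * B i j)) :
    F =O[𝓝 0] fun ζ => ‖ζ‖ ^ (k + 1) := by
  have h1 := h.trans (double_sum_eqO fun a b hab => hB a b hab.le)
  unfold EqO at h1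
  refine h1.congr_left fun ζ => ?_
  beta_reduce
  rw [Finset.sum_eq_zero, sub_zero]
  intro x hx
  rw [hB _ _ (Finset.HasAntidiagonal.mem_antidiagonal.1 hx).le, mul_zero]

theorem pos (H : StepB T r ρ a) {p : Fin n → ℂ} (hp : p ∈ T) {W : Wd} {V : Fin 2 → Wd}
    (c : Fin 2 → ℂ) {k : ℕ} (hW : IsLie W) (hV : ∀ i, IsLie (V i)) (hk : Odd k)
    (h1 : ∀ α β, α + β < k → ∀ i j, (bra a r (W ^ α * V i) (W ^ β * V j)).1 p = 0)
    (h2 : ∀ α β, α + β ≤ k → (bra a r (W ^ α) (W ^ β)).1 p = 0)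
    (h3 : ∀ α β, α + β ≤ k → ∀ i, (bra a r (W ^ α * V i) (W ^ β)).1 p = 0) :
    ∑ x ∈ Finset.HasAntidiagonal.antidiagonal k,
      I ^ x.1 * (-I) ^ x.2 / (x.1.factorial * x.2.factorial) *
      ∑ i, ∑ j, c i * (starRingEnd ℂ) (c j) * (bra a r (W ^ x.1 * V i) (W ^ x.2 * V j)).1 p
        = 0 := by
  set A : ℂ := ∑ x ∈ Finset.HasAntidiagonal.antidiagonal k,
      I ^ x.1 * (-I) ^ x.2 / (x.1.factorial * x.2.factorial) *
      ∑ i, ∑ j, c i * (starRingEnd ℂ) (c j) * (bra a r (W ^ x.1 * V i) (W ^ x.2 * V j)).1 p with hA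
  set C : ℂ → Fin n → ℂ := fun ζ l => ∑ i, c i * vec a p W (V i) k ζ l with hC
  have hCc : Continuous C := continuous_pi fun l =>
    continuous_finsetSum _ fun i _ => continuous_const.mul
      ((continuous_apply l).comp (vec_continuous a p W (V i) k))
  -- the value, the first derivative and the Levi form along the curve
  have hv : (fun ζ => (ρ (curve a p W k ζ) : ℂ)) =O[𝓝 0] fun ζ => ‖ζ‖ ^ (k + 1) :=
    eqO_zero h2 (value_expansion H.hr p hW k)
  have hd : (fun ζ => dirDeriv (C ζ) (cplx ρ) (curve a p W k ζ)) =O[𝓝 0]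
      fun ζ => ‖ζ‖ ^ (k + 1) := by
    simp only [hC, dirDeriv_sum]
    refine IsBigO.fun_sum fun i _ => ?_
    exact (eqO_zero (fun a b hab => h3 a b hab i)
      (dirDeriv_expansion H.hr p hW (hV i) k)).const_mul_left _
  have hl : EqO k (fun ζ => levi ρ (C ζ) (C ζ) (curve a p W k ζ))
      (fun ζ => ∑ i, ∑ j, c i * (starRingEnd ℂ) (c j) *
        ∑ x ∈ Finset.HasAntidiagonal.antidiagonal k,
          ζ ^ x.1 * (starRingEnd ℂ) ζ ^ x.2 / (x.1.factorial * x.2.factorial) *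
            (bra a r (W ^ x.1 * V i) (W ^ x.2 * V j)).1 p) := by
    simp only [hC, levi_sum]
    refine EqO.sum _ fun i _ => EqO.sum _ fun j _ => ?_
    have := (levi_expansion H.hr p hW (hV i) (hV j) k).trans
      (double_sum_eqO fun a b hab => h1 a b hab i j)
    unfold EqO at this ⊢
    exact (this.const_mul_left (c i * (starRingEnd ℂ) (c j))).congr_left fun ζ => by ring
  have hIε : Filter.Tendsto (fun ε : ℝ => (ε : ℂ) * I) (𝓝 0) (𝓝 0) := by
    have : Continuous fun ε : ℝ => (ε : ℂ) * I := by fun_prop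
    simpa using this.tendsto 0
  have hn : ∀ ε : ℝ, ‖(ε : ℂ) * I‖ = |ε| := fun ε => by simp
  have hl' : (fun ε : ℝ => levi ρ (C (ε * I)) (C (ε * I)) (curve a p W k (ε * I)) - ε ^ k * A)
      =O[𝓝 0] fun ε : ℝ => |ε| ^ (k + 1) := by
    unfold EqO at hl
    have := hl.comp_tendsto hIε
    simp only [Function.comp_def, hn] at this
    refine this.congr_left fun ε => ?_
    congr 1
    rw [hA, Finset.mul_sum]
    simp only [Finset.mul_sum]
    rw [Finset.sum_congr rfl fun i _ => Finset.sum_comm, Finset.sum_comm]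
    refine Finset.sum_congr rfl fun x hx => Finset.sum_congr rfl fun i _ =>
      Finset.sum_congr rfl fun j _ => ?_
    rw [← Finset.HasAntidiagonal.mem_antidiagonal.1 hx, map_mul (starRingEnd ℂ), Complex.conj_I,
      Complex.conj_ofReal, mul_pow, mul_pow, pow_add]
    ring
  obtain ⟨M₁, hM₁⟩ := hl'.bound
  have hreal : ∀ X z, (levi ρ X X z).im = 0 := fun X z =>
    Complex.conj_eq_iff_im.1 (levi_conj H.hr X X z)
  apply Complex.ext
  · -- real part
    obtain ⟨c₀, hc₀⟩ := H.lower p hp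
    have hct : Filter.Tendsto (fun ε : ℝ => curve a p W k (ε * I)) (𝓝 0) (𝓝 p) := by
      have h := (curve_continuous a p (W := W) k).tendsto 0
      rw [curve_zero] at h
      exact h.comp hIε
    have hv' := hv.comp_tendsto hIε
    have hd' := hd.comp_tendsto hIε
    have hCb : (fun ε : ℝ => ‖C (ε * I)‖) =O[𝓝 0] fun _ => (1 : ℝ) := by
      have : Filter.Tendsto (fun ε : ℝ => C (ε * I)) (𝓝 0) (𝓝 (C 0)) := (hCc.tendsto 0).comp hIε
      exact (this.isBigO_one ℝ).norm_left
    have hT : (fun ε : ℝ => -c₀ * (|ρ (curve a p W k (ε * I))| * ‖C (ε * I)‖ ^ 2 +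
        ‖dirDeriv (C (ε * I)) (cplx ρ) (curve a p W k (ε * I))‖ * ‖C (ε * I)‖))
        =O[𝓝 0] fun ε : ℝ => |ε| ^ (k + 1) := by
      refine IsBigO.const_mul_left (IsBigO.add ?_ ?_) _
      · have h := (hv'.norm_left).mul (hCb.pow 2)
        simp only [Function.comp_def, hn, one_pow, mul_one, Complex.norm_real,
          Real.norm_eq_abs] at h
        exact h
      · have h := (hd'.norm_left).mul hCb
        simp only [Function.comp_def, hn, mul_one] at h
        exact h
    obtain ⟨M₂, hM₂⟩ := hT.bound
    refine eq_zero_of_odd hk (M := M₁ + M₂) ?_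
    filter_upwards [hM₁, hM₂, hct.eventually hc₀] with ε e1 e2 e3
    have e3 := e3 (C (ε * I))
    rw [Real.norm_of_nonneg (by positivity : (0 : ℝ) ≤ |ε| ^ (k + 1))] at e1 e2
    rw [Real.norm_eq_abs] at e2
    have e4 := (Complex.abs_re_le_norm _).trans e1
    rw [Complex.sub_re, ← Complex.ofReal_pow, Complex.re_ofReal_mul] at e4
    have := abs_le.1 e2
    have := abs_le.1 e4
    linarith
  · refine eq_zero_of_odd hk (M := M₁) ?_
    filter_upwards [hM₁] with ε e1
    rw [Real.norm_of_nonneg (by positivity : (0 : ℝ) ≤ |ε| ^ (k + 1))] at e1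
    have e4 := (Complex.abs_im_le_norm _).trans e1
    rw [Complex.sub_im, ← Complex.ofReal_pow, Complex.im_ofReal_mul, hreal] at e4
    have := abs_le.1 e4
    linarith

theorem bracketHyp (H : StepB T r ρ a) :
    BracketHyp (fun (t : T) u v => (bra a r u v).1 t.1) where
  add_left t u u' v := by rw [bra_add]; rfl
  smul_left t c u v := by
    rw [bra_smul]
    exact Complex.real_smul
  leib g u v hg h t := by
    have h1 := H.act_vanish g (f := bra a r u v) (fun z hz => h ⟨z, hz⟩) t.1 t.2
    rw [hg.act_bra] at h1
    exact h1
  kill t u v := by rw [bra_mul_true]; rfl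
  herm t u v := by rw [← cj_apply, cj_bra, cj_of_real H.hr]
  one t := by
    rw [bra_one, dop_one, H.hr, H.zero t.1 t.2, Complex.ofReal_zero]
  null V hV h t := by
    have h1 := h t
    rw [bra_firstOrder a t.1 (hV.firstOrder a) (firstOrder_one a)] at h1
    rw [bra_firstOrder a t.1 ((IsLie.gen true).firstOrder a) (hV.firstOrder a)]
    have h2 := H.null t.1 t.2 (fun j => (act a V (cz j)).1 t.1) (by
      rw [dirDeriv_eq H.hr, ← h1, Fintype.sum_option, Fintype.sum_option]
      simp [dO, dbO])
    rw [levi_eq H.hr] at h2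
    rw [← h2, Fintype.sum_option]
    have h0 : ∀ o', (((Option.none : Option (Fin n)).elim (0 : smoothAlg n)
        fun j => act a (lt true) (cz j)) : smoothAlg n).1 t.1 *
        (starRingEnd ℂ) ((Option.elim o' (0 : smoothAlg n) fun j => act a V (cz j)).1 t.1) *
        (dO none (dbO o' r)).1 t.1 = 0 := by
      intro o'
      simp
    rw [Finset.sum_eq_zero fun o' _ => h0 o', zero_add]
    refine Finset.sum_congr rfl fun j _ => ?_
    rw [Fintype.sum_option]
    simp only [Option.elim_none, Option.elim_some, ZeroMemClass.coe_zero, Pi.zero_apply, map_zero,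
      mul_zero, zero_mul, zero_add, act_lt, dv_cz_true]
    refine Finset.sum_congr rfl fun k _ => ?_
    simp only [dO, dbO, Derivation.coeFn_coe]
    ring
  pos t W V c k hW hV hk h1 h2 h3 := H.pos t.2 c hW hV hk h1 h2 h3

theorem curve_isBigO (H : StepB T r ρ a) {q : Fin n → ℂ} (hq : q ∈ T) (N : ℕ) :
    (fun ζ => ρ (curve a q (lt true) N ζ)) =O[𝓝 0] fun ζ => ‖ζ‖ ^ (N + 1) := by
  have h := eqO_zero (k := N) (fun α β _ => H.bracketHyp.pow_eq_zero α β ⟨q, hq⟩)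
    (value_expansion H.hr q (IsLie.gen true) N)
  exact IsBigO.of_norm_left (h.norm_left.congr_left fun ζ => Complex.norm_real _)

end StepB

end

section

variable {n : ℕ}

open Asymptotics Polynomial

section VanishingDerivatives

variable {E F : Type*} [NormedAddCommGroup E] [NormedSpace ℝ E] [NormedAddCommGroup F]
  [NormedSpace ℝ F]

/-- Directional derivative acting on smooth functions. -/
def smoothDir (v : E) (f : {f : E → F // ContDiff ℝ ∞ f}) : {f : E → F // ContDiff ℝ ∞ f} :=
  ⟨fun x => fderiv ℝ f.1 x v, (f.2.fderiv_right (m := ∞) (by simp)).clm_apply contDiff_const⟩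

theorem smoothDir_comm (v w : E) (f : {f : E → F // ContDiff ℝ ∞ f}) :
    smoothDir v (smoothDir w f) = smoothDir w (smoothDir v f) := by
  ext z
  have hd : DifferentiableAt ℝ (fderiv ℝ f.1) z :=
    ((f.2.fderiv_right (m := ∞) (by simp)).differentiable (by simp)).differentiableAt
  have key : ∀ v w : E,
      (smoothDir v (smoothDir w f)).1 z = fderiv ℝ (fderiv ℝ f.1) z v w := by
    intro v w
    change fderiv ℝ (fun y => fderiv ℝ f.1 y w) z v = _
    rw [fderiv_clm_apply hd (differentiableAt_const w)]
    simp
  have hs : IsSymmSndFDerivAt ℝ f.1 z :=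
    f.2.contDiffAt.isSymmSndFDerivAt (by
      rw [minSmoothness_of_isRCLikeNormedField]; exact WithTop.coe_le_coe.2 (le_top (a := (2 : ℕ∞))))
  rw [key, key, hs v w]

theorem iteratedFDeriv_eq_foldr (f : {f : E → F // ContDiff ℝ ∞ f}) (k : ℕ) :
    ∀ (x : E) (v : Fin k → E),
      iteratedFDeriv ℝ k f.1 x v = ((List.ofFn v).foldr smoothDir f).1 x := by
  induction k with
  | zero => intro x v; simp
  | succ k ih =>
    intro x v
    rw [iteratedFDeriv_succ_apply_left, List.ofFn_succ, List.foldr_cons]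
    change _ = fderiv ℝ ((List.foldr smoothDir f (List.ofFn fun i => v i.succ)).1) x (v 0)
    have h1 : (List.foldr smoothDir f (List.ofFn fun i => v i.succ)).1 =
        fun y => iteratedFDeriv ℝ k f.1 y (Fin.tail v) := funext fun y => (ih y _).symm
    rw [h1]
    have hd : DifferentiableAt ℝ (iteratedFDeriv ℝ k f.1) x :=
      (f.2.differentiable_iteratedFDeriv (by exact_mod_cast ENat.natCast_lt_top k)).differentiableAt
    have h2 := ((ContinuousMultilinearMap.apply ℝ (fun _ : Fin k => E) F
      (Fin.tail v)).hasFDerivAt.comp x hd.hasFDerivAt).fderiv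
    rw [show (fun y => iteratedFDeriv ℝ k f.1 y (Fin.tail v)) =
      (ContinuousMultilinearMap.apply ℝ (fun _ : Fin k => E) F (Fin.tail v)) ∘
        iteratedFDeriv ℝ k f.1 from rfl, h2]
    rfl

theorem iteratedFDeriv_perm {f : E → F} (hf : ContDiff ℝ ∞ f) {k : ℕ} (x : E) (v : Fin k → E)
    (σ : Equiv.Perm (Fin k)) :
    iteratedFDeriv ℝ k f x (fun i => v (σ i)) = iteratedFDeriv ℝ k f x v := by
  have : LeftCommutative (smoothDir : E → {f : E → F // ContDiff ℝ ∞ f} → _) := ⟨smoothDir_comm⟩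
  have h := iteratedFDeriv_eq_foldr ⟨f, hf⟩ k x
  rw [h, h]
  exact congrArg (fun u => u.1 x)
    (List.Perm.foldr_eq (f := smoothDir (E := E) (F := F)) (Equiv.Perm.ofFn_comp_perm σ v) _)

theorem iteratedDeriv_eq_zero_of_isBigO {h : ℝ → F} (hh : ContDiff ℝ ∞ h) {N : ℕ}
    (hO : h =O[𝓝 0] fun t => ‖t‖ ^ (N + 1)) (k : ℕ) (hk : k ≤ N) : iteratedDeriv k h 0 = 0 := by
  induction k using Nat.strong_induction_on with
  | _ k ih =>
    have hc : ContDiff ℝ k h := hh.of_le (by exact_mod_cast le_top)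
    have h1 := taylor_isLittleO_univ (x₀ := (0 : ℝ)) hc
    have h2 : ∀ x, taylorWithinEval h k Set.univ 0 x =
        ((k.factorial : ℝ)⁻¹ * x ^ k) • iteratedDeriv k h 0 := by
      intro x
      rw [taylor_within_apply, Finset.sum_range_succ, Finset.sum_eq_zero, zero_add, sub_zero,
        iteratedDerivWithin_univ]
      intro i hi
      rw [iteratedDerivWithin_univ, ih i (Finset.mem_range.1 hi) (by
        have := Finset.mem_range.1 hi; omega), smul_zero]
    simp only [h2, sub_zero] at h1
    have h4 : (fun t : ℝ => t ^ (N + 1)) =o[𝓝 0] fun t : ℝ => t ^ k :=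
      isLittleO_pow_pow (by omega)
    have h3 : h =o[𝓝 0] fun t : ℝ => t ^ k := by
      refine hO.trans_isLittleO ?_
      simpa only [norm_pow] using h4.norm_left
    have h5 : (fun x : ℝ => ((k.factorial : ℝ)⁻¹ * x ^ k) • iteratedDeriv k h 0) =o[𝓝 0]
        fun t : ℝ => t ^ k := (h3.sub h1).congr_left fun x => sub_sub_cancel _ _
    by_contra hne
    have h6 : (fun x : ℝ => x ^ k) =O[𝓝 0]
        fun x : ℝ => ((k.factorial : ℝ)⁻¹ * x ^ k) • iteratedDeriv k h 0 := by
      refine IsBigO.of_bound (k.factorial * ‖iteratedDeriv k h 0‖⁻¹) (.of_forall fun x => ?_)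
      have : ‖iteratedDeriv k h 0‖ ≠ 0 := norm_ne_zero_iff.2 hne
      have h7 : (k.factorial : ℝ) ≠ 0 := by positivity
      rw [norm_smul, norm_mul, norm_inv, Real.norm_natCast]
      field_simp
      exact le_rfl
    refine isLittleO_irrefl ?_ (h6.trans_isLittleO h5)
    have h8 : ∃ᶠ x : ℝ in 𝓝[≠] 0, x ^ k ≠ 0 := by
      refine Filter.Eventually.frequently ?_
      filter_upwards [self_mem_nhdsWithin] with x hx
      exact pow_ne_zero _ hx
    exact h8.filter_mono nhdsWithin_le_nhds

theorem iteratedFDeriv_eq_zero_of_isBigO {g : E → F} (hg : ContDiff ℝ ∞ g) {N : ℕ}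
    (hO : g =O[𝓝 0] fun x => ‖x‖ ^ (N + 1)) (k : ℕ) (hk : k ≤ N) :
    iteratedFDeriv ℝ k g 0 = 0 := by
  have hdiag : ∀ v : E, iteratedFDeriv ℝ k g 0 (fun _ => v) = 0 := by
    intro v
    let L := ContinuousLinearMap.toSpanSingleton ℝ v
    have h1 := L.iteratedFDeriv_comp_right (i := k) hg (0 : ℝ) (by exact_mod_cast le_top)
    have h2 := iteratedDeriv_eq_zero_of_isBigO (h := g ∘ L) (N := N) (hg.comp L.contDiff) ?_ k hk
    · rw [iteratedDeriv_eq_iteratedFDeriv, h1] at h2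
      simpa [L] using h2
    · have h3 : Filter.Tendsto L (𝓝 0) (𝓝 0) := by
        simpa using L.continuous.tendsto 0
      refine (hO.comp_tendsto h3).trans ?_
      have h4 : (fun t => L t) =O[𝓝 0] fun t : ℝ => t := L.isBigO_id _
      exact ((h4.norm_norm).pow (N + 1))
  have h5 := fun v => (iteratedFDeriv ℝ k g 0).iteratedFDeriv_comp_diagonal (0 : E) v
  ext v
  have h6 := h5 v
  have h7 : (fun x : E => iteratedFDeriv ℝ k g 0 fun _ => x) = fun _ => 0 := funext hdiag
  rw [h7] at h6
  simp only [iteratedFDeriv_perm hg, Finset.sum_const, Finset.card_univ] at h6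
  rw [show (fun _ : E => (0 : F)) = 0 from rfl, iteratedFDeriv_zero] at h6
  have h8 : Fintype.card (Equiv.Perm (Fin k)) ≠ 0 := Fintype.card_ne_zero
  rw [← Nat.cast_smul_eq_nsmul ℝ] at h6
  have h9 := smul_eq_zero.1 h6.symm
  rcases h9 with h9 | h9
  · exact absurd (by exact_mod_cast h9) h8
  · exact h9

end VanishingDerivatives

theorem orderR_ge {g : ℂ → ℝ} (hg : ContDiff ℝ ∞ g) {N : ℕ}
    (hO : g =O[𝓝 0] fun x => ‖x‖ ^ (N + 1)) : ((N + 1 : ℕ) : ℕ∞) ≤ orderR g := by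
  refine le_sInf ?_
  rintro _ ⟨k, hk, rfl⟩
  by_contra hlt
  refine hk (iteratedFDeriv_eq_zero_of_isBigO hg hO k ?_)
  have : k < N + 1 := Nat.cast_lt.1 (not_le.1 hlt)
  omega

theorem not_finiteTypePt {T : Set (Fin n → ℂ)} {r : smoothAlg n} {ρ : (Fin n → ℂ) → ℝ}
    {a : Fin n → smoothAlg n} (H : StepB T r ρ a) {q : Fin n → ℂ} (hq : q ∈ T) {j : Fin n}
    (hj : (a j).1 q ≠ 0) : ¬ FiniteTypePt ρ q := by
  rintro ⟨M, hM⟩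
  have hpoly : ∀ i, (fun t => curve a q (lt true) (M + 1) t i) =
      fun t => (jet a q (lt true) (M + 1) (cz i)).eval t := fun i => rfl
  have hder : deriv (fun t => curve a q (lt true) (M + 1) t j) 0 = (a j).1 q := by
    rw [hpoly, Polynomial.deriv, ← Polynomial.coeff_zero_eq_eval_zero, Polynomial.coeff_derivative,
      jet_coeff _ _ _ _ _ (by omega), jetCoeff]
    simp [act_lt, dv_cz_true]
  have hcurve : curveOrder (curve a q (lt true) (M + 1)) q ≤ 1 := by
    refine (iInf_le _ j).trans (sInf_le ⟨1, ?_, by simp⟩)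
    change iteratedDeriv 1 _ 0 ≠ 0
    rw [iteratedDeriv_one, deriv_sub_const, hder]
    exact hj
  have hsm : ContDiff ℝ ∞ ρ := by
    have : ρ = fun z => (r.1 z).re := funext fun z => by rw [H.hr]; rfl
    rw [this]
    exact Complex.reCLM.contDiff.comp (smC r)
  have hcs : ContDiff ℝ ∞ (curve a q (lt true) (M + 1)) := by
    rw [contDiff_pi]
    intro i
    rw [hpoly]
    have h : ContDiff ℂ ∞ fun t : ℂ => aeval t (jet a q (lt true) (M + 1) (cz i)) :=
      Polynomial.contDiff_aeval _ _
    simp only [Polynomial.coe_aeval_eq_eval] at h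
    exact h.restrict_scalars ℝ
  have hord := orderR_ge (hsm.comp hcs) (H.curve_isBigO hq (M + 1))
  have h1 := hM (curve a q (lt true) (M + 1))
    (fun i => by
      rw [hpoly]
      exact ((jet a q (lt true) (M + 1) (cz i)).differentiable.analyticAt 0))
    (curve_zero _ _ _) (by
      intro hc
      apply hj
      rw [← hder]
      have h2 : (fun t => curve a q (lt true) (M + 1) t j) =ᶠ[𝓝 0] fun _ => q j := by
        filter_upwards [hc] with t ht
        rw [ht]
      rw [h2.deriv_eq]; simp)
  have h2 : ((M + 1 + 1 : ℕ) : ℕ∞) ≤ M := by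
    calc _ ≤ _ := hord
      _ ≤ _ := h1
      _ ≤ (M : ℕ∞) * 1 := by gcongr
      _ = M := mul_one _
  have h3 : M + 1 + 1 ≤ M := by exact_mod_cast h2
  omega

end

section

variable {n : ℕ}

theorem contDiffAt_eventually_two {f : (Fin n → ℂ) → ℝ} {z : Fin n → ℂ} (hf : ContDiffAt ℝ 2 f z) :
    ∀ᶠ w in 𝓝 z, ContDiffAt ℝ 2 f w := hf.eventually (by simp)

theorem fderiv_cplx {f : (Fin n → ℂ) → ℝ} {z : Fin n → ℂ} (hf : DifferentiableAt ℝ f z)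
    (v : Fin n → ℂ) : fderiv ℝ (cplx f) z v = (fderiv ℝ f z v : ℂ) := by
  have := (Complex.ofRealCLM.hasFDerivAt.comp z hf.hasFDerivAt).fderiv
  rw [show cplx f = ofRealCLM ∘ f from rfl, this]; rfl

theorem differentiableAt_cplx {f : (Fin n → ℂ) → ℝ} {z : Fin n → ℂ} (hf : DifferentiableAt ℝ f z) :
    DifferentiableAt ℝ (cplx f) z :=
  (Complex.ofRealCLM.hasFDerivAt.comp z hf.hasFDerivAt).differentiableAt

theorem dz_congr {F G : (Fin n → ℂ) → ℂ} {z : Fin n → ℂ} (h : F =ᶠ[𝓝 z] G) (j : Fin n) :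
    dz j F z = dz j G z := by
  unfold dz; rw [h.fderiv_eq]

theorem dzbar_congr {F G : (Fin n → ℂ) → ℂ} {z : Fin n → ℂ} (h : F =ᶠ[𝓝 z] G) (j : Fin n) :
    dzbar j F z = dzbar j G z := by
  unfold dzbar; rw [h.fderiv_eq]

theorem dirDeriv_congr {F G : (Fin n → ℂ) → ℂ} {z : Fin n → ℂ} (h : F =ᶠ[𝓝 z] G) (X : Fin n → ℂ) :
    dirDeriv X F z = dirDeriv X G z := by
  unfold dirDeriv
  simp only [dz_congr h]

theorem cplx_congr {f g : (Fin n → ℂ) → ℝ} {z : Fin n → ℂ} (h : f =ᶠ[𝓝 z] g) :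
    cplx f =ᶠ[𝓝 z] cplx g := h.mono fun w hw => by simp [cplx, hw]

theorem levi_congr {f g : (Fin n → ℂ) → ℝ} {z : Fin n → ℂ} (h : f =ᶠ[𝓝 z] g) (X Y : Fin n → ℂ) :
    levi f X Y z = levi g X Y z := by
  unfold levi
  refine Finset.sum_congr rfl fun j _ => Finset.sum_congr rfl fun k _ => ?_
  rw [dz_congr (F := fun w => dzbar k (cplx f) w) (G := fun w => dzbar k (cplx g) w)]
  filter_upwards [(cplx_congr h).eventuallyEq_nhds] with w hw
  exact dzbar_congr hw k

theorem conj_dz {f : (Fin n → ℂ) → ℝ} {z : Fin n → ℂ} (hf : DifferentiableAt ℝ f z) (j : Fin n) :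
    (starRingEnd ℂ) (dz j (cplx f) z) = dzbar j (cplx f) z := by
  unfold dz dzbar
  simp only [fderiv_cplx hf, map_div₀, map_sub, map_mul (starRingEnd ℂ), conj_I, conj_ofReal,
    map_ofNat]
  ring

theorem conj_dirDeriv {f : (Fin n → ℂ) → ℝ} {z : Fin n → ℂ} (hf : DifferentiableAt ℝ f z)
    (X : Fin n → ℂ) :
    (starRingEnd ℂ) (dirDeriv X (cplx f) z) = ∑ j, (starRingEnd ℂ) (X j) * dzbar j (cplx f) z := by
  unfold dirDeriv
  simp only [map_sum, map_mul (starRingEnd ℂ), conj_dz hf]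

theorem dz_mul {F G : (Fin n → ℂ) → ℂ} {z : Fin n → ℂ} (hF : DifferentiableAt ℝ F z)
    (hG : DifferentiableAt ℝ G z) (j : Fin n) :
    dz j (fun w => F w * G w) z = F z * dz j G z + G z * dz j F z := by
  unfold dz
  rw [fderiv_fun_mul hF hG]
  simp only [add_apply, smul_apply, smul_eq_mul]
  ring

theorem dz_add {F G : (Fin n → ℂ) → ℂ} {z : Fin n → ℂ} (hF : DifferentiableAt ℝ F z)
    (hG : DifferentiableAt ℝ G z) (j : Fin n) :
    dz j (fun w => F w + G w) z = dz j F z + dz j G z := by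
  unfold dz
  rw [fderiv_fun_add hF hG]
  simp only [add_apply]
  ring

theorem dzbar_mul {F G : (Fin n → ℂ) → ℂ} {z : Fin n → ℂ} (hF : DifferentiableAt ℝ F z)
    (hG : DifferentiableAt ℝ G z) (j : Fin n) :
    dzbar j (fun w => F w * G w) z = F z * dzbar j G z + G z * dzbar j F z := by
  unfold dzbar
  rw [fderiv_fun_mul hF hG]
  simp only [add_apply, smul_apply, smul_eq_mul]
  ring

theorem dzbar_add {F G : (Fin n → ℂ) → ℂ} {z : Fin n → ℂ} (hF : DifferentiableAt ℝ F z)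
    (hG : DifferentiableAt ℝ G z) (j : Fin n) :
    dzbar j (fun w => F w + G w) z = dzbar j F z + dzbar j G z := by
  unfold dzbar
  rw [fderiv_fun_add hF hG]
  simp only [add_apply]
  ring

theorem fderiv_comp_real {f : (Fin n → ℂ) → ℝ} {φ : ℝ → ℝ} {z : Fin n → ℂ}
    (hf : DifferentiableAt ℝ f z) (hφ : DifferentiableAt ℝ φ (f z)) (v : Fin n → ℂ) :
    fderiv ℝ (fun w => φ (f w)) z v = deriv φ (f z) * fderiv ℝ f z v := by
  have := (hφ.hasDerivAt.comp_hasFDerivAt z hf.hasFDerivAt).fderiv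
  rw [show (fun w => φ (f w)) = φ ∘ f from rfl, this]
  simp

theorem dz_comp {f : (Fin n → ℂ) → ℝ} {φ : ℝ → ℝ} {z : Fin n → ℂ}
    (hf : DifferentiableAt ℝ f z) (hφ : DifferentiableAt ℝ φ (f z)) (j : Fin n) :
    dz j (cplx fun w => φ (f w)) z = ((deriv φ (f z) : ℝ) : ℂ) * dz j (cplx f) z := by
  unfold dz
  have h : DifferentiableAt ℝ (fun w => φ (f w)) z := hφ.comp z hf
  simp only [fderiv_cplx h, fderiv_cplx hf, fderiv_comp_real hf hφ]
  push_cast; ring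

theorem dzbar_comp {f : (Fin n → ℂ) → ℝ} {φ : ℝ → ℝ} {z : Fin n → ℂ}
    (hf : DifferentiableAt ℝ f z) (hφ : DifferentiableAt ℝ φ (f z)) (j : Fin n) :
    dzbar j (cplx fun w => φ (f w)) z = ((deriv φ (f z) : ℝ) : ℂ) * dzbar j (cplx f) z := by
  unfold dzbar
  have h : DifferentiableAt ℝ (fun w => φ (f w)) z := hφ.comp z hf
  simp only [fderiv_cplx h, fderiv_cplx hf, fderiv_comp_real hf hφ]
  push_cast; ring

theorem dirDeriv_comp {f : (Fin n → ℂ) → ℝ} {φ : ℝ → ℝ} {z : Fin n → ℂ}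
    (hf : DifferentiableAt ℝ f z) (hφ : DifferentiableAt ℝ φ (f z)) (X : Fin n → ℂ) :
    dirDeriv X (cplx fun w => φ (f w)) z = ((deriv φ (f z) : ℝ) : ℂ) * dirDeriv X (cplx f) z := by
  unfold dirDeriv
  rw [Finset.mul_sum]
  exact Finset.sum_congr rfl fun j _ => by rw [dz_comp hf hφ]; ring

theorem dirDeriv_mul {f g : (Fin n → ℂ) → ℝ} {z : Fin n → ℂ} (hf : DifferentiableAt ℝ f z)
    (hg : DifferentiableAt ℝ g z) (X : Fin n → ℂ) :
    dirDeriv X (cplx fun w => f w * g w) z =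
      f z * dirDeriv X (cplx g) z + g z * dirDeriv X (cplx f) z := by
  have : (cplx fun w => f w * g w) = fun w => cplx f w * cplx g w := by
    funext w; simp [cplx]
  unfold dirDeriv
  simp only [this, dz_mul (differentiableAt_cplx hf) (differentiableAt_cplx hg), Finset.mul_sum,
    ← Finset.sum_add_distrib]
  exact Finset.sum_congr rfl fun j _ => by simp only [cplx]; ring

theorem dirDeriv_add {f g : (Fin n → ℂ) → ℝ} {z : Fin n → ℂ} (hf : DifferentiableAt ℝ f z)
    (hg : DifferentiableAt ℝ g z) (X : Fin n → ℂ) :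
    dirDeriv X (cplx fun w => f w + g w) z = dirDeriv X (cplx f) z + dirDeriv X (cplx g) z := by
  have : (cplx fun w => f w + g w) = fun w => cplx f w + cplx g w := by
    funext w; simp [cplx]
  unfold dirDeriv
  simp only [this, dz_add (differentiableAt_cplx hf) (differentiableAt_cplx hg), 
    ← Finset.sum_add_distrib]
  exact Finset.sum_congr rfl fun j _ => by ring

theorem differentiableAt_dzbar {f : (Fin n → ℂ) → ℝ} {z : Fin n → ℂ} (hf : ContDiffAt ℝ 2 f z)
    (k : Fin n) : DifferentiableAt ℝ (fun w => dzbar k (cplx f) w) z := by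
  have h1 : ContDiffAt ℝ 2 (cplx f) z := Complex.ofRealCLM.contDiff.contDiffAt.comp z hf
  have h2 : ContDiffAt ℝ 1 (fderiv ℝ (cplx f)) z := h1.fderiv_right (by norm_num)
  have h3 : DifferentiableAt ℝ (fderiv ℝ (cplx f)) z := h2.differentiableAt (by simp)
  unfold dzbar
  have h4 : ∀ v : Fin n → ℂ, DifferentiableAt ℝ (fun w => fderiv ℝ (cplx f) w v) z := fun v =>
    h3.clm_apply (differentiableAt_const v)
  simp only [div_eq_mul_inv]
  exact ((h4 _).fun_add ((differentiableAt_const I).fun_mul (h4 _))).fun_mul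
    (differentiableAt_const _)

theorem levi_comp {f : (Fin n → ℂ) → ℝ} {φ : ℝ → ℝ} {z : Fin n → ℂ}
    (hf : ContDiffAt ℝ 2 f z) (hφ : ContDiffAt ℝ 2 φ (f z)) (X Y : Fin n → ℂ) :
    levi (fun w => φ (f w)) X Y z = ((deriv φ (f z) : ℝ) : ℂ) * levi f X Y z +
      ((deriv (deriv φ) (f z) : ℝ) : ℂ) * (dirDeriv X (cplx f) z *
        (starRingEnd ℂ) (dirDeriv Y (cplx f) z)) := by
  have hfd : DifferentiableAt ℝ f z := hf.differentiableAt (by simp)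
  have h1 : ∀ k, (fun w => dzbar k (cplx fun w => φ (f w)) w) =ᶠ[𝓝 z]
      fun w => cplx (fun w => deriv φ (f w)) w * dzbar k (cplx f) w := by
    intro k
    have h2 : ∀ᶠ w in 𝓝 z, DifferentiableAt ℝ φ (f w) :=
      hfd.continuousAt.eventually ((hφ.eventually (by simp)).mono fun y hy =>
        hy.differentiableAt (by simp))
    filter_upwards [h2, contDiffAt_eventually_two hf] with w hw hw2
    exact dzbar_comp (hw2.differentiableAt (by simp)) hw k
  have hφ' : DifferentiableAt ℝ (deriv φ) (f z) := by
    have h2 : ContDiffAt ℝ 1 (deriv φ) (f z) := by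
      have := hφ.fderiv_right (m := 1) (by norm_num)
      exact this.clm_apply contDiffAt_const
    exact h2.differentiableAt (by simp)
  have h3 : DifferentiableAt ℝ (fun w => deriv φ (f w)) z := hφ'.comp z hfd
  unfold levi
  rw [conj_dirDeriv hfd]
  unfold dirDeriv
  rw [Finset.sum_mul_sum]
  simp only [Finset.mul_sum, ← Finset.sum_add_distrib]
  refine Finset.sum_congr rfl fun j _ => Finset.sum_congr rfl fun k _ => ?_
  rw [dz_congr (h1 k), dz_mul (differentiableAt_cplx h3) (differentiableAt_dzbar hf k),
    dz_comp hfd hφ']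
  simp only [cplx]; ring

theorem levi_mul {f g : (Fin n → ℂ) → ℝ} {z : Fin n → ℂ}
    (hf : ContDiffAt ℝ 2 f z) (hg : ContDiffAt ℝ 2 g z) (X Y : Fin n → ℂ) :
    levi (fun w => f w * g w) X Y z = f z * levi g X Y z + g z * levi f X Y z +
      (dirDeriv X (cplx f) z * (starRingEnd ℂ) (dirDeriv Y (cplx g) z) +
        dirDeriv X (cplx g) z * (starRingEnd ℂ) (dirDeriv Y (cplx f) z)) := by
  have hfd : DifferentiableAt ℝ f z := hf.differentiableAt (by simp)
  have hgd : DifferentiableAt ℝ g z := hg.differentiableAt (by simp)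
  have h1 : ∀ k, (fun w => dzbar k (cplx fun w => f w * g w) w) =ᶠ[𝓝 z]
      fun w => cplx f w * dzbar k (cplx g) w + cplx g w * dzbar k (cplx f) w := by
    intro k
    filter_upwards [contDiffAt_eventually_two hf, contDiffAt_eventually_two hg] with w h1 h2
    have : (cplx fun w => f w * g w) = fun w => cplx f w * cplx g w := by
      funext w; simp [cplx]
    rw [this, dzbar_mul (differentiableAt_cplx (h1.differentiableAt (by simp)))
      (differentiableAt_cplx (h2.differentiableAt (by simp)))]
  have hdf := differentiableAt_cplx hfd
  have hdg := differentiableAt_cplx hgd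
  unfold levi
  rw [conj_dirDeriv hfd, conj_dirDeriv hgd]
  unfold dirDeriv
  rw [Finset.sum_mul_sum, Finset.sum_mul_sum]
  simp only [Finset.mul_sum, ← Finset.sum_add_distrib]
  refine Finset.sum_congr rfl fun j _ => Finset.sum_congr rfl fun k _ => ?_
  rw [dz_congr (h1 k), dz_add (hdf.fun_mul (differentiableAt_dzbar hg k))
    (hdg.fun_mul (differentiableAt_dzbar hf k)), dz_mul hdf (differentiableAt_dzbar hg k),
    dz_mul hdg (differentiableAt_dzbar hf k)]
  simp only [cplx]; ring

theorem levi_add {f g : (Fin n → ℂ) → ℝ} {z : Fin n → ℂ}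
    (hf : ContDiffAt ℝ 2 f z) (hg : ContDiffAt ℝ 2 g z) (X Y : Fin n → ℂ) :
    levi (fun w => f w + g w) X Y z = levi f X Y z + levi g X Y z := by
  have h1 : ∀ k, (fun w => dzbar k (cplx fun w => f w + g w) w) =ᶠ[𝓝 z]
      fun w => dzbar k (cplx f) w + dzbar k (cplx g) w := by
    intro k
    filter_upwards [contDiffAt_eventually_two hf, contDiffAt_eventually_two hg] with w h1 h2
    have : (cplx fun w => f w + g w) = fun w => cplx f w + cplx g w := by
      funext w; simp [cplx]
    rw [this, dzbar_add (differentiableAt_cplx (h1.differentiableAt (by simp)))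
      (differentiableAt_cplx (h2.differentiableAt (by simp)))]
  unfold levi
  simp only [← Finset.sum_add_distrib]
  refine Finset.sum_congr rfl fun j _ => Finset.sum_congr rfl fun k _ => ?_
  rw [dz_congr (h1 k), dz_add (differentiableAt_dzbar hf k) (differentiableAt_dzbar hg k)]
  ring

/-- The diagonal of the Levi form, as a real number. -/
def lev (f : (Fin n → ℂ) → ℝ) (X z : Fin n → ℂ) : ℝ := (levi f X X z).re

/-- The squared modulus of the derivative `X f`. -/
def dsq (f : (Fin n → ℂ) → ℝ) (X z : Fin n → ℂ) : ℝ := normSq (dirDeriv X (cplx f) z)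

theorem dsq_nonneg (f : (Fin n → ℂ) → ℝ) (X z : Fin n → ℂ) : 0 ≤ dsq f X z := normSq_nonneg _

theorem lev_comp {f : (Fin n → ℂ) → ℝ} {φ : ℝ → ℝ} {z : Fin n → ℂ}
    (hf : ContDiffAt ℝ 2 f z) (hφ : ContDiffAt ℝ 2 φ (f z)) (X : Fin n → ℂ) :
    lev (fun w => φ (f w)) X z = deriv φ (f z) * lev f X z +
      deriv (deriv φ) (f z) * dsq f X z := by
  unfold lev dsq
  rw [levi_comp hf hφ, mul_conj, add_re, re_ofReal_mul, re_ofReal_mul, ofReal_re]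

theorem lev_mul {f g : (Fin n → ℂ) → ℝ} {z : Fin n → ℂ}
    (hf : ContDiffAt ℝ 2 f z) (hg : ContDiffAt ℝ 2 g z) (X : Fin n → ℂ) :
    lev (fun w => f w * g w) X z = f z * lev g X z + g z * lev f X z +
      2 * (dirDeriv X (cplx f) z * (starRingEnd ℂ) (dirDeriv X (cplx g) z)).re := by
  unfold lev
  rw [levi_mul hf hg]
  simp only [add_re, mul_re, ofReal_re, ofReal_im, zero_mul, sub_zero, conj_re, conj_im]
  ring

theorem lev_add {f g : (Fin n → ℂ) → ℝ} {z : Fin n → ℂ}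
    (hf : ContDiffAt ℝ 2 f z) (hg : ContDiffAt ℝ 2 g z) (X : Fin n → ℂ) :
    lev (fun w => f w + g w) X z = lev f X z + lev g X z := by
  unfold lev
  rw [levi_add hf hg, add_re]

theorem lev_const_mul (c : ℝ) {f : (Fin n → ℂ) → ℝ} {z : Fin n → ℂ} (hf : ContDiffAt ℝ 2 f z)
    (X : Fin n → ℂ) : lev (fun w => c * f w) X z = c * lev f X z := by
  have h := lev_comp (φ := fun t => c * t) hf (contDiff_const.mul contDiff_id).contDiffAt X
  have h1 : deriv (fun t : ℝ => c * t) = fun _ => c := by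
    funext t; simp
  rw [h, h1]; simp

theorem fderiv_eq_re_dirDeriv {f : (Fin n → ℂ) → ℝ} {z : Fin n → ℂ} (hf : DifferentiableAt ℝ f z)
    (X : Fin n → ℂ) : fderiv ℝ f z X = 2 * (dirDeriv X (cplx f) z).re := by
  have h1 : X = ∑ j, ((X j).re • (Pi.single j 1 : Fin n → ℂ) +
      (X j).im • (Pi.single j I : Fin n → ℂ)) := by
    ext i
    simp only [Finset.sum_apply, Pi.add_apply, Pi.smul_apply, Pi.single_apply]
    simp [Finset.sum_add_distrib, Complex.re_add_im]
  conv_lhs => rw [h1]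
  unfold dirDeriv dz
  simp only [map_sum, map_add, map_smul, fderiv_cplx hf, smul_eq_mul, re_sum, Finset.mul_sum]
  refine Finset.sum_congr rfl fun j _ => ?_
  simp [Complex.mul_re]
  ring

end

section

variable {n : ℕ}

theorem levi_add_left {ρ : (Fin n → ℂ) → ℝ} (X X' Y z : Fin n → ℂ) :
    levi ρ (X + X') Y z = levi ρ X Y z + levi ρ X' Y z := by
  unfold levi
  simp only [← Finset.sum_add_distrib, Pi.add_apply]
  exact Finset.sum_congr rfl fun j _ => Finset.sum_congr rfl fun k _ => by ring

theorem levi_add_right {ρ : (Fin n → ℂ) → ℝ} (X Y Y' z : Fin n → ℂ) :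
    levi ρ X (Y + Y') z = levi ρ X Y z + levi ρ X Y' z := by
  unfold levi
  simp only [← Finset.sum_add_distrib, Pi.add_apply, map_add]
  exact Finset.sum_congr rfl fun j _ => Finset.sum_congr rfl fun k _ => by ring

theorem levi_smul_left {ρ : (Fin n → ℂ) → ℝ} (c : ℂ) (X Y z : Fin n → ℂ) :
    levi ρ (c • X) Y z = c * levi ρ X Y z := by
  unfold levi
  simp only [Finset.mul_sum, Pi.smul_apply, smul_eq_mul]
  exact Finset.sum_congr rfl fun j _ => Finset.sum_congr rfl fun k _ => by ring

theorem levi_smul_right {ρ : (Fin n → ℂ) → ℝ} (c : ℂ) (X Y z : Fin n → ℂ) :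
    levi ρ X (c • Y) z = (starRingEnd ℂ) c * levi ρ X Y z := by
  unfold levi
  simp only [Finset.mul_sum, Pi.smul_apply, smul_eq_mul, map_mul (starRingEnd ℂ)]
  exact Finset.sum_congr rfl fun j _ => Finset.sum_congr rfl fun k _ => by ring

theorem dirDeriv_add_left {f : (Fin n → ℂ) → ℂ} (X Y z : Fin n → ℂ) :
    dirDeriv (X + Y) f z = dirDeriv X f z + dirDeriv Y f z := by
  unfold dirDeriv
  simp only [← Finset.sum_add_distrib, Pi.add_apply]
  exact Finset.sum_congr rfl fun j _ => by ring

theorem dirDeriv_smul_left {f : (Fin n → ℂ) → ℂ} (c : ℂ) (X z : Fin n → ℂ) :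
    dirDeriv (c • X) f z = c * dirDeriv X f z := by
  unfold dirDeriv
  simp only [Finset.mul_sum, Pi.smul_apply, smul_eq_mul]
  exact Finset.sum_congr rfl fun j _ => by ring

theorem dirDeriv_sub_left {f : (Fin n → ℂ) → ℂ} (X Y z : Fin n → ℂ) :
    dirDeriv (X - Y) f z = dirDeriv X f z - dirDeriv Y f z := by
  have := dirDeriv_add_left (f := f) (X - Y) Y z
  rw [sub_add_cancel] at this
  rw [this]; ring

/-- A compact set of boundary points cut out by a globally smooth pseudoconvex function. -/
structure Bd (K : Set (Fin n → ℂ)) (r : smoothAlg n) (ρ : (Fin n → ℂ) → ℝ) : Prop where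
  hr : ∀ z, r.1 z = (ρ z : ℂ)
  cpt : IsCompact K
  zero : ∀ p ∈ K, ρ p = 0
  loc : ∀ p ∈ K, ∀ᶠ z in 𝓝 p, ρ z = 0 → z ∈ K
  grad : ∀ p ∈ K, fderiv ℝ ρ p ≠ 0
  psc : ∀ p ∈ K, LeviPseudoconvexAt ρ p

theorem smooth_of_eq {r : smoothAlg n} {ρ : (Fin n → ℂ) → ℝ} (hr : ∀ z, r.1 z = (ρ z : ℂ)) :
    ContDiff ℝ ∞ ρ := by
  have : ρ = fun z => (r.1 z).re := funext fun z => by rw [hr]; rfl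
  rw [this]
  exact Complex.reCLM.contDiff.comp (smC r)

/-- The complexification of a real smooth function, as an element of the smooth algebra. -/
def ofRealSmooth {f : (Fin n → ℂ) → ℝ} (hf : ContDiff ℝ ∞ f) : smoothAlg n :=
  ⟨cplx f, Complex.ofRealCLM.contDiff.comp hf⟩

theorem two_le_infty : (2 : WithTop ℕ∞) ≤ ((⊤ : ℕ∞) : WithTop ℕ∞) := WithTop.coe_le_coe.2 (le_top (a := (2 : ℕ∞)))

theorem levi_lipschitz {ρ : (Fin n → ℂ) → ℝ} (hρ : ContDiff ℝ ∞ ρ) (p : Fin n → ℂ) :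
    ∃ L, 0 ≤ L ∧ ∃ t ∈ 𝓝 p, (∀ z ∈ t, ∀ w ∈ t, ∀ X Y,
      ‖levi ρ X Y z - levi ρ X Y w‖ ≤ L * ‖z - w‖ * ‖X‖ * ‖Y‖) ∧
      (∀ z ∈ t, ∀ X Y, ‖levi ρ X Y z‖ ≤ L * ‖X‖ * ‖Y‖) ∧
      (∀ z ∈ t, ∀ w ∈ t, ∀ X,
      ‖dirDeriv X (cplx ρ) z - dirDeriv X (cplx ρ) w‖ ≤ L * ‖z - w‖ * ‖X‖) ∧
      (∀ z ∈ t, ∀ X, ‖dirDeriv X (cplx ρ) z‖ ≤ L * ‖X‖) := by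
  set r := ofRealSmooth hρ with hrdef
  have hr : ∀ z, r.1 z = (ρ z : ℂ) := fun z => rfl
  let G : (Fin n → ℂ) → Fin n → Fin n → ℂ := fun z j k => (pz j (pzb k r)).1 z
  let H : (Fin n → ℂ) → Fin n → ℂ := fun z j => (pz j r).1 z
  have hG : ContDiff ℝ ∞ G := contDiff_pi.2 fun j => contDiff_pi.2 fun k => smC _
  have hH : ContDiff ℝ ∞ H := contDiff_pi.2 fun j => smC _
  have h1le : (1 : WithTop ℕ∞) ≤ ((⊤ : ℕ∞) : WithTop ℕ∞) := WithTop.coe_le_coe.2 (le_top (a := (1 : ℕ∞)))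
  obtain ⟨L1, t1, ht1, hL1⟩ := (hG.of_le h1le).contDiffAt.exists_lipschitzOnWith (x := p)
  obtain ⟨L2, t2, ht2, hL2⟩ := (hH.of_le h1le).contDiffAt.exists_lipschitzOnWith (x := p)
  have hb1 : ∀ᶠ z in 𝓝 p, ‖G z‖ < ‖G p‖ + 1 :=
    (hG.continuous.norm.tendsto p).eventually_lt_const (by linarith)
  have hb2 : ∀ᶠ z in 𝓝 p, ‖H z‖ < ‖H p‖ + 1 :=
    (hH.continuous.norm.tendsto p).eventually_lt_const (by linarith)
  have gsum : ∀ (g : Fin n → Fin n → ℂ) (X Y : Fin n → ℂ),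
      ‖∑ j, ∑ k, g j k * X j * (starRingEnd ℂ) (Y k)‖ ≤ (n * n : ℝ) * ‖g‖ * ‖X‖ * ‖Y‖ := by
    intro g X Y
    calc _ ≤ ∑ j : Fin n, ∑ k : Fin n, ‖g‖ * ‖X‖ * ‖Y‖ := by
          refine norm_sum_le_of_le _ fun j _ => norm_sum_le_of_le _ fun k _ => ?_
          rw [norm_mul, norm_mul, RCLike.norm_conj]
          gcongr
          · exact (norm_le_pi_norm (g j) k).trans (norm_le_pi_norm g j)
          · exact norm_le_pi_norm X j
          · exact norm_le_pi_norm Y k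
      _ = _ := by simp; ring
  have hsum : ∀ (g : Fin n → ℂ) (X : Fin n → ℂ),
      ‖∑ j, X j * g j‖ ≤ (n : ℝ) * ‖g‖ * ‖X‖ := by
    intro g X
    calc _ ≤ ∑ j : Fin n, ‖X‖ * ‖g‖ := by
          refine norm_sum_le_of_le _ fun j _ => ?_
          rw [norm_mul]
          gcongr
          · exact norm_le_pi_norm X j
          · exact norm_le_pi_norm g j
      _ = _ := by simp; ring
  refine ⟨(n * n) * L1 + (n * n) * (‖G p‖ + 1) + n * L2 + n * (‖H p‖ + 1), by positivity,
    t1 ∩ t2 ∩ {z | ‖G z‖ < ‖G p‖ + 1} ∩ {z | ‖H z‖ < ‖H p‖ + 1},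
    Filter.inter_mem (Filter.inter_mem (Filter.inter_mem ht1 ht2) hb1) hb2, ?_, ?_, ?_, ?_⟩
  · rintro z ⟨⟨⟨hz1, hz2⟩, hz3⟩, hz4⟩ w ⟨⟨⟨hw1, hw2⟩, hw3⟩, hw4⟩ X Y
    have h1 : levi ρ X Y z - levi ρ X Y w =
        ∑ j, ∑ k, (G z - G w) j k * X j * (starRingEnd ℂ) (Y k) := by
      rw [levi_eq hr, levi_eq hr]
      simp only [← Finset.sum_sub_distrib, Pi.sub_apply, sub_mul, G]
    rw [h1]
    have h2 := hL1.norm_sub_le hz1 hw1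
    calc _ ≤ (n * n : ℝ) * ‖G z - G w‖ * ‖X‖ * ‖Y‖ := gsum _ _ _
      _ ≤ (n * n : ℝ) * (L1 * ‖z - w‖) * ‖X‖ * ‖Y‖ := by gcongr
      _ = ((n * n : ℝ) * L1 + 0 + 0 + 0) * ‖z - w‖ * ‖X‖ * ‖Y‖ := by ring
      _ ≤ _ := by gcongr <;> positivity
  · rintro z ⟨⟨⟨hz1, hz2⟩, hz3⟩, hz4⟩ X Y
    rw [levi_eq hr]
    have h3 : ‖G z‖ ≤ ‖G p‖ + 1 := le_of_lt hz3
    calc _ ≤ (n * n : ℝ) * ‖G z‖ * ‖X‖ * ‖Y‖ := gsum (G z) _ _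
      _ ≤ (0 + (n * n : ℝ) * (‖G p‖ + 1) + 0 + 0) * ‖X‖ * ‖Y‖ := by
        simp only [zero_add, add_zero]; gcongr
      _ ≤ _ := by gcongr <;> positivity
  · rintro z ⟨⟨⟨hz1, hz2⟩, hz3⟩, hz4⟩ w ⟨⟨⟨hw1, hw2⟩, hw3⟩, hw4⟩ X
    have h1 : dirDeriv X (cplx ρ) z - dirDeriv X (cplx ρ) w = ∑ j, X j * (H z - H w) j := by
      rw [dirDeriv_eq hr, dirDeriv_eq hr]
      simp only [← Finset.sum_sub_distrib, Pi.sub_apply, mul_sub, H]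
    rw [h1]
    have h2 := hL2.norm_sub_le hz2 hw2
    calc _ ≤ (n : ℝ) * ‖H z - H w‖ * ‖X‖ := hsum _ _
      _ ≤ (n : ℝ) * (L2 * ‖z - w‖) * ‖X‖ := by gcongr
      _ = (0 + 0 + (n : ℝ) * L2 + 0) * ‖z - w‖ * ‖X‖ := by ring
      _ ≤ _ := by gcongr <;> positivity
  · rintro z ⟨⟨⟨hz1, hz2⟩, hz3⟩, hz4⟩ X
    rw [dirDeriv_eq hr]
    have h3 : ‖H z‖ ≤ ‖H p‖ + 1 := le_of_lt hz4
    calc _ ≤ (n : ℝ) * ‖H z‖ * ‖X‖ := hsum (H z) _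
      _ ≤ (0 + 0 + 0 + (n : ℝ) * (‖H p‖ + 1)) * ‖X‖ := by
        simp only [zero_add]; gcongr
      _ ≤ _ := by gcongr <;> positivity

theorem exists_zero_near {ρ : (Fin n → ℂ) → ℝ} (hρ : ContDiff ℝ ∞ ρ) {p : Fin n → ℂ}
    (hp : ρ p = 0) (hg : fderiv ℝ ρ p ≠ 0) :
    ∃ C, 0 ≤ C ∧ ∀ᶠ z in 𝓝 p, ∃ w, ρ w = 0 ∧ ‖z - w‖ ≤ C * |ρ z| := by
  have hst : HasStrictFDerivAt ρ (fderiv ℝ ρ p) p := hρ.contDiffAt.hasStrictFDerivAt (by simp)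
  have hsurj : (fderiv ℝ ρ p).range = ⊤ := by
    refine LinearMap.range_eq_top.2 ?_
    apply LinearMap.surjective
    intro h
    exact hg (ContinuousLinearMap.coe_injective h)
  let f' := fderiv ℝ ρ p
  let g := f'.nonlinearRightInverseOfSurjective hsurj
  have hpos : 0 < g.nnnorm := f'.nonlinearRightInverseOfSurjective_nnnorm_pos hsurj
  obtain ⟨s, hs, happ⟩ := hst.approximates_deriv_on_nhds (c := g.nnnorm⁻¹ / 2)
    (Or.inr (by positivity))
  obtain ⟨δ, hδ, hball⟩ := Metric.mem_nhds_iff.1 hs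
  set m : ℝ := (g.nnnorm : ℝ)⁻¹ / 2 with hm
  have hmpos : 0 < m := by have : (0 : ℝ) < g.nnnorm := hpos; positivity
  refine ⟨m⁻¹, by positivity, ?_⟩
  have h1 : ∀ᶠ z in 𝓝 p, m⁻¹ * |ρ z| < δ / 2 := by
    have : Filter.Tendsto (fun z => m⁻¹ * |ρ z|) (𝓝 p) (𝓝 (m⁻¹ * |ρ p|)) :=
      ((hρ.continuous.abs.tendsto p).const_mul _)
    rw [hp, abs_zero, mul_zero] at this
    exact this.eventually_lt_const (by positivity)
  filter_upwards [h1, Metric.ball_mem_nhds p (half_pos hδ)] with z hz1 hz2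
  have h2 : Metric.closedBall z (m⁻¹ * |ρ z|) ⊆ s := by
    refine subset_trans (fun w hw => ?_) hball
    rw [Metric.mem_closedBall] at hw
    rw [Metric.mem_ball] at hz2 ⊢
    linarith [dist_triangle w z p]
  have h3 := happ.surjOn_closedBall_of_nonlinearRightInverse g (by positivity) h2
  have h4 : (((g.nnnorm : ℝ)⁻¹ - ((g.nnnorm⁻¹ / 2 : NNReal) : ℝ)) * (m⁻¹ * |ρ z|)) = |ρ z| := by
    push_cast
    rw [show (g.nnnorm : ℝ)⁻¹ - (g.nnnorm : ℝ)⁻¹ / 2 = m by rw [hm]; ring]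
    field_simp
  obtain ⟨w, hw1, hw2⟩ := h3 (show (0 : ℝ) ∈ _ by rw [h4, Metric.mem_closedBall]; simp)
  exact ⟨w, hw2, by rw [Metric.mem_closedBall, dist_eq_norm] at hw1; rw [norm_sub_rev]; exact hw1⟩

theorem dirDeriv_ne_zero {f : (Fin n → ℂ) → ℝ} {p : Fin n → ℂ} (hf : DifferentiableAt ℝ f p)
    (h : fderiv ℝ f p ≠ 0) : ∃ ν, dirDeriv ν (cplx f) p ≠ 0 := by
  by_contra! hc
  apply h
  ext v
  rw [fderiv_eq_re_dirDeriv hf, hc]; simp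

theorem Bd.lower {K : Set (Fin n → ℂ)} {r : smoothAlg n} {ρ : (Fin n → ℂ) → ℝ} (H : Bd K r ρ)
    (p : Fin n → ℂ) (hp : p ∈ K) : ∃ c, ∀ᶠ z in 𝓝 p, ∀ X,
      -c * (|ρ z| * ‖X‖ ^ 2 + ‖dirDeriv X (cplx ρ) z‖ * ‖X‖) ≤ (levi ρ X X z).re := by
  have hρ := smooth_of_eq H.hr
  obtain ⟨L, hL, t, ht, l1, l2, l3, l4⟩ := levi_lipschitz hρ p
  obtain ⟨C, hC, hz⟩ := exists_zero_near hρ (H.zero p hp) (H.grad p hp)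
  obtain ⟨ν, hν⟩ := dirDeriv_ne_zero (hρ.contDiffAt.differentiableAt (by simp)) (H.grad p hp)
  have hcont : Continuous fun z => dirDeriv ν (cplx ρ) z := by
    simp only [dirDeriv_eq H.hr]
    exact continuous_finsetSum _ fun j _ => continuous_const.mul (smC _).continuous
  set δ := ‖dirDeriv ν (cplx ρ) p‖ / 2 with hδ
  have hδpos : 0 < δ := by have := norm_pos_iff.2 hν; positivity
  have hνlow : ∀ᶠ z in 𝓝 p, δ < ‖dirDeriv ν (cplx ρ) z‖ :=
    (hcont.norm.tendsto p).eventually_const_lt (by linarith)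
  obtain ⟨ε, hε, hball⟩ := Metric.mem_nhds_iff.1 (Filter.inter_mem (Filter.inter_mem ht hνlow)
    (H.loc p hp))
  have hsmall : ∀ᶠ z in 𝓝 p, C * |ρ z| < ε / 2 := by
    have : Filter.Tendsto (fun z => C * |ρ z|) (𝓝 p) (𝓝 (C * |ρ p|)) :=
      ((hρ.continuous.abs.tendsto p).const_mul _)
    rw [H.zero p hp, abs_zero, mul_zero] at this
    exact this.eventually_lt_const (by positivity)
  set D := δ⁻¹ * L with hD
  set E := L * ‖ν‖ * (2 + D * ‖ν‖) * δ⁻¹ with hE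
  have hE0 : 0 ≤ E := by positivity
  refine ⟨L * C + E + E * (L * C), ?_⟩
  filter_upwards [hz, hsmall, Metric.ball_mem_nhds p (half_pos hε)] with z ⟨w, hw0, hwz⟩ hzs hzb X
  rw [Metric.mem_ball] at hzb
  have hzin : z ∈ Metric.ball p ε := by rw [Metric.mem_ball]; linarith
  have hwin : w ∈ Metric.ball p ε := by
    rw [Metric.mem_ball]
    have := dist_triangle w z p
    rw [dist_eq_norm w z, norm_sub_rev] at this
    linarith
  obtain ⟨⟨hzt, -⟩, -⟩ := hball hzin
  obtain ⟨⟨hwt, hwν⟩, hwK⟩ := hball hwin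
  have hwK := hwK hw0
  have hwν' : δ < ‖dirDeriv ν (cplx ρ) w‖ := hwν
  have hτ : dirDeriv ν (cplx ρ) w ≠ 0 := norm_pos_iff.1 (hδpos.trans hwν')
  set c := dirDeriv X (cplx ρ) w / dirDeriv ν (cplx ρ) w with hc
  set Y := X - c • ν with hY
  have hYt : dirDeriv Y (cplx ρ) w = 0 := by
    rw [hY, dirDeriv_sub_left, dirDeriv_smul_left, hc]; field_simp; ring
  have hpos := H.psc w hwK Y hYt
  have hcn : ‖c‖ ≤ δ⁻¹ * ‖dirDeriv X (cplx ρ) w‖ := by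
    rw [hc, norm_div, div_eq_inv_mul]
    gcongr
  have hcX : ‖c‖ ≤ D * ‖X‖ := by
    calc _ ≤ _ := hcn
      _ ≤ δ⁻¹ * (L * ‖X‖) := by gcongr; exact l4 w hwt X
      _ = _ := by rw [hD]; ring
  have hYn : ‖Y‖ ≤ (1 + D * ‖ν‖) * ‖X‖ := by
    calc _ ≤ ‖X‖ + ‖c‖ * ‖ν‖ := by rw [← norm_smul]; exact norm_sub_le _ _
      _ ≤ ‖X‖ + D * ‖X‖ * ‖ν‖ := by gcongr
      _ = _ := by ring
  have hsplit : levi ρ X X w = levi ρ Y Y w + (levi ρ (c • ν) X w + levi ρ Y (c • ν) w) := by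
    have hX : X = Y + c • ν := by rw [hY]; abel
    conv_lhs => rw [hX, levi_add_left, levi_add_right, ← hX]
    ring
  have hrest : ‖levi ρ (c • ν) X w + levi ρ Y (c • ν) w‖ ≤
      E * (‖dirDeriv X (cplx ρ) z‖ + L * (C * |ρ z|) * ‖X‖) * ‖X‖ := by
    have h1 := l2 w hwt (c • ν) X
    have h2 := l2 w hwt Y (c • ν)
    rw [norm_smul] at h1 h2
    have h3 : ‖dirDeriv X (cplx ρ) w‖ ≤ ‖dirDeriv X (cplx ρ) z‖ + L * (C * |ρ z|) * ‖X‖ := by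
      have h4 := l3 z hzt w hwt X
      have h5 := norm_le_norm_add_norm_sub (dirDeriv X (cplx ρ) z) (dirDeriv X (cplx ρ) w)
      have h6 : L * ‖z - w‖ * ‖X‖ ≤ L * (C * |ρ z|) * ‖X‖ := by gcongr
      linarith
    calc _ ≤ ‖levi ρ (c • ν) X w‖ + ‖levi ρ Y (c • ν) w‖ := norm_add_le _ _
      _ ≤ L * (‖c‖ * ‖ν‖) * ‖X‖ + L * ‖Y‖ * (‖c‖ * ‖ν‖) := add_le_add h1 h2
      _ ≤ L * (‖c‖ * ‖ν‖) * ‖X‖ + L * ((1 + D * ‖ν‖) * ‖X‖) * (‖c‖ * ‖ν‖) := by gcongr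
      _ = L * ‖ν‖ * (2 + D * ‖ν‖) * ‖c‖ * ‖X‖ := by ring
      _ ≤ L * ‖ν‖ * (2 + D * ‖ν‖) * (δ⁻¹ * ‖dirDeriv X (cplx ρ) w‖) * ‖X‖ := by gcongr
      _ = E * ‖dirDeriv X (cplx ρ) w‖ * ‖X‖ := by rw [hE]; ring
      _ ≤ _ := by gcongr
  have hlip : ‖levi ρ X X z - levi ρ X X w‖ ≤ L * (C * |ρ z|) * ‖X‖ * ‖X‖ :=
    (l1 z hzt w hwt X X).trans (by gcongr)
  have e1 : -‖levi ρ X X z - levi ρ X X w‖ ≤ (levi ρ X X z - levi ρ X X w).re :=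
    (abs_le.1 (abs_re_le_norm _)).1
  have e2 := (abs_le.1 (abs_re_le_norm (levi ρ (c • ν) X w + levi ρ Y (c • ν) w))).1
  have e3 : (levi ρ X X z).re = (levi ρ X X z - levi ρ X X w).re + ((levi ρ Y Y w).re +
      (levi ρ (c • ν) X w + levi ρ Y (c • ν) w).re) := by
    rw [hsplit]; simp only [add_re, sub_re]; ring
  have e4 : 0 ≤ L * C * (‖dirDeriv X (cplx ρ) z‖ * ‖X‖) := by positivity
  have e5 : 0 ≤ E * (|ρ z| * ‖X‖ ^ 2) := by positivity
  have e6 : 0 ≤ E * (L * C) * (‖dirDeriv X (cplx ρ) z‖ * ‖X‖) := by positivity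
  rw [e3]
  nlinarith [e1, e2, hlip, hrest, hpos]

end

section

variable {n : ℕ}

/-- `X` is a complex tangent vector at `p` annihilated by the Levi form. -/
def IsNull (ρ : (Fin n → ℂ) → ℝ) (p X : Fin n → ℂ) : Prop :=
  dirDeriv X (cplx ρ) p = 0 ∧ lev ρ X p = 0

/-- Existence, on `A`, of bounded functions with arbitrarily large Levi form in the null directions. -/
def GoodOn (ρ : (Fin n → ℂ) → ℝ) (A : Set (Fin n → ℂ)) : Prop :=
  ∀ C : ℝ, ∃ u : (Fin n → ℂ) → ℝ, ContDiff ℝ ∞ u ∧ (∀ z, 0 ≤ u z ∧ u z ≤ 1) ∧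
    ∀ p ∈ A, ∀ X, IsNull ρ p X → C * ‖X‖ ^ 2 ≤ lev u X p

theorem lev_continuous {f : (Fin n → ℂ) → ℝ} (hf : ContDiff ℝ ∞ f) :
    Continuous fun x : (Fin n → ℂ) × (Fin n → ℂ) => lev f x.2 x.1 := by
  unfold lev
  simp only [levi_eq (r := ofRealSmooth hf) (fun z => rfl)]
  refine Complex.continuous_re.comp (continuous_finsetSum _ fun j _ =>
    continuous_finsetSum _ fun k _ => ?_)
  have h1 := (smC (pz j (pzb k (ofRealSmooth hf)))).continuous
  exact ((h1.comp continuous_fst).mul ((continuous_apply j).comp continuous_snd)).mul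
    (Complex.continuous_conj.comp ((continuous_apply k).comp continuous_snd))

theorem dirDeriv_continuous {f : (Fin n → ℂ) → ℝ} (hf : ContDiff ℝ ∞ f) :
    Continuous fun x : (Fin n → ℂ) × (Fin n → ℂ) => dirDeriv x.2 (cplx f) x.1 := by
  simp only [dirDeriv_eq (r := ofRealSmooth hf) (fun z => rfl)]
  refine continuous_finsetSum _ fun j _ => ?_
  have h1 := (smC (pz j (ofRealSmooth hf))).continuous
  exact ((continuous_apply j).comp continuous_snd).mul (h1.comp continuous_fst)

theorem dsq_continuous {f : (Fin n → ℂ) → ℝ} (hf : ContDiff ℝ ∞ f) :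
    Continuous fun x : (Fin n → ℂ) × (Fin n → ℂ) => dsq f x.2 x.1 :=
  Complex.continuous_normSq.comp (dirDeriv_continuous hf)

theorem lev_smul (f : (Fin n → ℂ) → ℝ) (c : ℝ) (X z : Fin n → ℂ) :
    lev f (c • X) z = c ^ 2 * lev f X z := by
  unfold lev
  rw [show c • X = (c : ℂ) • X from by ext i; simp, levi_smul_left, levi_smul_right, conj_ofReal,
    ← mul_assoc, ← ofReal_mul, re_ofReal_mul, sq]

theorem dsq_smul (f : (Fin n → ℂ) → ℝ) (c : ℝ) (X z : Fin n → ℂ) :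
    dsq f (c • X) z = c ^ 2 * dsq f X z := by
  unfold dsq
  rw [show c • X = (c : ℂ) • X from by ext i; simp, dirDeriv_smul_left, normSq_mul,
    normSq_ofReal, sq]

theorem Bd.lower_uniform {K : Set (Fin n → ℂ)} {r : smoothAlg n} {ρ : (Fin n → ℂ) → ℝ}
    (H : Bd K r ρ) : ∃ c, 0 ≤ c ∧ ∀ p ∈ K, ∀ᶠ z in 𝓝 p, ∀ X,
      -c * (|ρ z| * ‖X‖ ^ 2 + ‖dirDeriv X (cplx ρ) z‖ * ‖X‖) ≤ lev ρ X z := by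
  have mono : ∀ {c c' : ℝ} {z X : Fin n → ℂ}, c ≤ c' →
      -c * (|ρ z| * ‖X‖ ^ 2 + ‖dirDeriv X (cplx ρ) z‖ * ‖X‖) ≤ lev ρ X z →
      -c' * (|ρ z| * ‖X‖ ^ 2 + ‖dirDeriv X (cplx ρ) z‖ * ‖X‖) ≤ lev ρ X z := by
    intro c c' z X h h1
    refine le_trans ?_ h1
    have : 0 ≤ |ρ z| * ‖X‖ ^ 2 + ‖dirDeriv X (cplx ρ) z‖ * ‖X‖ := by positivity
    nlinarith
  have key : ∃ c, 0 ≤ c ∧ ∀ᶠ z in 𝓝ˢ K, ∀ X,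
      -c * (|ρ z| * ‖X‖ ^ 2 + ‖dirDeriv X (cplx ρ) z‖ * ‖X‖) ≤ lev ρ X z := by
    refine H.cpt.induction_on (p := fun s => ∃ c, 0 ≤ c ∧ ∀ᶠ z in 𝓝ˢ s, ∀ X,
      -c * (|ρ z| * ‖X‖ ^ 2 + ‖dirDeriv X (cplx ρ) z‖ * ‖X‖) ≤ lev ρ X z) ?_ ?_ ?_ ?_
    · exact ⟨0, le_rfl, by simp⟩
    · rintro s t hst ⟨c, hc, h⟩
      exact ⟨c, hc, h.filter_mono (nhdsSet_mono hst)⟩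
    · rintro s t ⟨c, hc, h⟩ ⟨c', hc', h'⟩
      refine ⟨max c c', le_max_of_le_left hc, ?_⟩
      rw [nhdsSet_union, Filter.eventually_sup]
      exact ⟨h.mono fun z hz X => mono (le_max_left _ _) (hz X),
        h'.mono fun z hz X => mono (le_max_right _ _) (hz X)⟩
    · intro p hp
      obtain ⟨c, hc⟩ := H.lower p hp
      have h1 : ∀ᶠ z in 𝓝 p, ∀ X,
          -(max c 0) * (|ρ z| * ‖X‖ ^ 2 + ‖dirDeriv X (cplx ρ) z‖ * ‖X‖) ≤ lev ρ X z :=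
        hc.mono fun z hz X => mono (le_max_left _ _) (hz X)
      obtain ⟨t, ht, hto, hpt⟩ := eventually_nhds_iff.1 h1
      refine ⟨t, mem_nhdsWithin_of_mem_nhds (hto.mem_nhds hpt), max c 0, le_max_right _ _, ?_⟩
      rw [hto.nhdsSet_eq]
      exact ht
  obtain ⟨c, hc, h⟩ := key
  exact ⟨c, hc, fun p hp => h.filter_mono (nhds_le_nhdsSet hp)⟩

theorem Bd.eventually_pos {K : Set (Fin n → ℂ)} {r : smoothAlg n} {ρ : (Fin n → ℂ) → ℝ}
    (H : Bd K r ρ) {c k C Λ : ℝ} (hk : 0 < k) (hC : 0 < C)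
    (hlow : ∀ p ∈ K, ∀ᶠ z in 𝓝 p, ∀ X,
      -c * (|ρ z| * ‖X‖ ^ 2 + ‖dirDeriv X (cplx ρ) z‖ * ‖X‖) ≤ lev ρ X z)
    {u : (Fin n → ℂ) → ℝ} (hu : ContDiff ℝ ∞ u) (hu01 : ∀ z, 0 ≤ u z ∧ u z ≤ 1)
    (hΛ : c + c ^ 2 / (4 * k) < Λ / (2 * C)) (hΛ0 : 0 ≤ Λ)
    (huΛ : ∀ p ∈ K, ∀ X, IsNull ρ p X → Λ * ‖X‖ ^ 2 ≤ lev u X p) (p : Fin n → ℂ) (hp : p ∈ K) :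
    ∀ᶠ z in 𝓝 p, 0 < ρ z → ∀ X, X ≠ 0 →
      0 < lev ρ X z / ρ z + k * dsq ρ X z / ρ z ^ 2 + lev u X z / (C * (2 - u z)) := by
  have hρ := smooth_of_eq H.hr
  have cA := lev_continuous hρ
  have cT := dsq_continuous hρ
  have cB : Continuous fun x : (Fin n → ℂ) × (Fin n → ℂ) => lev u x.2 x.1 / (C * (2 - u x.1)) :=
    (lev_continuous hu).div (continuous_const.mul (continuous_const.sub
      (hu.continuous.comp continuous_fst))) fun x => by
        have := (hu01 x.1).2
        exact (mul_pos hC (by linarith)).ne'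
  have cρ : Continuous fun x : (Fin n → ℂ) × (Fin n → ℂ) => ρ x.1 :=
    hρ.continuous.comp continuous_fst
  have hsph : ∀ᶠ z in 𝓝 p, ∀ X ∈ Metric.sphere (0 : Fin n → ℂ) 1, ‖X‖ = 1 → 0 < ρ z →
      0 < lev ρ X z / ρ z + k * dsq ρ X z / ρ z ^ 2 + lev u X z / (C * (2 - u z)) := by
    refine (isCompact_sphere _ _).eventually_forall_of_forall_eventually fun X₀ hX₀ => ?_
    have hX₀' : ‖X₀‖ = 1 := by simpa using hX₀
    rcases (dsq_nonneg ρ X₀ p).lt_or_eq with hT | hT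
    · have hcont : Continuous fun x : (Fin n → ℂ) × (Fin n → ℂ) => lev ρ x.2 x.1 * ρ x.1 +
          k * dsq ρ x.2 x.1 + lev u x.2 x.1 / (C * (2 - u x.1)) * ρ x.1 ^ 2 :=
        ((cA.mul cρ).add (continuous_const.mul cT)).add (cB.mul (cρ.pow 2))
      have := (hcont.tendsto (p, X₀)).eventually_const_lt (u := 0) (by
        simp only [H.zero p hp]; simpa using mul_pos hk hT)
      filter_upwards [this] with x hx _ hpos
      have h1 : lev ρ x.2 x.1 / ρ x.1 + k * dsq ρ x.2 x.1 / ρ x.1 ^ 2 +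
          lev u x.2 x.1 / (C * (2 - u x.1)) = (lev ρ x.2 x.1 * ρ x.1 +
          k * dsq ρ x.2 x.1 + lev u x.2 x.1 / (C * (2 - u x.1)) * ρ x.1 ^ 2) / ρ x.1 ^ 2 := by
        have := hpos.ne'
        rw [add_div, add_div, mul_div_cancel_right₀ _ (pow_ne_zero 2 this)]
        congr 2
        rw [sq, mul_div_mul_right _ _ this]
      rw [h1]
      positivity
    · have hd0 : dirDeriv X₀ (cplx ρ) p = 0 := normSq_eq_zero.1 hT.symm
      have hA0 : 0 ≤ lev ρ X₀ p := H.psc p hp X₀ hd0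
      rcases hA0.lt_or_eq with hA | hA
      · have hcont : Continuous fun x : (Fin n → ℂ) × (Fin n → ℂ) => lev ρ x.2 x.1 +
          lev u x.2 x.1 / (C * (2 - u x.1)) * ρ x.1 := cA.add (cB.mul cρ)
        have := (hcont.tendsto (p, X₀)).eventually_const_lt (u := 0) (by
          simp only [H.zero p hp]; simpa using hA)
        filter_upwards [this] with x hx _ hpos
        have h1 : lev ρ x.2 x.1 / ρ x.1 + k * dsq ρ x.2 x.1 / ρ x.1 ^ 2 +
          lev u x.2 x.1 / (C * (2 - u x.1)) = (lev ρ x.2 x.1 +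
            lev u x.2 x.1 / (C * (2 - u x.1)) * ρ x.1) / ρ x.1 +
              k * dsq ρ x.2 x.1 / ρ x.1 ^ 2 := by
          rw [add_div, mul_div_cancel_right₀ _ hpos.ne']; ring
        rw [h1]
        have := dsq_nonneg ρ x.2 x.1
        positivity
      · have hnull : IsNull ρ p X₀ := ⟨hd0, hA.symm⟩
        have h2 := huΛ p hp X₀ hnull
        rw [hX₀', one_pow, mul_one] at h2
        have h3 : c + c ^ 2 / (4 * k) < lev u X₀ p / (C * (2 - u p)) := by
          refine hΛ.trans_le ?_
          have hup := hu01 p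
          calc Λ / (2 * C) ≤ Λ / (C * (2 - u p)) := by
                refine div_le_div_of_nonneg_left hΛ0 (mul_pos hC (by linarith)) ?_
                nlinarith
            _ ≤ _ := by
                refine div_le_div_of_nonneg_right h2 (mul_pos hC (by linarith)).le
        have h4 := (cB.tendsto (p, X₀)).eventually_const_lt h3
        have h5 : ∀ᶠ x : (Fin n → ℂ) × (Fin n → ℂ) in 𝓝 (p, X₀), ∀ X,
            -c * (|ρ x.1| * ‖X‖ ^ 2 + ‖dirDeriv X (cplx ρ) x.1‖ * ‖X‖) ≤ lev ρ X x.1 :=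
          (continuous_fst.tendsto (p, X₀)).eventually (hlow p hp)
        filter_upwards [h4, h5] with x hx4 hx5 hx1 hpos
        have h6 := hx5 x.2
        rw [hx1, abs_of_pos hpos, one_pow, mul_one, mul_one] at h6
        have h7 : dsq ρ x.2 x.1 = ‖dirDeriv x.2 (cplx ρ) x.1‖ ^ 2 := Complex.normSq_eq_norm_sq _
        rw [h7]
        generalize ‖dirDeriv x.2 (cplx ρ) x.1‖ = d at *
        have h8 : -c - c * (d / ρ x.1) ≤ lev ρ x.2 x.1 / ρ x.1 := by
          rw [le_div_iff₀ hpos]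
          refine le_trans (le_of_eq ?_) h6
          field_simp
          ring
        have h9 : -(c ^ 2 / (4 * k)) ≤ k * (d / ρ x.1) ^ 2 - c * (d / ρ x.1) := by
          have : k * (d / ρ x.1) ^ 2 - c * (d / ρ x.1) + c ^ 2 / (4 * k) =
              (2 * k * (d / ρ x.1) - c) ^ 2 / (4 * k) := by
            field_simp; ring
          have h10 : 0 ≤ (2 * k * (d / ρ x.1) - c) ^ 2 / (4 * k) := by positivity
          linarith
        have h11 : k * d ^ 2 / ρ x.1 ^ 2 = k * (d / ρ x.1) ^ 2 := by rw [div_pow, mul_div_assoc]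
        rw [h11]
        linarith
  filter_upwards [hsph] with z hz hpos X hX
  have hn : 0 < ‖X‖ := norm_pos_iff.2 hX
  have h1 := hz (‖X‖⁻¹ • X) (by simp [norm_smul, hn.ne'])
    (by simp [norm_smul, hn.ne']) hpos
  rw [lev_smul, lev_smul, dsq_smul] at h1
  have h2 : ‖X‖⁻¹ ^ 2 * lev ρ X z / ρ z + k * (‖X‖⁻¹ ^ 2 * dsq ρ X z) / ρ z ^ 2 +
      ‖X‖⁻¹ ^ 2 * lev u X z / (C * (2 - u z)) = ‖X‖⁻¹ ^ 2 *
      (lev ρ X z / ρ z + k * dsq ρ X z / ρ z ^ 2 + lev u X z / (C * (2 - u z))) := by ring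
  rw [h2] at h1
  exact pos_of_mul_pos_right h1 (by positivity)

end

section

variable {n : ℕ}

/-- The weight `-C⁻¹ log (2 - t)`. -/
def logWeight (C : ℝ) (t : ℝ) : ℝ := -(C⁻¹ * Real.log (2 - t))

theorem deriv_logWeight (C : ℝ) : deriv (logWeight C) = fun t => C⁻¹ * (2 - t)⁻¹ := by
  funext t
  unfold logWeight
  rw [deriv.fun_neg, deriv_const_mul_field, deriv_comp_const_sub, Real.deriv_log]
  ring

theorem deriv_deriv_logWeight (C : ℝ) {t : ℝ} (ht : t ≤ 1) :
    deriv (deriv (logWeight C)) t = C⁻¹ * ((2 - t)⁻¹) ^ 2 := by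
  rw [deriv_logWeight, deriv_const_mul_field, deriv_comp_const_sub, deriv_inv]
  have : 2 - t ≠ 0 := by linarith
  field_simp

theorem logWeight_contDiffAt (C : ℝ) {t : ℝ} (ht : t ≤ 1) {m : WithTop ℕ∞} :
    ContDiffAt ℝ m (logWeight C) t := by
  have : 2 - t ≠ 0 := by linarith
  exact (contDiffAt_const.mul ((contDiffAt_const.sub contDiffAt_id).log this)).neg

theorem lev_rpow_pos {ρ u : (Fin n → ℂ) → ℝ} (hρ : ContDiff ℝ ∞ ρ) (hu : ContDiff ℝ ∞ u)
    (hu1 : ∀ z, u z ≤ 1) {η : ℝ} (hη : 1 < η) {z X : Fin n → ℂ} (hz : 0 < ρ z)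
    (hpos : 0 < lev ρ X z / ρ z + (η - 1) / 2 * dsq ρ X z / ρ z ^ 2 +
      lev u X z / (2 * η ^ 2 / (η - 1) * (2 - u z))) :
    0 < lev (fun w => (ρ w * Real.exp (logWeight (2 * η ^ 2 / (η - 1)) (u w))) ^ η) X z := by
  set C := 2 * η ^ 2 / (η - 1) with hC
  have hη1 : 0 < η - 1 := by linarith
  have hC0 : 0 < C := by positivity
  have hρ2 : ContDiffAt ℝ 2 ρ z := (hρ.of_le two_le_infty).contDiffAt
  have hu2 : ContDiffAt ℝ 2 u z := (hu.of_le two_le_infty).contDiffAt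
  have hW : ContDiffAt ℝ 2 (logWeight C) (u z) := logWeight_contDiffAt C (hu1 z)
  have hL : ContDiffAt ℝ 2 Real.log (ρ z) := Real.contDiffAt_log.2 hz.ne'
  have hu0 : 0 < 2 - u z := by linarith [hu1 z]
  have heq : (fun w => (ρ w * Real.exp (logWeight C (u w))) ^ η) =ᶠ[𝓝 z]
      fun w => Real.exp (η * (Real.log (ρ w) + logWeight C (u w))) := by
    filter_upwards [hρ.continuous.continuousAt.eventually_const_lt hz] with w hw
    rw [Real.rpow_def_of_pos (by positivity), Real.log_mul hw.ne' (Real.exp_pos _).ne',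
      Real.log_exp, mul_comm]
  have hlu : ContDiffAt ℝ 2 (fun w => logWeight C (u w)) z := hW.comp z hu2
  have hlρ : ContDiffAt ℝ 2 (fun w => Real.log (ρ w)) z := hL.comp z hρ2
  have hg : ContDiffAt ℝ 2 (fun w => Real.log (ρ w) + logWeight C (u w)) z := hlρ.add hlu
  have hφ : ∀ t, ContDiffAt ℝ 2 (fun t : ℝ => Real.exp (η * t)) t := fun t =>
    (Real.contDiff_exp.comp (contDiff_const.mul contDiff_id)).contDiffAt
  have hd : deriv (fun t : ℝ => Real.exp (η * t)) = fun t => η * Real.exp (η * t) := by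
    funext t
    have := ((hasDerivAt_id t).const_mul η).exp.deriv
    simpa [mul_comm] using this
  have hdd : ∀ t, deriv (deriv (fun t : ℝ => Real.exp (η * t))) t = η ^ 2 * Real.exp (η * t) := by
    intro t
    rw [hd, deriv_const_mul_field, hd]; ring
  have e1 : lev (fun w => (ρ w * Real.exp (logWeight C (u w))) ^ η) X z =
      lev (fun w => Real.exp (η * (Real.log (ρ w) + logWeight C (u w)))) X z := by
    unfold lev; rw [levi_congr heq]
  rw [e1, lev_comp (φ := fun t => Real.exp (η * t)) hg (hφ _), hdd, hd]
  have two_ne : (2 : WithTop ℕ∞) ≠ 0 := by norm_num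
  have e2 : dsq (fun w => Real.log (ρ w) + logWeight C (u w)) X z =
      normSq (((ρ z)⁻¹ : ℝ) * dirDeriv X (cplx ρ) z +
        ((C⁻¹ * (2 - u z)⁻¹ : ℝ) : ℂ) * dirDeriv X (cplx u) z) := by
    unfold dsq
    rw [dirDeriv_add (hlρ.differentiableAt two_ne) (hlu.differentiableAt two_ne),
      dirDeriv_comp (hρ2.differentiableAt two_ne) (hL.differentiableAt two_ne),
      dirDeriv_comp (hu2.differentiableAt two_ne) (hW.differentiableAt two_ne),
      deriv_logWeight, Real.deriv_log]
  have e3 : lev (fun w => Real.log (ρ w) + logWeight C (u w)) X z =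
      (ρ z)⁻¹ * lev ρ X z - normSq (((ρ z)⁻¹ : ℝ) * dirDeriv X (cplx ρ) z) +
      (C⁻¹ * (2 - u z)⁻¹ * lev u X z +
        C * normSq (((C⁻¹ * (2 - u z)⁻¹ : ℝ) : ℂ) * dirDeriv X (cplx u) z)) := by
    rw [lev_add hlρ hlu, lev_comp hρ2 hL, lev_comp hu2 hW, deriv_deriv_logWeight C (hu1 z),
      deriv_logWeight, Real.deriv_log, Real.deriv_log', deriv_inv, normSq_mul, normSq_mul,
      normSq_ofReal, normSq_ofReal]
    unfold dsq
    field_simp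
    ring
  rw [e2, e3]
  have e4 : dsq ρ X z / ρ z ^ 2 = normSq (((ρ z)⁻¹ : ℝ) * dirDeriv X (cplx ρ) z) := by
    rw [normSq_mul, normSq_ofReal]; unfold dsq; field_simp
  rw [mul_div_assoc, e4] at hpos
  have e5 : lev u X z / (C * (2 - u z)) = C⁻¹ * (2 - u z)⁻¹ * lev u X z := by
    rw [div_eq_mul_inv, mul_inv]; ring
  rw [e5, div_eq_inv_mul] at hpos
  generalize ((ρ z)⁻¹ : ℝ) * dirDeriv X (cplx ρ) z = a at *
  generalize ((C⁻¹ * (2 - u z)⁻¹ : ℝ) : ℂ) * dirDeriv X (cplx u) z = b at *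
  have key : (1 + (η - 1) / 2) * normSq a - C * normSq b ≤ η * normSq (a + b) := by
    have hab : ∀ x y : ℝ, (1 + (η - 1) / 2) * x ^ 2 - C * y ^ 2 ≤ η * (x + y) ^ 2 := by
      intro x y
      have : η * (x + y) ^ 2 - ((1 + (η - 1) / 2) * x ^ 2 - C * y ^ 2) =
          ((η - 1) * x + 2 * η * y) ^ 2 / (2 * (η - 1)) + η * y ^ 2 := by
        rw [hC]; field_simp; ring
      have h2 : 0 ≤ ((η - 1) * x + 2 * η * y) ^ 2 / (2 * (η - 1)) + η * y ^ 2 := by positivity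
      linarith
    rw [normSq_apply, normSq_apply, normSq_apply, add_re, add_im]
    nlinarith [hab a.re b.re, hab a.im b.im]
  have hfin : 0 < η * Real.exp (η * (Real.log (ρ z) + logWeight C (u z))) *
      ((ρ z)⁻¹ * lev ρ X z - normSq a + (C⁻¹ * (2 - u z)⁻¹ * lev u X z + C * normSq b) +
        η * normSq (a + b)) := by
    refine mul_pos (mul_pos (by linarith) (Real.exp_pos _)) ?_
    linarith
  refine hfin.trans_eq ?_
  ring

theorem steinIndex_eq_one_of_goodOn {Ω V : Set (Fin n → ℂ)} {ρ ρ' : (Fin n → ℂ) → ℝ}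
    {r : smoothAlg n} (hdef : IsDefFn Ω V ρ) (H : Bd (frontier Ω) r ρ')
    (hρ' : ∀ p ∈ frontier Ω, ρ' =ᶠ[𝓝 p] ρ) (hg : GoodOn ρ' (frontier Ω)) :
    steinIndex Ω = 1 := by
  have hs := smooth_of_eq H.hr
  refine le_antisymm ?_ ?_
  · have key : ∀ η : ℝ, 1 < η → steinIndex Ω ≤ ENNReal.ofReal η := by
      intro η hη
      have hη1 : 0 < η - 1 := by linarith
      obtain ⟨c, hc, hlow⟩ := H.lower_uniform
      set C := 2 * η ^ 2 / (η - 1) with hC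
      have hC0 : 0 < C := by positivity
      set k := (η - 1) / 2 with hk
      have hk0 : 0 < k := by positivity
      obtain ⟨u, hu, hu01, huΛ⟩ := hg (2 * C * (c + c ^ 2 / (4 * k) + 1))
      have hpos := H.eventually_pos hk0 hC0 hlow hu hu01 (Λ := 2 * C * (c + c ^ 2 / (4 * k) + 1))
        (by rw [mul_div_cancel_left₀ _ (by positivity)]; linarith) (by positivity) huΛ
      set R : (Fin n → ℂ) → ℝ := fun w => ρ w * Real.exp (logWeight C (u w)) with hR
      have hE : ContDiff ℝ ∞ fun w => Real.exp (logWeight C (u w)) :=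
        contDiff_iff_contDiffAt.2 fun w => Real.contDiff_exp.contDiffAt.comp w
          ((logWeight_contDiffAt C (hu01 w).2).comp w hu.contDiffAt)
      have hRdef : IsDefFn Ω V R := by
        refine ⟨hdef.isOpen, hdef.subset, hdef.smooth.mul hE.contDiffOn, ?_, ?_⟩
        · rw [hdef.eq]
          ext z
          simp only [Set.mem_ofPred_eq, hR]
          rw [mul_neg_iff]
          have := Real.exp_pos (logWeight C (u z))
          constructor
          · rintro ⟨h1, h2⟩; exact ⟨h1, Or.inr ⟨h2, this⟩⟩
          · rintro ⟨h1, h2 | h2⟩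
            · linarith [h2.2]
            · exact ⟨h1, h2.1⟩
        · intro z hz h0
          have h1 : DifferentiableAt ℝ ρ z :=
            (hs.differentiable (by simp) z).congr_of_eventuallyEq (hρ' z hz).symm
          have hz0 : ρ z = 0 := by rw [← (hρ' z hz).eq_of_nhds]; exact H.zero z hz
          rw [hR, fderiv_fun_mul h1 (hE.differentiable (by simp) z), hz0, zero_smul, zero_add] at h0
          exact hdef.grad_ne z hz ((smul_eq_zero.1 h0).resolve_left (Real.exp_pos _).ne')
      have hmem : η ∈ steinExpSet Ω R := by
        refine ⟨hη, ?_⟩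
        have hW : ∀ p ∈ frontier Ω, ∀ᶠ z in 𝓝 p, z ∈ (closure Ω)ᶜ → ∀ X, X ≠ 0 →
            0 < lev (fun w => R w ^ η) X z := by
          intro p hp
          filter_upwards [hpos p hp, (hρ' p hp).eventually_nhds, H.loc p hp,
            hdef.isOpen.mem_nhds (hdef.subset hp.1)] with z h1 h2 h3 h4 hz X hX
          have h2' : ρ' z = ρ z :=
            Filter.EventuallyEq.eq_of_nhds (f := ρ') (g := ρ) h2
          have hρz : 0 < ρ' z := by
            rw [h2'] at h3 ⊢
            rcases lt_trichotomy (ρ z) 0 with h | h | h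
            · exact absurd (subset_closure (by rw [hdef.eq]; exact ⟨h4, h⟩)) hz
            · exact absurd (h3 h).1 hz
            · exact h
          have := lev_rpow_pos hs hu (fun z => (hu01 z).2) hη hρz (h1 hρz X hX)
          refine this.trans_eq ?_
          unfold lev
          rw [levi_congr (g := fun w => R w ^ η)]
          filter_upwards [h2] with w hw
          rw [hw]
        refine ⟨{z | ∀ᶠ w in 𝓝 z, w ∈ (closure Ω)ᶜ → ∀ X, X ≠ 0 →
          0 < lev (fun w => R w ^ η) X w}, isOpen_setOfPred_eventually_nhds, hW, ?_⟩
        rintro z ⟨hz, hz2⟩ X hX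
        exact (Filter.Eventually.self_of_nhds hz2) hz X hX
      calc steinIndex Ω ≤ steinExp Ω R :=
            iInf_le_of_le V (iInf_le_of_le R (iInf_le_of_le hRdef le_rfl))
        _ ≤ _ := sInf_le ⟨η, hmem, rfl⟩
    refine ENNReal.le_of_forall_pos_le_add fun ε hε _ => ?_
    refine (key (1 + ε) (by simpa using hε)).trans (le_of_eq ?_)
    have := ENNReal.ofReal_add zero_le_one ε.2
    simpa using this
  · refine le_iInf fun V => le_iInf fun R => le_iInf fun _ => le_sInf ?_
    rintro _ ⟨η, hη, rfl⟩
    exact ENNReal.one_le_ofReal.2 hη.1.le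

end

section

variable {n : ℕ}

theorem exists_cutoff {s t : Set (Fin n → ℂ)} (hs : IsClosed s) (ht : IsClosed t)
    (hd : Disjoint s t) : ∃ χ : (Fin n → ℂ) → ℝ, ContDiff ℝ ∞ χ ∧ (∀ᶠ x in 𝓝ˢ s, χ x = 0) ∧
      (∀ᶠ x in 𝓝ˢ t, χ x = 1) ∧ ∀ x, 0 ≤ χ x ∧ χ x ≤ 1 := by
  obtain ⟨f, h0, h1, h⟩ := exists_contMDiffMap_zero_one_nhds_of_isClosed
    (modelWithCornersSelf ℝ (Fin n → ℂ)) (n := (⊤ : ℕ∞)) hs ht hd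
  exact ⟨f, f.contMDiff.contDiff, h0, h1, h⟩

theorem IsNull.smul {ρ : (Fin n → ℂ) → ℝ} {p X : Fin n → ℂ} (h : IsNull ρ p X) (c : ℝ) :
    IsNull ρ p (c • X) := by
  refine ⟨?_, by rw [lev_smul, h.2, mul_zero]⟩
  rw [show c • X = (c : ℂ) • X from by ext i; simp, dirDeriv_smul_left, h.1, mul_zero]

theorem isClosed_isNull {ρ : (Fin n → ℂ) → ℝ} (hρ : ContDiff ℝ ∞ ρ) :
    IsClosed {x : (Fin n → ℂ) × (Fin n → ℂ) | IsNull ρ x.1 x.2} :=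
  (isClosed_eq (dirDeriv_continuous hρ) continuous_const).inter
    (isClosed_eq (lev_continuous hρ) continuous_const)

theorem le_of_forall_sphere {Q : (Fin n → ℂ) → ℝ} (hQ : ∀ (c : ℝ) X, Q (c • X) = c ^ 2 * Q X)
    {m : ℝ} {P : (Fin n → ℂ) → Prop} (hP : ∀ (c : ℝ) X, P X → P (c • X))
    (h : ∀ X, ‖X‖ = 1 → P X → m ≤ Q X) (X : Fin n → ℂ) (hX : P X) : m * ‖X‖ ^ 2 ≤ Q X := by
  rcases eq_or_ne X 0 with rfl | h0
  · have := hQ 0 0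
    simp only [smul_zero, ne_eq, OfNat.ofNat_ne_zero, not_false_eq_true, zero_pow, zero_mul] at this
    simp [this]
  · have hn : 0 < ‖X‖ := norm_pos_iff.2 h0
    have h1 := h (‖X‖⁻¹ • X) (by simp [norm_smul, hn.ne']) (hP _ _ hX)
    rw [hQ] at h1
    have h2 := mul_le_mul_of_nonneg_left h1 (sq_nonneg ‖X‖)
    rw [← mul_assoc, ← mul_pow, mul_inv_cancel₀ hn.ne', one_pow, one_mul] at h2
    linarith

theorem exists_lev_lower_bound {f : (Fin n → ℂ) → ℝ} (hf : ContDiff ℝ ∞ f)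
    {B : Set (Fin n → ℂ)} (hB : IsCompact B) :
    ∃ M, 0 ≤ M ∧ ∀ p ∈ B, ∀ X, -M * ‖X‖ ^ 2 ≤ lev f X p ∧ dsq f X p ≤ M * ‖X‖ ^ 2 := by
  have hc := hB.prod (isCompact_sphere (0 : Fin n → ℂ) 1)
  obtain ⟨M1, h1⟩ := hc.exists_bound_of_continuousOn (lev_continuous hf).continuousOn
  obtain ⟨M2, h2⟩ := hc.exists_bound_of_continuousOn (dsq_continuous hf).continuousOn
  refine ⟨max 0 (max M1 M2), le_max_left _ _, fun p hp X => ⟨?_, ?_⟩⟩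
  · refine le_of_forall_sphere (P := fun _ => True) (Q := fun X => lev f X p)
      (fun c X => lev_smul f c X p)
      (fun _ _ _ => trivial) (fun X hX _ => ?_) X trivial
    have := h1 (p, X) ⟨hp, by simpa using hX⟩
    have h3 := (abs_le.1 ((Real.norm_eq_abs _) ▸ this)).1
    have : M1 ≤ max 0 (max M1 M2) := le_max_of_le_right (le_max_left _ _)
    simp only at h3
    linarith
  · have := le_of_forall_sphere (P := fun _ => True) (Q := fun X => -dsq f X p)
      (m := -(max 0 (max M1 M2))) (fun c X => by rw [dsq_smul]; ring)
      (fun _ _ _ => trivial) (fun X hX _ => ?_) X trivial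
    · linarith
    have := h2 (p, X) ⟨hp, by simpa using hX⟩
    have h3 := (abs_le.1 ((Real.norm_eq_abs _) ▸ this)).2
    have : M2 ≤ max 0 (max M1 M2) := le_max_of_le_right (le_max_right _ _)
    simp only at h3
    linarith

theorem eventually_lev_ge {ρ u : (Fin n → ℂ) → ℝ} (hρ : ContDiff ℝ ∞ ρ) (hu : ContDiff ℝ ∞ u)
    {A : Set (Fin n → ℂ)} {C : ℝ} (h : ∀ p ∈ A, ∀ X, IsNull ρ p X → C * ‖X‖ ^ 2 ≤ lev u X p) :
    ∀ᶠ z in 𝓝ˢ A, ∀ X, IsNull ρ z X → (C - 1) * ‖X‖ ^ 2 ≤ lev u X z := by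
  rw [eventually_nhdsSet_iff_forall]
  intro p hp
  have hsph : ∀ᶠ z in 𝓝 p, ∀ X ∈ Metric.sphere (0 : Fin n → ℂ) 1, IsNull ρ z X →
      C - 1 ≤ lev u X z := by
    refine (isCompact_sphere _ _).eventually_forall_of_forall_eventually fun X₀ hX₀ => ?_
    by_cases hn : IsNull ρ p X₀
    · have h1 := h p hp X₀ hn
      rw [show ‖X₀‖ = 1 by simpa using hX₀, one_pow, mul_one] at h1
      have h2 : C - 1 < lev u X₀ p := by linarith
      filter_upwards [((lev_continuous hu).tendsto (p, X₀)).eventually_const_lt h2] with x hx _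
      exact hx.le
    · filter_upwards [(isClosed_isNull hρ).isOpen_compl.mem_nhds
        (show (p, X₀) ∈ {x : (Fin n → ℂ) × (Fin n → ℂ) | IsNull ρ x.1 x.2}ᶜ from hn)] with x hx hx'
      exact absurd hx' hx
  filter_upwards [hsph] with z hz X hX
  exact le_of_forall_sphere (Q := fun X => lev u X z) (P := fun X => IsNull ρ z X)
    (fun c X => lev_smul u c X z) (fun c X h => IsNull.smul h c)
    (fun X hX hN => hz X (by simpa using hX) hN) X hX

theorem lev_cutoff_ge {χ u : (Fin n → ℂ) → ℝ} (hχ : ContDiff ℝ ∞ χ) (hu : ContDiff ℝ ∞ u)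
    (X z : Fin n → ℂ) :
    Real.exp (u z) * (χ z ^ 2 * lev u X z + 2 * χ z * lev χ X z - 2 * dsq χ X z) ≤
      lev (fun w => χ w * χ w * Real.exp (u w)) X z := by
  have hχ2 : ContDiffAt ℝ 2 χ z := (hχ.of_le two_le_infty).contDiffAt
  have hu2 : ContDiffAt ℝ 2 u z := (hu.of_le two_le_infty).contDiffAt
  have hE : ContDiffAt ℝ 2 (fun w => Real.exp (u w)) z := Real.contDiff_exp.contDiffAt.comp z hu2
  have hcc : ContDiffAt ℝ 2 (fun w => χ w * χ w) z := hχ2.mul hχ2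
  have two_ne : (2 : WithTop ℕ∞) ≠ 0 := by norm_num
  rw [lev_mul hcc hE, lev_mul hχ2 hχ2, lev_comp hu2 Real.contDiff_exp.contDiffAt,
    dirDeriv_mul (hχ2.differentiableAt two_ne) (hχ2.differentiableAt two_ne),
    dirDeriv_comp (hu2.differentiableAt two_ne) Real.differentiable_exp.differentiableAt,
    Real.deriv_exp, Real.deriv_exp]
  unfold dsq
  generalize dirDeriv X (cplx χ) z = a
  generalize dirDeriv X (cplx u) z = b
  have h1 : (a * (starRingEnd ℂ) a).re = normSq a := by rw [mul_conj, ofReal_re]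
  have h2 : ((χ z * a + χ z * a) * (starRingEnd ℂ) ((Real.exp (u z) : ℝ) * b)).re =
      Real.exp (u z) * (2 * χ z * (a.re * b.re + a.im * b.im)) := by
    simp only [mul_re, add_re, add_im, mul_im, ofReal_re, ofReal_im, conj_re, conj_im]
    ring
  rw [h1, h2, normSq_apply, normSq_apply]
  have h3 : 0 ≤ Real.exp (u z) * ((χ z * b.re + 2 * a.re) ^ 2 + (χ z * b.im + 2 * a.im) ^ 2) := by
    positivity
  nlinarith [h3]

theorem GoodOn.mono {ρ : (Fin n → ℂ) → ℝ} {A B : Set (Fin n → ℂ)} (h : GoodOn ρ B) (hAB : A ⊆ B) :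
    GoodOn ρ A := fun C => by
  obtain ⟨u, h1, h2, h3⟩ := h C
  exact ⟨u, h1, h2, fun p hp => h3 p (hAB hp)⟩

theorem GoodOn.empty {ρ : (Fin n → ℂ) → ℝ} : GoodOn ρ (∅ : Set (Fin n → ℂ)) := fun _ =>
  ⟨fun _ => 0, contDiff_const, fun _ => ⟨le_rfl, zero_le_one⟩, fun _ h => h.elim⟩

theorem GoodOn.glue {ρ : (Fin n → ℂ) → ℝ} (hρ : ContDiff ℝ ∞ ρ) {A B : Set (Fin n → ℂ)}
    (hA : IsCompact A) (hB : IsCompact B) (hgA : GoodOn ρ A)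
    (hg : ∀ D ⊆ B, IsCompact D → Disjoint D A → GoodOn ρ D) : GoodOn ρ B := by
  suffices H : ∀ C : ℝ, 0 ≤ C → ∃ u : (Fin n → ℂ) → ℝ, ContDiff ℝ ∞ u ∧
      (∀ z, 0 ≤ u z ∧ u z ≤ 1) ∧ ∀ p ∈ B, ∀ X, IsNull ρ p X → C * ‖X‖ ^ 2 ≤ lev u X p by
    intro C
    obtain ⟨u, h1, h2, h3⟩ := H |C| (abs_nonneg C)
    exact ⟨u, h1, h2, fun p hp X hX => le_trans
      (mul_le_mul_of_nonneg_right (le_abs_self C) (sq_nonneg _)) (h3 p hp X hX)⟩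
  intro C hC
  obtain ⟨u₁, hu₁, hu₁01, hu₁C⟩ := hgA (2 * C + 2)
  obtain ⟨U, hUo, hAU, hU⟩ := eventually_nhdsSet_iff_exists.1 (eventually_lev_ge hρ hu₁ hu₁C)
  obtain ⟨χ, hχ, hχ0, hχ1, hχ01⟩ := exists_cutoff hA.isClosed hUo.isClosed_compl
    (Set.disjoint_compl_right_iff_subset.2 hAU)
  obtain ⟨M, hM, hMu⟩ := exists_lev_lower_bound hu₁ hB
  obtain ⟨N, hN, hNχ⟩ := exists_lev_lower_bound hχ hB
  have hD : IsCompact (B ∩ tsupport χ) := hB.inter_right (isClosed_tsupport χ)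
  have hDA : Disjoint (B ∩ tsupport χ) A := by
    rw [Set.disjoint_left]
    rintro p ⟨-, hp⟩ hpA
    exact (notMem_tsupport_iff_eventuallyEq.2
      ((eventually_nhdsSet_iff_forall.1 hχ0) p hpA)) hp
  set ε : ℝ := (3 * (4 * N + 1))⁻¹ with hε
  have hε0 : 0 < ε := by positivity
  obtain ⟨u₂, hu₂, hu₂01, hu₂C⟩ := hg _ Set.inter_subset_left hD hDA ((2 * C + M + 1) / ε)
  have hC2 : 0 ≤ (2 * C + M + 1) / ε := by positivity
  have e3 : Real.exp 1 ≤ 3 := Real.exp_one_lt_d9.le.trans (by norm_num)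
  have hεN : ε * (3 * (4 * N)) ≤ 1 := by
    rw [hε, inv_mul_le_iff₀ (by positivity)]; linarith
  have hε3 : ε * 3 ≤ 1 := by
    rw [hε, inv_mul_le_iff₀ (by positivity)]; linarith
  have hv : ContDiff ℝ ∞ fun w => χ w * χ w * Real.exp (u₂ w) :=
    (hχ.mul hχ).mul (Real.contDiff_exp.comp hu₂)
  have hexp : ∀ z, 1 ≤ Real.exp (u₂ z) ∧ Real.exp (u₂ z) ≤ 3 := fun z =>
    ⟨Real.one_le_exp (hu₂01 z).1, (Real.exp_le_exp.2 (hu₂01 z).2).trans e3⟩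
  have hlow : ∀ p ∈ B, ∀ X, IsNull ρ p X →
      χ p ^ 2 * ((2 * C + M + 1) * ‖X‖ ^ 2) - ‖X‖ ^ 2 ≤
        ε * lev (fun w => χ w * χ w * Real.exp (u₂ w)) X p := by
    intro p hp X hX
    have h1 := lev_cutoff_ge hχ hu₂ X p
    obtain ⟨h2, h3⟩ := hNχ p hp X
    have h4 := hχ01 p
    have h5 := hexp p
    have h6 : χ p ^ 2 * ((2 * C + M + 1) / ε * ‖X‖ ^ 2) ≤ χ p ^ 2 * lev u₂ X p := by
      by_cases hpt : p ∈ tsupport χ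
      · exact mul_le_mul_of_nonneg_left (hu₂C p ⟨hp, hpt⟩ X hX) (sq_nonneg _)
      · rw [image_eq_zero_of_notMem_tsupport hpt]; simp
    have h7 : -(4 * N) * ‖X‖ ^ 2 ≤ 2 * χ p * lev χ X p - 2 * dsq χ X p := by
      have : -(N * ‖X‖ ^ 2) ≤ χ p * lev χ X p := by
        have h8 : 0 ≤ N * ‖X‖ ^ 2 := by positivity
        nlinarith [mul_le_mul_of_nonneg_left h2 h4.1, mul_nonneg h8 (sub_nonneg.2 h4.2)]
      linarith
    have h8 : χ p ^ 2 * ((2 * C + M + 1) / ε * ‖X‖ ^ 2) - 3 * (4 * N * ‖X‖ ^ 2) ≤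
        lev (fun w => χ w * χ w * Real.exp (u₂ w)) X p := by
      refine le_trans ?_ h1
      have h9 : 0 ≤ χ p ^ 2 * ((2 * C + M + 1) / ε * ‖X‖ ^ 2) := by positivity
      have h10 : 0 ≤ 4 * N * ‖X‖ ^ 2 := by positivity
      have h11 : χ p ^ 2 * ((2 * C + M + 1) / ε * ‖X‖ ^ 2) - 4 * N * ‖X‖ ^ 2 ≤
        χ p ^ 2 * lev u₂ X p + 2 * χ p * lev χ X p - 2 * dsq χ X p := by linarith
      refine le_trans ?_ (mul_le_mul_of_nonneg_left h11 (Real.exp_pos _).le)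
      nlinarith [mul_le_mul_of_nonneg_right h5.1 h9, mul_le_mul_of_nonneg_right h5.2 h10]
    refine le_trans ?_ (mul_le_mul_of_nonneg_left h8 hε0.le)
    have h12 : ε * (χ p ^ 2 * ((2 * C + M + 1) / ε * ‖X‖ ^ 2)) =
        χ p ^ 2 * ((2 * C + M + 1) * ‖X‖ ^ 2) := by
      field_simp
    rw [mul_sub, h12]
    nlinarith [mul_le_mul_of_nonneg_right hεN (sq_nonneg ‖X‖)]
  refine ⟨fun z => 2⁻¹ * (u₁ z + ε * (χ z * χ z * Real.exp (u₂ z))),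
    contDiff_const.mul (hu₁.add (contDiff_const.mul hv)), fun z => ⟨?_, ?_⟩, fun p hp X hX => ?_⟩
  · have := hu₁01 z
    have := hχ01 z
    have := this.1
    have h0 : 0 ≤ u₁ z := (hu₁01 z).1
    positivity
  · have h1 := (hu₁01 z).2
    have h2 := hχ01 z
    have h3 := hexp z
    have h4 : χ z * χ z * Real.exp (u₂ z) ≤ 3 := by
      have : χ z * χ z ≤ 1 := by nlinarith
      nlinarith
    nlinarith [mul_le_mul_of_nonneg_left h4 hε0.le]
  · have c1 : ContDiffAt ℝ 2 u₁ p := (hu₁.of_le two_le_infty).contDiffAt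
    have c2 := (hv.of_le two_le_infty).contDiffAt (x := p)
    have c3 : ContDiffAt ℝ 2 (fun z => ε * (χ z * χ z * Real.exp (u₂ z))) p :=
      contDiffAt_const.mul c2
    rw [lev_const_mul _ (c1.add c3), lev_add c1 c3, lev_const_mul _ c2]
    have h1 := hlow p hp X hX
    by_cases hpU : p ∈ U
    · have h2 := hU p hpU X hX
      have h3 : 0 ≤ χ p ^ 2 * ((2 * C + M + 1) * ‖X‖ ^ 2) := by positivity
      nlinarith
    · have h2 : χ p = 1 := (eventually_nhdsSet_iff_forall.1 hχ1 p hpU).self_of_nhds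
      have h3 := (hMu p hp X).1
      rw [h2] at h1
      nlinarith

theorem GoodOn.union {ρ : (Fin n → ℂ) → ℝ} (hρ : ContDiff ℝ ∞ ρ) {A B : Set (Fin n → ℂ)}
    (hA : IsCompact A) (hB : IsCompact B) (hgA : GoodOn ρ A) (hgB : GoodOn ρ B) :
    GoodOn ρ (A ∪ B) :=
  GoodOn.glue hρ hA (hA.union hB) hgA fun _ hD _ hDA => hgB.mono fun _ hp =>
    (hD hp).resolve_left (Set.disjoint_left.1 hDA hp)

theorem GoodOn.of_functions {ρ : (Fin n → ℂ) → ℝ} (hρ : ContDiff ℝ ∞ ρ) {A : Set (Fin n → ℂ)}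
    (hA : IsCompact A) (h : ∀ p ∈ A, ∀ X, X ≠ 0 → IsNull ρ p X →
      ∃ f : (Fin n → ℂ) → ℝ, ContDiff ℝ ∞ f ∧ (∀ z ∈ A, f z = 0) ∧ dirDeriv X (cplx f) p ≠ 0) :
    GoodOn ρ A := by
  have two_ne : (2 : WithTop ℕ∞) ≠ 0 := by norm_num
  set N : Set ((Fin n → ℂ) × (Fin n → ℂ)) :=
    (A ×ˢ Metric.sphere 0 1) ∩ {x | IsNull ρ x.1 x.2} with hN
  have hNc : IsCompact N := (hA.prod (isCompact_sphere _ _)).inter_right (isClosed_isNull hρ)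
  have key : ∃ g : (Fin n → ℂ) → ℝ, ContDiff ℝ ∞ g ∧ (∀ z, 0 ≤ g z) ∧ (∀ z ∈ A, g z = 0) ∧
      (∀ p ∈ A, ∀ X, dirDeriv X (cplx g) p = 0 ∧ 0 ≤ lev g X p) ∧
      ∀ x ∈ N, x ∈ N → 0 < lev g x.2 x.1 := by
    refine hNc.induction_on (p := fun S => ∃ g : (Fin n → ℂ) → ℝ, ContDiff ℝ ∞ g ∧
      (∀ z, 0 ≤ g z) ∧ (∀ z ∈ A, g z = 0) ∧
      (∀ p ∈ A, ∀ X, dirDeriv X (cplx g) p = 0 ∧ 0 ≤ lev g X p) ∧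
      ∀ x ∈ S, x ∈ N → 0 < lev g x.2 x.1) ?_ ?_ ?_ ?_
    · refine ⟨fun _ => 0, contDiff_const, fun _ => le_rfl, fun _ _ => rfl, fun p _ X => ?_,
        fun x hx => hx.elim⟩
      have hc : ContDiffAt ℝ 2 (fun _ : Fin n → ℂ => (0 : ℝ)) p := contDiffAt_const
      have h1 := lev_const_mul 0 hc X
      have h2 := dirDeriv_mul (hc.differentiableAt two_ne) (hc.differentiableAt two_ne) X
      simp only [zero_mul, mul_zero, ofReal_zero, add_zero] at h1 h2
      exact ⟨h2, h1.ge⟩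
    · rintro s t hst ⟨g, h1, h2, h3, h4, h5⟩
      exact ⟨g, h1, h2, h3, h4, fun x hx => h5 x (hst hx)⟩
    · rintro s t ⟨g, h1, h2, h3, h4, h5⟩ ⟨g', h1', h2', h3', h4', h5'⟩
      have c : ∀ p, ContDiffAt ℝ 2 g p := fun p => (h1.of_le two_le_infty).contDiffAt
      have c' : ∀ p, ContDiffAt ℝ 2 g' p := fun p => (h1'.of_le two_le_infty).contDiffAt
      have hD : ∀ p X, dirDeriv X (cplx fun z => g z + g' z) p =
          dirDeriv X (cplx g) p + dirDeriv X (cplx g') p := fun p X =>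
        dirDeriv_add ((c p).differentiableAt two_ne) ((c' p).differentiableAt two_ne) X
      have hL : ∀ p X, lev (fun z => g z + g' z) X p = lev g X p + lev g' X p := fun p X =>
        lev_add (c p) (c' p) X
      refine ⟨fun z => g z + g' z, h1.add h1', fun z => add_nonneg (h2 z) (h2' z),
        fun z hz => by simp [h3 z hz, h3' z hz], fun p hp X => ?_, fun x hx hxN => ?_⟩
      · rw [hD, hL, (h4 p hp X).1, (h4' p hp X).1, add_zero]
        exact ⟨rfl, add_nonneg (h4 p hp X).2 (h4' p hp X).2⟩
      · rw [hL]
        rcases hx with hx | hx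
        · exact add_pos_of_pos_of_nonneg (h5 x hx hxN) (h4' _ hxN.1.1 _).2
        · exact add_pos_of_nonneg_of_pos (h4 _ hxN.1.1 _).2 (h5' x hx hxN)
    · rintro ⟨p, X⟩ ⟨⟨hp, hX⟩, hnull⟩
      have hX0 : X ≠ 0 := by
        rintro rfl
        simp at hX
      obtain ⟨f, hf, hf0, hfX⟩ := h p hp X hX0 hnull
      have c : ∀ p, ContDiffAt ℝ 2 f p := fun p => (hf.of_le two_le_infty).contDiffAt
      have hlev : ∀ q ∈ A, ∀ Y, lev (fun z => f z * f z) Y q = 2 * dsq f Y q := by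
        intro q hq Y
        rw [lev_mul (c q) (c q), hf0 q hq, mul_conj, ofReal_re]
        unfold dsq; ring
      refine ⟨{x | 0 < lev (fun z => f z * f z) x.2 x.1}, ?_, fun z => f z * f z, hf.mul hf,
        fun z => mul_self_nonneg _, fun z hz => by simp [hf0 z hz], fun q hq Y => ⟨?_, ?_⟩,
        fun x hx _ => hx⟩
      · refine mem_nhdsWithin_of_mem_nhds (((lev_continuous (hf.mul hf)).tendsto (p, X)
          ).eventually_const_lt ?_)
        simp only [hlev p hp]
        exact mul_pos two_pos (normSq_pos.2 hfX)
      · rw [dirDeriv_mul ((c q).differentiableAt two_ne) ((c q).differentiableAt two_ne),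
          hf0 q hq]
        simp
      · rw [hlev q hq]
        exact mul_nonneg two_pos.le (dsq_nonneg _ _ _)
  obtain ⟨g, hg, hg0, hgA, hgD, hgN⟩ := key
  obtain ⟨δ, hδ, hδN⟩ : ∃ δ, 0 < δ ∧ ∀ x ∈ N, δ ≤ lev g x.2 x.1 := by
    rcases N.eq_empty_or_nonempty with h0 | h0
    · exact ⟨1, one_pos, fun x hx => by rw [h0] at hx; exact hx.elim⟩
    · obtain ⟨x, hx, hmin⟩ := hNc.exists_isMinOn h0 (lev_continuous hg).continuousOn
      exact ⟨_, hgN x hx hx, fun y hy => hmin hy⟩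
  intro C
  set t := |C| / δ with ht
  have ht0 : 0 ≤ t := by positivity
  have hd : deriv (fun s : ℝ => 1 - Real.exp (-(t * s))) = fun s => t * Real.exp (-(t * s)) := by
    funext s
    simp [mul_comm]
  have hφ : ContDiff ℝ ∞ fun s : ℝ => 1 - Real.exp (-(t * s)) :=
    contDiff_const.sub (Real.contDiff_exp.comp (contDiff_const.mul contDiff_id).neg)
  refine ⟨fun z => 1 - Real.exp (-(t * g z)), hφ.comp hg, fun z => ⟨?_, ?_⟩, fun p hp X hX => ?_⟩
  · have : Real.exp (-(t * g z)) ≤ 1 := Real.exp_le_one_iff.2 (by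
      have := mul_nonneg ht0 (hg0 z); linarith)
    linarith
  · have := Real.exp_pos (-(t * g z)); linarith
  · rw [lev_comp (φ := fun s : ℝ => 1 - Real.exp (-(t * s)))
      (hg.of_le two_le_infty).contDiffAt (hφ.of_le two_le_infty).contDiffAt, hd, hgA p hp]
    have h1 : dsq g X p = 0 := by unfold dsq; rw [(hgD p hp X).1, map_zero]
    simp only [h1, mul_zero, neg_zero, Real.exp_zero, mul_one, add_zero]
    have h2 := le_of_forall_sphere (Q := fun X => lev g X p)
      (P := fun X => IsNull ρ p X) (m := δ)
      (fun c X => lev_smul g c X p) (fun c X h => IsNull.smul h c)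
      (fun X hX1 hXn => hδN (p, X) ⟨⟨hp, by simpa using hX1⟩, hXn⟩) X hX
    have h3 := mul_le_mul_of_nonneg_left h2 ht0
    rw [← mul_assoc, ht, div_mul_cancel₀ _ hδ.ne'] at h3
    exact le_trans (mul_le_mul_of_nonneg_right (le_abs_self C) (sq_nonneg _)) h3

theorem exists_real_of_complex {A : Set (Fin n → ℂ)} (f : smoothAlg n)
    (hf : ∀ z ∈ A, f.1 z = 0) {p X : Fin n → ℂ} (hX : ∑ j, X j * (pz j f).1 p ≠ 0) :
    ∃ g : (Fin n → ℂ) → ℝ, ContDiff ℝ ∞ g ∧ (∀ z ∈ A, g z = 0) ∧ dirDeriv X (cplx g) p ≠ 0 := by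
  have hre : ContDiff ℝ ∞ fun z => (f.1 z).re := Complex.reCLM.contDiff.comp (smC f)
  have him : ContDiff ℝ ∞ fun z => (f.1 z).im := Complex.imCLM.contDiff.comp (smC f)
  have heq : f = ofRealSmooth hre + I • ofRealSmooth him := by
    ext z
    change f.1 z = ((f.1 z).re : ℂ) + I * ((f.1 z).im : ℂ)
    rw [mul_comm, re_add_im]
  by_contra! hcon
  have h1 := hcon _ hre fun z hz => by rw [hf z hz, zero_re]
  have h2 := hcon _ him fun z hz => by rw [hf z hz, zero_im]
  rw [dirDeriv_eq (r := ofRealSmooth hre) fun z => rfl] at h1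
  rw [dirDeriv_eq (r := ofRealSmooth him) fun z => rfl] at h2
  apply hX
  have h3 : ∀ j, (pz j f).1 p = (pz j (ofRealSmooth hre)).1 p +
      I * (pz j (ofRealSmooth him)).1 p := fun j => by
    conv_lhs => rw [heq, map_add, Derivation.map_smul]
    rfl
  calc ∑ j, X j * (pz j f).1 p = ∑ j, X j * (pz j (ofRealSmooth hre)).1 p +
        I * ∑ j, X j * (pz j (ofRealSmooth him)).1 p := by
        rw [Finset.mul_sum, ← Finset.sum_add_distrib]
        exact Finset.sum_congr rfl fun j _ => by rw [h3]; ring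
    _ = 0 := by rw [h1, h2]; simp

theorem GoodOn.singleton {ρ : (Fin n → ℂ) → ℝ} (hρ : ContDiff ℝ ∞ ρ) (p : Fin n → ℂ) :
    GoodOn ρ {p} := by
  refine GoodOn.of_functions hρ isCompact_singleton ?_
  rintro q rfl X hX -
  obtain ⟨j, hj⟩ := Function.ne_iff.1 hX
  refine exists_real_of_complex (cz j - algebraMap ℂ _ (q j)) ?_ ?_
  · rintro z rfl
    exact sub_self _
  · have : ∀ i, (pz i (cz j - algebraMap ℂ (smoothAlg n) (q j))).1 q = if i = j then 1 else 0 := by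
      intro i
      rw [map_sub, Derivation.map_algebraMap, sub_zero, pz_cz]
      split_ifs <;> rfl
    simp only [this]
    simpa using hj

theorem GoodOn.of_finite {ρ : (Fin n → ℂ) → ℝ} (hρ : ContDiff ℝ ∞ ρ) {A : Set (Fin n → ℂ)}
    (hA : A.Finite) : GoodOn ρ A := by
  induction A, hA using Set.Finite.induction_on with
  | empty => exact GoodOn.empty
  | @insert a s _ hs ih => exact (GoodOn.singleton hρ a).union hρ isCompact_singleton hs.isCompact ih

end

section

variable {n : ℕ}

theorem exists_annihilated {m : ℕ} (hm : m < n) (v : Fin m → Fin n → smoothAlg n)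
    {q : Fin n → ℂ} (hv : LinearIndependent ℂ fun i j => (v i j).1 q) :
    ∃ a : Fin n → smoothAlg n, (∃ j, (a j).1 q ≠ 0) ∧ ∀ i, ∑ j, v i j * a j = 0 := by
  obtain ⟨W, hW⟩ := (Submodule.span ℂ (Set.range fun i j => (v i j).1 q)).exists_isCompl
  have hfr := Submodule.finrank_add_eq_of_isCompl hW
  rw [finrank_span_eq_card hv, Fintype.card_fin, Module.finrank_fin_fun] at hfr
  set d := Module.finrank ℂ W with hd
  let b := Module.finBasis ℂ W
  let w : Fin d → Fin n → ℂ := fun i => (b i : Fin n → ℂ)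
  have hw : LinearIndependent ℂ w := b.linearIndependent.map' W.subtype W.ker_subtype
  have hwW : Submodule.span ℂ (Set.range w) ≤ W := by
    rw [Submodule.span_le]
    rintro _ ⟨i, rfl⟩
    exact (b i).2
  have hvw := hv.sum_type hw (hW.disjoint.mono_right hwW)
  have hcard : Fintype.card (Fin n) = Fintype.card (Fin m ⊕ Fin d) := by simp [hfr]
  let e : Fin n ≃ Fin m ⊕ Fin d := Fintype.equivOfCardEq hcard
  let R : Fin m ⊕ Fin d → Fin n → smoothAlg n :=
    Sum.elim v fun i j => algebraMap ℂ (smoothAlg n) (w i j)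
  let M : Matrix (Fin n) (Fin n) (smoothAlg n) := Matrix.of fun i => R (e i)
  let ev : smoothAlg n →+* ℂ := (Pi.evalRingHom _ q).comp (smoothAlg n).val.toRingHom
  have hev : ∀ f, ev f = f.1 q := fun f => rfl
  have hdet : ev M.det ≠ 0 := by
    rw [RingHom.map_det]
    refine (Matrix.isUnit_iff_isUnit_det _).1 (Matrix.linearIndependent_rows_iff_isUnit.1 ?_) |>.ne_zero
    have h1 := hvw.comp e e.injective
    have h2 : (ev.mapMatrix M).row = Sum.elim (fun i j => (v i j).1 q) w ∘ e := by
      funext i j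
      change ev (R (e i) j) = _
      simp only [Function.comp]
      rcases e i with x | x
      · rfl
      · rfl
    rw [h2]
    exact h1
  have hd0 : 0 < d := by omega
  let i₀ : Fin n := e.symm (Sum.inr ⟨0, hd0⟩)
  have hadj : ∀ i, ∑ j, M i j * M.adjugate j i₀ = if i = i₀ then M.det else 0 := by
    intro i
    have := congrFun (congrFun M.mul_adjugate i) i₀
    rw [Matrix.mul_apply, Matrix.smul_apply, Matrix.one_apply] at this
    rw [this]
    split_ifs <;> simp
  refine ⟨fun j => M.adjugate j i₀, ?_, fun i => ?_⟩
  · by_contra! hcon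
    have h1 := congrArg ev (hadj i₀)
    rw [if_pos rfl, map_sum] at h1
    refine hdet (h1.symm.trans (Finset.sum_eq_zero fun j _ => ?_))
    rw [map_mul, hev (M.adjugate j i₀), hcon j, mul_zero]
  · have h1 := hadj (e.symm (Sum.inl i))
    rw [if_neg (by simp [i₀])] at h1
    have h2 : ∀ j, M (e.symm (Sum.inl i)) j = v i j := fun j => by
      simp [M, R]
    simpa only [h2] using h1

/-- The coefficient vectors of the linear conditions defining the degenerate tangent vectors. -/
def rowSet (T : Set (Fin n → ℂ)) (r : smoothAlg n) : Set (Fin n → smoothAlg n) :=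
  {c | (∃ f : smoothAlg n, (∀ z ∈ T, f.1 z = 0) ∧ c = fun j => pz j f) ∨
    ∃ i k, c = fun j => pz j (pzb i r) * pzb k r - pz j (pzb k r) * pzb i r}

/-- There are `m` linear conditions that are independent at `p`. -/
def HasIndepRows (T : Set (Fin n → ℂ)) (r : smoothAlg n) (m : ℕ) (p : Fin n → ℂ) : Prop :=
  ∃ v : Fin m → Fin n → smoothAlg n, (∀ i, v i ∈ rowSet T r) ∧
    LinearIndependent ℂ fun i j => (v i j).1 p

theorem levi_eq_sum {ρ : (Fin n → ℂ) → ℝ} {r : smoothAlg n} (hr : ∀ z, r.1 z = (ρ z : ℂ))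
    (X Y z : Fin n → ℂ) :
    levi ρ X Y z = ∑ k, (∑ j, X j * (pz j (pzb k r)).1 z) * (starRingEnd ℂ) (Y k) := by
  rw [levi_eq hr, Finset.sum_comm]
  refine Finset.sum_congr rfl fun k _ => ?_
  rw [Finset.sum_mul]
  exact Finset.sum_congr rfl fun j _ => by ring

theorem sum_row_eq (r : smoothAlg n) (X z : Fin n → ℂ) (i k : Fin n) :
    ∑ j, X j * (pz j (pzb i r) * pzb k r - pz j (pzb k r) * pzb i r).1 z =
      (∑ j, X j * (pz j (pzb i r)).1 z) * (pzb k r).1 z -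
      (∑ j, X j * (pz j (pzb k r)).1 z) * (pzb i r).1 z := by
  rw [Finset.sum_mul, Finset.sum_mul, ← Finset.sum_sub_distrib]
  refine Finset.sum_congr rfl fun j _ => ?_
  change X j * ((pz j (pzb i r)).1 z * (pzb k r).1 z - (pz j (pzb k r)).1 z * (pzb i r).1 z) = _
  ring

theorem pzb_eq_conj {ρ : (Fin n → ℂ) → ℝ} {r : smoothAlg n} (hr : ∀ z, r.1 z = (ρ z : ℂ))
    (k : Fin n) (z : Fin n → ℂ) : (pzb k r).1 z = (starRingEnd ℂ) ((pz k r).1 z) := by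
  have := pzb_cj k r
  rw [cj_of_real hr] at this
  rw [this, cj_apply]

theorem levi_eq_zero_of_rows {ρ : (Fin n → ℂ) → ℝ} {r : smoothAlg n} (hr : ∀ z, r.1 z = (ρ z : ℂ))
    {X Y z : Fin n → ℂ} (hX : ∀ i k, ∑ j, X j *
      (pz j (pzb i r) * pzb k r - pz j (pzb k r) * pzb i r).1 z = 0)
    (hY : dirDeriv Y (cplx ρ) z = 0) {k : Fin n} (hk : (pz k r).1 z ≠ 0) : levi ρ X Y z = 0 := by
  have hk' : (pzb k r).1 z ≠ 0 := by
    rw [pzb_eq_conj hr]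
    exact (map_ne_zero _).2 hk
  refine (mul_eq_zero.1 ?_).resolve_left hk'
  rw [levi_eq_sum hr, Finset.mul_sum]
  rw [dirDeriv_eq hr] at hY
  have h2 := congrArg (starRingEnd ℂ) hY
  rw [map_sum, map_zero] at h2
  calc _ = ∑ i, (∑ j, X j * (pz j (pzb k r)).1 z) * (starRingEnd ℂ) (Y i * (pz i r).1 z) := by
        refine Finset.sum_congr rfl fun i _ => ?_
        have h1 := hX i k
        rw [sum_row_eq] at h1
        rw [map_mul (starRingEnd ℂ), ← pzb_eq_conj hr]
        linear_combination (starRingEnd ℂ) (Y i) * h1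
    _ = 0 := by rw [← Finset.mul_sum, h2, mul_zero]

theorem rows_eq_zero_of_isNull {ρ : (Fin n → ℂ) → ℝ} {r : smoothAlg n}
    (hr : ∀ z, r.1 z = (ρ z : ℂ)) {p X : Fin n → ℂ} (hpsc : LeviPseudoconvexAt ρ p)
    (hX : IsNull ρ p X) (i k : Fin n) :
    ∑ j, X j * (pz j (pzb i r) * pzb k r - pz j (pzb k r) * pzb i r).1 p = 0 := by
  set Z : Fin n → ℂ := Pi.single i ((pz k r).1 p) - Pi.single k ((pz i r).1 p) with hZ
  have hZt : dirDeriv Z (cplx ρ) p = 0 := by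
    rw [dirDeriv_eq hr, hZ]
    simp only [Pi.sub_apply, sub_mul, Finset.sum_sub_distrib, Pi.single_apply, ite_mul, zero_mul,
      Finset.sum_ite_eq', Finset.mem_univ, if_true]
    ring
  have hL : levi ρ X Z p =
      ∑ j, X j * (pz j (pzb i r) * pzb k r - pz j (pzb k r) * pzb i r).1 p := by
    rw [levi_eq_sum hr, sum_row_eq, hZ, pzb_eq_conj hr, pzb_eq_conj hr]
    simp only [Pi.sub_apply, map_sub, mul_sub, Finset.sum_sub_distrib, Pi.single_apply,
      apply_ite (starRingEnd ℂ), map_zero, mul_ite, mul_zero,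
      Finset.sum_ite_eq', Finset.mem_univ, if_true]
  rw [← hL]
  by_contra hne
  have hpos : 0 < normSq (levi ρ X Z p) := normSq_pos.2 hne
  have key : ∀ N : ℝ, 0 ≤ lev ρ Z p - 2 * N * normSq (levi ρ X Z p) := by
    intro N
    set s : ℂ := -((N : ℂ) * (starRingEnd ℂ) (levi ρ X Z p)) with hs
    have h1 := hpsc (Z + s • X) (by
      rw [dirDeriv_add_left, dirDeriv_smul_left, hZt, hX.1, mul_zero, add_zero])
    have h2 : (levi ρ X X p).re = 0 := hX.2
    have h3 : levi ρ Z X p = (starRingEnd ℂ) (levi ρ X Z p) := (levi_conj hr X Z p).symm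
    rw [levi_add_left, levi_add_right, levi_add_right, levi_smul_left, levi_smul_left,
      levi_smul_right, levi_smul_right, h3] at h1
    have h4 : ((starRingEnd ℂ) s * levi ρ X X p * s).re = 0 := by
      rw [show (starRingEnd ℂ) s * levi ρ X X p * s = (s * (starRingEnd ℂ) s) * levi ρ X X p by ring,
        mul_conj, re_ofReal_mul, h2, mul_zero]
    have h5 : (s * levi ρ X Z p).re = -(N * normSq (levi ρ X Z p)) := by
      rw [hs, neg_mul, mul_assoc, mul_comm ((starRingEnd ℂ) _), mul_conj, neg_re, re_ofReal_mul,
        ofReal_re]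
    have h6 : ((starRingEnd ℂ) s * (starRingEnd ℂ) (levi ρ X Z p)).re =
        -(N * normSq (levi ρ X Z p)) := by
      rw [← map_mul (starRingEnd ℂ), conj_re, h5]
    have h7 : (s * ((starRingEnd ℂ) s * levi ρ X X p)).re = 0 := by
      rw [← h4]; congr 1; ring
    simp only [add_re] at h1
    rw [h5, h6, h7] at h1
    unfold lev
    linarith
  have := key ((lev ρ Z p + 1) / (2 * normSq (levi ρ X Z p)))
  rw [show 2 * ((lev ρ Z p + 1) / (2 * normSq (levi ρ X Z p))) * normSq (levi ρ X Z p) =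
    lev ρ Z p + 1 by field_simp] at this
  linarith

end

section

variable {n : ℕ}

theorem sum_mul_eq_zero_of_mem_span {m : ℕ} {v : Fin m → Fin n → ℂ} {X : Fin n → ℂ}
    (hX : ∀ i, ∑ j, X j * v i j = 0) {w : Fin n → ℂ} (hw : w ∈ Submodule.span ℂ (Set.range v)) :
    ∑ j, X j * w j = 0 := by
  induction hw using Submodule.span_induction with
  | mem x h => obtain ⟨i, rfl⟩ := h; exact hX i
  | zero => simp
  | add x y _ _ hx hy =>
    simp only [Pi.add_apply, mul_add, Finset.sum_add_distrib, hx, hy, add_zero]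
  | smul c x _ hx =>
    simp only [Pi.smul_apply, smul_eq_mul, mul_left_comm _ c, ← Finset.mul_sum, hx, mul_zero]

theorem GoodOn.of_locally {ρ : (Fin n → ℂ) → ℝ} (hρ : ContDiff ℝ ∞ ρ) {K D : Set (Fin n → ℂ)}
    (hK : IsCompact K) (hD : IsCompact D) (hDK : D ⊆ K)
    (h : ∀ p ∈ D, ∃ ε > 0, GoodOn ρ (K ∩ Metric.closedBall p ε)) : GoodOn ρ D := by
  suffices ∃ L, IsCompact L ∧ GoodOn ρ L ∧ D ⊆ L by
    obtain ⟨L, _, h2, h3⟩ := this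
    exact h2.mono h3
  have : ∃ L, IsCompact L ∧ GoodOn ρ L ∧ D ∩ K ⊆ L := by
    refine hD.induction_on (p := fun S => ∃ L, IsCompact L ∧ GoodOn ρ L ∧ S ∩ K ⊆ L) ?_ ?_ ?_ ?_
    · exact ⟨∅, isCompact_empty, GoodOn.empty, by simp⟩
    · rintro s t hst ⟨L, h1, h2, h3⟩
      exact ⟨L, h1, h2, (Set.inter_subset_inter_left K hst).trans h3⟩
    · rintro s t ⟨L, h1, h2, h3⟩ ⟨L', h1', h2', h3'⟩
      refine ⟨L ∪ L', h1.union h1', h2.union hρ h1 h1' h2', ?_⟩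
      rw [Set.union_inter_distrib_right]
      exact Set.union_subset_union h3 h3'
    · intro p hp
      obtain ⟨ε, hε, hg⟩ := h p hp
      refine ⟨Metric.closedBall p ε, mem_nhdsWithin_of_mem_nhds (Metric.closedBall_mem_nhds p hε),
        K ∩ Metric.closedBall p ε, hK.inter_right Metric.isClosed_closedBall, hg, ?_⟩
      rw [Set.inter_comm]
  rwa [Set.inter_eq_left.2 hDK] at this

theorem rowSet.mem_span {T : Set (Fin n → ℂ)} {r : smoothAlg n} {m : ℕ} {p : Fin n → ℂ}
    {v : Fin m → Fin n → smoothAlg n} (hv : ∀ i, v i ∈ rowSet T r)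
    (hli : LinearIndependent ℂ fun i j => (v i j).1 p) (hmax : ¬ HasIndepRows T r (m + 1) p)
    {c : Fin n → smoothAlg n} (hc : c ∈ rowSet T r) :
    (fun j => (c j).1 p) ∈ Submodule.span ℂ (Set.range fun i j => (v i j).1 p) := by
  by_contra hcon
  refine hmax ⟨Fin.snoc v c, fun i => ?_, ?_⟩
  · refine Fin.lastCases ?_ (fun i => ?_) i
    · simpa using hc
    · simpa using hv i
  · have h1 := linearIndependent_finSnoc.2 ⟨hli, hcon⟩
    have h2 : (fun (i : Fin (m + 1)) j =>
        ((Fin.snoc v c : Fin (m + 1) → Fin n → smoothAlg n) i j).1 p) =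
        Fin.snoc (α := fun _ => Fin n → ℂ) (fun i j => (v i j).1 p) fun j => (c j).1 p := by
      funext i
      refine Fin.lastCases ?_ (fun i => ?_) i
      · simp
      · simp
    rw [h2]
    exact h1

theorem Bd.exists_annihilating_field {K B : Set (Fin n → ℂ)} {r : smoothAlg n}
    {ρ : (Fin n → ℂ) → ℝ} (H : Bd K r ρ) (hBK : B ⊆ K) {U : Set (Fin n → ℂ)} (hU : IsOpen U)
    {q : Fin n → ℂ} (hqU : q ∈ U) {a : Fin n → smoothAlg n}
    (ha : ∀ p ∈ B ∩ U, ∀ c ∈ rowSet B r, ∑ j, (a j).1 p * (c j).1 p = 0) :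
    ∃ a' : Fin n → smoothAlg n, StepB B r ρ a' ∧ ∀ j, (a' j).1 q = (a j).1 q := by
  obtain ⟨χ, hχ, h0, h1, -⟩ := exists_cutoff (s := Uᶜ) (t := {q}) hU.isClosed_compl
    isClosed_singleton (by simpa using hqU)
  have hχ0 : ∀ p, p ∉ U → χ p = 0 := fun p hp =>
    (eventually_nhdsSet_iff_forall.1 h0 p hp).self_of_nhds
  have hχ1 : χ q = 1 := (eventually_nhdsSet_iff_forall.1 h1 q rfl).self_of_nhds
  have happ : ∀ j p, (ofRealSmooth hχ * a j).1 p = (χ p : ℂ) * (a j).1 p := fun j p => rfl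
  have ha' : ∀ p ∈ B, ∀ c ∈ rowSet B r, ∑ j, (ofRealSmooth hχ * a j).1 p * (c j).1 p = 0 := by
    intro p hp c hc
    simp only [happ, mul_assoc, ← Finset.mul_sum]
    by_cases hpU : p ∈ U
    · rw [ha p ⟨hp, hpU⟩ c hc, mul_zero]
    · rw [hχ0 p hpU, ofReal_zero, zero_mul]
  refine ⟨fun j => ofRealSmooth hχ * a j, ⟨H.hr, fun p hp => H.zero p (hBK hp), ?_, ?_,
    fun p hp => H.lower p (hBK hp)⟩, fun j => by rw [happ, hχ1, ofReal_one, one_mul]⟩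
  · intro p hp f hf
    exact ha' p hp _ (Or.inl ⟨f, hf, rfl⟩)
  · intro p hp X hX
    have hd : DifferentiableAt ℝ ρ p := (smooth_of_eq H.hr).differentiable (by simp) p
    obtain ⟨ν, hν⟩ := dirDeriv_ne_zero hd (H.grad p (hBK hp))
    rw [dirDeriv_eq H.hr] at hν
    obtain ⟨k, -, hk⟩ := Finset.exists_ne_zero_of_sum_ne_zero hν
    exact levi_eq_zero_of_rows H.hr (fun i k => ha' p hp _ (Or.inr ⟨i, k, rfl⟩)) hX
      (right_ne_zero_of_mul hk)

theorem Bd.goodOn_of_span {K A B : Set (Fin n → ℂ)} {r : smoothAlg n}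
    {ρ : (Fin n → ℂ) → ℝ} (H : Bd K r ρ) (hA : IsCompact A) (hAB : A ⊆ B) (hBK : B ⊆ K)
    (h : ∀ p ∈ A, ∀ X : Fin n → ℂ, (∀ c ∈ rowSet B r, ∑ j, X j * (c j).1 p = 0) → X = 0) :
    GoodOn ρ A := by
  refine GoodOn.of_functions (smooth_of_eq H.hr) hA fun p hp X hX0 hX => ?_
  by_contra hcon
  refine hX0 (h p hp X ?_)
  rintro c (⟨f, hf, rfl⟩ | ⟨i, k, rfl⟩)
  · by_contra hne
    exact hcon (exists_real_of_complex f (fun z hz => hf z (hAB hz)) hne)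
  · exact rows_eq_zero_of_isNull H.hr (H.psc p (hBK (hAB hp))) hX i k

theorem Bd.goodOn {K : Set (Fin n → ℂ)} {r : smoothAlg n} {ρ : (Fin n → ℂ) → ℝ}
    (H : Bd K r ρ) (hfin : {p ∈ K | ¬ FiniteTypePt ρ p}.Finite) : GoodOn ρ K := by
  have hs := smooth_of_eq H.hr
  set P := {p ∈ K | ¬ FiniteTypePt ρ p} with hP
  set B : Set (Fin n → ℂ) := {p ∈ K | ∀ ε > 0, ¬ GoodOn ρ (K ∩ Metric.closedBall p ε)} with hB
  have hBK : B ⊆ K := fun p hp => hp.1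
  have hBcl : IsClosed B := by
    rw [← isOpen_compl_iff, Metric.isOpen_iff]
    intro p hp
    by_cases hpK : p ∈ K
    · have : ∃ ε > 0, GoodOn ρ (K ∩ Metric.closedBall p ε) := by
        by_contra! hcon
        exact hp ⟨hpK, hcon⟩
      obtain ⟨ε, hε, hg⟩ := this
      refine ⟨ε / 2, by positivity, fun z hz hzB => hzB.2 (ε / 2) (by positivity) (hg.mono ?_)⟩
      refine Set.inter_subset_inter_right _ (Metric.closedBall_subset_closedBall' ?_)
      have := Metric.mem_ball.1 hz
      linarith
    · obtain ⟨ε, hε, h⟩ := Metric.isOpen_iff.1 H.cpt.isClosed.isOpen_compl p hpK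
      exact ⟨ε, hε, fun z hz hzB => h hz (hBK hzB)⟩
  have hBc : IsCompact B := H.cpt.of_isClosed_subset hBcl hBK
  have hout : ∀ D ⊆ K, IsCompact D → Disjoint D B → GoodOn ρ D := by
    intro D hDK hD hDB
    refine GoodOn.of_locally hs H.cpt hD hDK fun p hp => ?_
    by_contra! hcon
    exact Set.disjoint_left.1 hDB hp ⟨hDK hp, hcon⟩
  have hloc : ∀ q ∈ B, ∀ ε > 0, ¬ GoodOn ρ (B ∩ Metric.closedBall q ε) := by
    intro q hq ε hε hg
    refine hq.2 ε hε (GoodOn.glue hs (hBc.inter_right Metric.isClosed_closedBall)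
      (H.cpt.inter_right Metric.isClosed_closedBall) hg fun D hD hDc hdis => ?_)
    refine hout D (hD.trans Set.inter_subset_left) hDc ?_
    rw [Set.disjoint_left] at hdis ⊢
    exact fun z hz hzB => hdis hz ⟨hzB, (hD hz).2⟩
  by_cases hBP : B ⊆ P
  · exact GoodOn.glue hs hBc H.cpt (GoodOn.of_finite hs (hfin.subset hBP)) hout
  exfalso
  obtain ⟨q₀, hq₀B, hq₀P⟩ := Set.not_subset.1 hBP
  let S : Set ℕ := {m | ∃ q ∈ B, q ∉ P ∧ HasIndepRows B r m q}
  have hS0 : S.Nonempty := ⟨0, q₀, hq₀B, hq₀P, Fin.elim0, fun i => i.elim0,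
    linearIndependent_empty_type⟩
  have hSn : ∀ m ∈ S, m ≤ n := by
    rintro m ⟨q, -, -, v, -, hv⟩
    simpa using hv.fintype_card_le_finrank
  have hSb : BddAbove S := ⟨n, hSn⟩
  have hmS := Nat.sSup_mem hS0 hSb
  set m := sSup S with hm
  have hmax : m + 1 ∉ S := fun h => by
    have := le_csSup hSb h
    omega
  obtain ⟨q, hqB, hqP, v, hv, hvq⟩ := hmS
  have hcont : Continuous fun p : Fin n → ℂ => fun (i : Fin m) (j : Fin n) => (v i j).1 p :=
    continuous_pi fun i => continuous_pi fun j => (smC (v i j)).continuous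
  have hev : ∀ᶠ p in 𝓝 q, (LinearIndependent ℂ fun i j => (v i j).1 p) ∧ p ∉ P :=
    (hcont.continuousAt.eventually hvq.eventually).and
      (hfin.isClosed.isOpen_compl.mem_nhds hqP)
  have hkey : ∀ᶠ p in 𝓝 q, p ∈ B → (LinearIndependent ℂ fun i j => (v i j).1 p) ∧
      ∀ X : Fin n → ℂ, (∀ i, ∑ j, X j * (v i j).1 p = 0) → ∀ c ∈ rowSet B r,
        ∑ j, X j * (c j).1 p = 0 := by
    filter_upwards [hev] with p hp hpB
    refine ⟨hp.1, fun X hX c hc => ?_⟩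
    exact sum_mul_eq_zero_of_mem_span hX (rowSet.mem_span hv hp.1
      (fun h => hmax ⟨p, hpB, hp.2, h⟩) hc)
  obtain ⟨ε, hε, hball⟩ := Metric.eventually_nhds_iff_ball.1 hkey
  rcases (hSn m ⟨q, hqB, hqP, v, hv, hvq⟩).eq_or_lt with hmn | hmn
  · refine hloc q hqB (ε / 2) (by positivity) (H.goodOn_of_span
      (hBc.inter_right Metric.isClosed_closedBall) Set.inter_subset_left hBK ?_)
    rintro p ⟨hpB, hpe⟩ X hX
    have hli := (hball p (Metric.closedBall_subset_ball (by linarith) hpe) hpB).1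
    have hspan := hli.span_eq_top_of_card_eq_finrank' (by simp [hmn])
    funext j
    have h1 : (Pi.single j 1 : Fin n → ℂ) ∈
        Submodule.span ℂ (Set.range fun i j => (v i j).1 p) := hspan ▸ Submodule.mem_top
    have := sum_mul_eq_zero_of_mem_span (fun i => hX _ (hv i)) h1
    simpa [Pi.single_apply] using this
  · obtain ⟨a, ⟨j, hj⟩, ha⟩ := exists_annihilated hmn v hvq
    have hak : ∀ p i, ∑ j, (a j).1 p * (v i j).1 p = 0 := by
      intro p i
      let ev : smoothAlg n →+* ℂ := (Pi.evalRingHom _ p).comp (smoothAlg n).val.toRingHom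
      have := congrArg ev (ha i)
      rw [map_sum, map_zero] at this
      rw [← this]
      refine Finset.sum_congr rfl fun j _ => ?_
      rw [map_mul, mul_comm]
      rfl
    obtain ⟨a', h1, h2⟩ := H.exists_annihilating_field hBK Metric.isOpen_ball
      (Metric.mem_ball_self hε) (a := a) fun p hp => (hball p hp.2 hp.1).2 _ (hak p)
    exact hqP ⟨hBK hqB, not_finiteTypePt h1 hqB (j := j) (by rwa [h2])⟩

end

section

variable {n : ℕ}

theorem FiniteTypePt.congr_germ {f g : (Fin n → ℂ) → ℝ} {p : Fin n → ℂ} (h : f =ᶠ[𝓝 p] g)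
    (hf : FiniteTypePt f p) : FiniteTypePt g p := by
  obtain ⟨M, hM⟩ := hf
  refine ⟨M, fun γ hγ h0 hne => ?_⟩
  have hc : ContinuousAt γ 0 := continuousAt_pi.2 fun j => (hγ j).continuousAt
  have h1 : (fun t => f (γ t)) =ᶠ[𝓝 0] fun t => g (γ t) := by
    unfold ContinuousAt at hc
    rw [h0] at hc
    exact hc.eventually h
  have h2 : orderR (fun t => g (γ t)) = orderR fun t => f (γ t) := by
    unfold orderR
    have : ∀ k, iteratedFDeriv ℝ k (fun t => g (γ t)) 0 = iteratedFDeriv ℝ k (fun t => f (γ t)) 0 :=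
      fun k => (h1.symm.iteratedFDeriv ℝ k).eq_of_nhds
    simp only [this]
  rw [h2]
  exact hM γ hγ h0 hne

theorem mem_closure_neg_of_fderiv_ne_zero {f : (Fin n → ℂ) → ℝ} {z : Fin n → ℂ}
    (h0 : f z = 0) (hd : fderiv ℝ f z ≠ 0) : ∃ᶠ w in 𝓝 z, f w < 0 := by
  intro hcon
  refine hd (IsLocalMin.fderiv_eq_zero ?_)
  filter_upwards [hcon] with w hw
  rw [h0]
  exact not_lt.1 hw

theorem IsDefFn.exists_global {Ω V : Set (Fin n → ℂ)} {ρ : (Fin n → ℂ) → ℝ}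
    (hdef : IsDefFn Ω V ρ) : ∃ ρ' : (Fin n → ℂ) → ℝ, ContDiff ℝ ∞ ρ' ∧
      ∀ p ∈ frontier Ω, ρ' =ᶠ[𝓝 p] ρ := by
  have hKV : frontier Ω ⊆ V := frontier_subset_closure.trans hdef.subset
  obtain ⟨χ, hχ, h0, h1, -⟩ := exists_cutoff (s := Vᶜ) (t := frontier Ω)
    hdef.isOpen.isClosed_compl isClosed_frontier
    (Set.disjoint_left.2 fun z hz hzK => hz (hKV hzK))
  refine ⟨fun z => χ z * ρ z, ?_, fun p hp => ?_⟩
  · rw [contDiff_iff_contDiffAt]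
    intro z
    by_cases hz : z ∈ V
    · exact hχ.contDiffAt.mul (hdef.smooth.contDiffAt (hdef.isOpen.mem_nhds hz))
    · have : (fun z => χ z * ρ z) =ᶠ[𝓝 z] fun _ => 0 :=
        (eventually_nhdsSet_iff_forall.1 h0 z hz).mono fun w hw => by
          change χ w * ρ w = 0
          rw [hw, zero_mul]
      exact contDiffAt_const.congr_of_eventuallyEq this
  · exact (eventually_nhdsSet_iff_forall.1 h1 p hp).mono fun w hw => by
      change χ w * ρ w = ρ w
      rw [hw, one_mul]

theorem IsDefFn.eq_zero {Ω V : Set (Fin n → ℂ)} {ρ : (Fin n → ℂ) → ℝ}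
    (hdef : IsDefFn Ω V ρ) (hΩ : IsOpen Ω) {p : Fin n → ℂ} (hp : p ∈ frontier Ω) : ρ p = 0 := by
  have hpV : p ∈ V := hdef.subset (frontier_subset_closure hp)
  have hpΩ : p ∉ Ω := (hΩ.frontier_eq ▸ hp).2
  refine le_antisymm ?_ ?_
  · have hc : ContinuousAt ρ p := (hdef.smooth.contDiffAt (hdef.isOpen.mem_nhds hpV)).continuousAt
    by_contra! hpos
    have h1 : ∀ᶠ z in 𝓝 p, 0 < ρ z := hc.eventually_const_lt hpos
    obtain ⟨z, hz, hzΩ⟩ := mem_closure_iff_nhds.1 (frontier_subset_closure hp) _ h1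
    rw [hdef.eq] at hzΩ
    exact lt_asymm hz hzΩ.2
  · by_contra! hneg
    rw [hdef.eq] at hpΩ
    exact hpΩ ⟨hpV, hneg⟩

theorem IsDefFn.bd {Ω V : Set (Fin n → ℂ)} {ρ ρ' : (Fin n → ℂ) → ℝ}
    (hdef : IsDefFn Ω V ρ) (hΩ : IsOpen Ω) (hbd : Bornology.IsBounded Ω)
    (hpsc : ∀ q ∈ frontier Ω, LeviPseudoconvexAt ρ q) (hρ : ContDiff ℝ ∞ ρ')
    (heq : ∀ p ∈ frontier Ω, ρ' =ᶠ[𝓝 p] ρ) : Bd (frontier Ω) (ofRealSmooth hρ) ρ' := by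
  have hgrad : ∀ p ∈ frontier Ω, fderiv ℝ ρ' p ≠ 0 := fun p hp => by
    rw [(heq p hp).fderiv_eq]
    exact hdef.grad_ne p hp
  refine ⟨fun z => rfl, hbd.isCompact_closure.of_isClosed_subset isClosed_frontier
    frontier_subset_closure, fun p hp => ?_, fun p hp => ?_, hgrad, fun p hp X hX => ?_⟩
  · rw [Filter.EventuallyEq.eq_of_nhds (f := ρ') (g := ρ) (heq p hp)]
    exact hdef.eq_zero hΩ hp
  · have hpV : p ∈ V := hdef.subset (frontier_subset_closure hp)
    have h1 : ∀ᶠ z in 𝓝 p, fderiv ℝ ρ' z ≠ 0 :=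
      (hρ.continuous_fderiv (by simp)).continuousAt.eventually_ne (hgrad p hp)
    filter_upwards [h1, (heq p hp).eventually_nhds, hdef.isOpen.mem_nhds hpV] with z hz1 hz2 hz3 hz0
    have hz2' : ρ' z = ρ z := Filter.EventuallyEq.eq_of_nhds (f := ρ') (g := ρ) hz2
    rw [hΩ.frontier_eq]
    refine ⟨?_, fun hzΩ => ?_⟩
    · refine mem_closure_iff_frequently.2 ?_
      refine ((mem_closure_neg_of_fderiv_ne_zero hz0 hz1).and_eventually
        (hz2.and (hdef.isOpen.mem_nhds hz3))).mono ?_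
      rintro w ⟨hw1, hw2, hw3⟩
      rw [hdef.eq]
      exact ⟨hw3, hw2 ▸ hw1⟩
    · rw [hdef.eq] at hzΩ
      have := hzΩ.2
      rw [← hz2', hz0] at this
      exact lt_irrefl _ this
  · rw [dirDeriv_congr (cplx_congr (heq p hp))] at hX
    rw [levi_congr (heq p hp)]
    exact hpsc p hp X hX

end

/-- Corollary 6.5: if the set of infinite type boundary points of `Ω` is
finite, then `S(Ω) = 1`. -/
theorem steinIndex_eq_one_of_finitely_many_infinite_type {n : ℕ} (hn : 2 ≤ n)
    (Ω V : Set (Fin n → ℂ)) (ρ : (Fin n → ℂ) → ℝ)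
    (hΩ : IsOpen Ω) (hbd : Bornology.IsBounded Ω)
    (hdef : IsDefFn Ω V ρ) (hpsc : ∀ q ∈ frontier Ω, LeviPseudoconvexAt ρ q)
    (hfin : {p ∈ frontier Ω | ¬ FiniteTypePt ρ p}.Finite) :
    steinIndex Ω = 1 := by
  obtain ⟨ρ', hρ', heq⟩ := hdef.exists_global
  have H := hdef.bd hΩ hbd hpsc hρ' heq
  refine steinIndex_eq_one_of_goodOn hdef H heq (H.goodOn (hfin.subset ?_))
  exact fun p hp => ⟨hp.1, fun h => hp.2 (h.congr_germ (heq p hp.1).symm)⟩
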